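/- Let 0 ≤ α, β < ∞, 1 < r ≤ q < ∞. Assume α + β > 2/q − 1/2 and that one of the following holds: (iii) max{α,β} > 1/q and 2·min{α,β} = 2/q − 1/r′; (iv) max{α,β} < 1/q and α + β + min{α,β} = 3/q − 1/r′. Then there is a constant C > 0 such that for every measurable F : ℝ → ℂ one has ‖R*_{α,β}F‖_{L^q(ℝ²)} ≤ C · ‖F‖_{L^r(S¹)}. -/

import Mathlib

open MeasureTheory Real Set Filter
open scoped ENNReal
noncomputable section


/-- Fourier extension operator of the unit circle,
`(R*F)(x,y) = (1/(2π)) ∫_0^{2π} F(φ) exp(i(x cos φ + y sin φ)) dφ`. -/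
def Rext (F : ℝ → ℂ) (x y : ℝ) : ℂ :=
  Complex.ofReal (1 / (2 * π)) *
    ∫ φ in (0:ℝ)..(2 * π),
      F φ * Complex.exp (Complex.I * Complex.ofReal (x * Real.cos φ + y * Real.sin φ))

/-- Weighted extension operator with product weight `(1+|x|)^{-α}(1+|y|)^{-β}`. -/
def Rab (α β : ℝ) (F : ℝ → ℂ) (x y : ℝ) : ℂ :=
  Rext F x y * Complex.ofReal ((1 + |x|) ^ (-α) * (1 + |y|) ^ (-β))

/-- Weighted extension operator with weight `(1+|x|+|y|)^{-γ}`. -/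
def Rgamma (γ : ℝ) (F : ℝ → ℂ) (x y : ℝ) : ℂ :=
  Rext F x y * Complex.ofReal ((1 + |x| + |y|) ^ (-γ))

/-- `L^r` norm on the circle, parametrized by `[0, 2π]`. -/
def circleLp (r : ℝ≥0∞) (F : ℝ → ℂ) : ℝ≥0∞ :=
  eLpNorm F r (volume.restrict (Ioc (0:ℝ) (2 * π)))

/-- `L^q` quasinorm on the plane. -/
def planeLp (q : ℝ≥0∞) (g : ℝ × ℝ → ℂ) : ℝ≥0∞ :=
  eLpNorm g q (volume : Measure (ℝ × ℝ))

/-- Weak `L^q` quasinorm on the line. -/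
def wline (q : ℝ) (g : ℝ → ℂ) : ℝ≥0∞ :=
  ⨆ (t : ℝ) (_ : 0 < t), ENNReal.ofReal t * (volume {x : ℝ | t < ‖g x‖}) ^ (1 / q)

/-- Weak `L^q` quasinorm on the line, for `ℝ≥0∞`-valued functions. -/
def wlineE (q : ℝ) (g : ℝ → ℝ≥0∞) : ℝ≥0∞ :=
  ⨆ (t : ℝ) (_ : 0 < t), ENNReal.ofReal t * (volume {x : ℝ | ENNReal.ofReal t < g x}) ^ (1 / q)

/-- Mixed weak quasinorm `L^{q,∞}_x(L^{q,∞}_y)`. -/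
def mixedXY (q : ℝ) (g : ℝ × ℝ → ℂ) : ℝ≥0∞ :=
  wlineE q fun x => wline q fun y => g (x, y)

/-- Mixed weak quasinorm `L^{q,∞}_y(L^{q,∞}_x)`. -/
def mixedYX (q : ℝ) (g : ℝ × ℝ → ℂ) : ℝ≥0∞ :=
  wlineE q fun y => wline q fun x => g (x, y)

/-- Weak `L^q` quasinorm on the plane. -/
def wplane (q : ℝ) (g : ℝ × ℝ → ℂ) : ℝ≥0∞ :=
  ⨆ (t : ℝ) (_ : 0 < t), ENNReal.ofReal t * (volume {p : ℝ × ℝ | t < ‖g p‖}) ^ (1 / q)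

/-- Lorentz `L^{r,1}` norm on the circle. -/
def lorentz1 (r : ℝ) (F : ℝ → ℂ) : ℝ≥0∞ :=
  ∫⁻ t in Ioi (0:ℝ), (volume {φ ∈ Icc (0:ℝ) (2 * π) | t < ‖F φ‖}) ^ (1 / r)

/-- Weak `L^r` quasinorm on the circle. -/
def wcircle (r : ℝ) (F : ℝ → ℂ) : ℝ≥0∞ :=
  ⨆ (t : ℝ) (_ : 0 < t), ENNReal.ofReal t * (volume {φ ∈ Icc (0:ℝ) (2 * π) | t < ‖F φ‖}) ^ (1 / r)


open scoped FourierTransform SchwartzMap in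
theorem plan_aux {V : Type*} [NormedAddCommGroup V] [InnerProductSpace ℝ V] [FiniteDimensional ℝ V]
    [MeasurableSpace V] [BorelSpace V] (g : V → ℂ) (h1 : Integrable g volume) (h2 : MemLp g 2 volume) :
    eLpNorm (𝓕 g) 2 volume ≤ eLpNorm g 2 volume := by
  have key : (𝓕 (h2.toLp g) : Lp ℂ 2 (volume : Measure V)) =ᵐ[volume] 𝓕 g := by
    apply ae_eq_of_integral_contDiff_smul_eq
    · exact (Lp.memLp _).locallyIntegrable (by norm_num)
    · have : Continuous (𝓕 g) := by
        exact VectorFourier.fourierIntegral_continuous Real.continuous_fourierChar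
          (L := innerₗ V) continuous_inner h1
      exact this.locallyIntegrable
    · intro φ hφ hc
      have hg₁ : HasCompactSupport (Complex.ofRealCLM ∘ φ) := hc.comp_left rfl
      have hg₂ : ContDiff ℝ (⊤ : ℕ∞) (Complex.ofRealCLM ∘ φ) := by fun_prop
      set ψ : 𝓢(V, ℂ) := hg₁.toSchwartzMap hg₂ with hψ
      have e1 := congrArg (fun T => T ψ) (Lp.fourier_toTemperedDistribution_eq (h2.toLp g))
      simp only [TemperedDistribution.fourier_apply, Lp.toTemperedDistribution_apply] at e1
      have e2 : ∫ x, φ x • (𝓕 (h2.toLp g) : Lp ℂ 2 (volume : Measure V)) x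
          = ∫ x, ψ x • (𝓕 (h2.toLp g) : Lp ℂ 2 (volume : Measure V)) x := by
        simp [hψ]
      have e3 : ∫ x, φ x • (𝓕 g) x = ∫ x, ψ x • 𝓕 g x := by
        simp [hψ]
      rw [e2, e3, ← e1]
      have e4 := VectorFourier.integral_fourierIntegral_smul_eq_flip (L := innerₗ V) (μ := volume) (ν := volume) (f := ψ) (g := g)
        Real.continuous_fourierChar continuous_inner ψ.integrable h1
      have e5 : ∫ x, (𝓕 ψ) x • (h2.toLp g) x = ∫ x, (𝓕 ψ) x • g x := by
        apply integral_congr_ae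
        filter_upwards [h2.coeFn_toLp] with x hx
        rw [hx]
      rw [e5]
      simpa using! e4
  rw [← eLpNorm_congr_ae key, ← eLpNorm_congr_ae h2.coeFn_toLp]
  have := Lp.norm_fourier_eq (h2.toLp g)
  rw [Lp.norm_def, Lp.norm_def, ENNReal.toReal_eq_toReal_iff' (Lp.eLpNorm_ne_top _) (Lp.eLpNorm_ne_top _)] at this
  exact this.le

open scoped FourierTransform in
theorem plan_l {V : Type*} [NormedAddCommGroup V] [InnerProductSpace ℝ V] [FiniteDimensional ℝ V]
    [MeasurableSpace V] [BorelSpace V] (g : V → ℂ) (h1 : Integrable g volume) :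
    ∫⁻ w, ‖𝓕 g w‖ₑ ^ (2:ℝ) ≤ ∫⁻ v, ‖g v‖ₑ ^ (2:ℝ) := by
  by_cases h : ∫⁻ v, ‖g v‖ₑ ^ (2:ℝ) = ∞
  · rw [h]; exact le_top
  have h2 : MemLp g 2 volume := by
    refine ⟨h1.1, ?_⟩
    rw [eLpNorm_lt_top_iff_lintegral_rpow_enorm_lt_top (by norm_num) (by norm_num)]
    simpa using lt_top_iff_ne_top.2 h
  have := plan_aux g h1 h2
  rw [eLpNorm_eq_lintegral_rpow_enorm_toReal (by norm_num) (by norm_num), eLpNorm_eq_lintegral_rpow_enorm_toReal (by norm_num) (by norm_num)] at this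
  rw [ENNReal.rpow_le_rpow_iff (by norm_num)] at this
  simpa using this

theorem enorm_rpow_eq {E : Type*} [NormedAddCommGroup E] (x : E) {p : ℝ} (hp : 0 ≤ p) : ‖x‖ₑ ^ p = ENNReal.ofReal (‖x‖ ^ p) := by
  rw [← ofReal_norm, ENNReal.ofReal_rpow_of_nonneg (norm_nonneg _) hp]

open scoped FourierTransform in
theorem HY_meas {V : Type*} [NormedAddCommGroup V] [InnerProductSpace ℝ V] [FiniteDimensional ℝ V]
    [MeasurableSpace V] [BorelSpace V] {s : ℝ} (hs1 : 1 < s) (hs2 : s < 2) (g : V → ℂ) (hgm : Measurable g)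
    (h1 : Integrable g volume) :
    ∫⁻ w, ‖𝓕 g w‖ₑ ^ (s / (s - 1)) ≤
      ENNReal.ofReal (4 * (s / (s - 1)) * 2 ^ (s / (s-1) - 2) / (s / (s-1) - 2)) * (∫⁻ v, ‖g v‖ₑ ^ s) ^ (1 / (s - 1)) := by
  set s' := s / (s - 1) with hs'
  have hs0 : 0 < s - 1 := by linarith
  have hs'2 : 2 < s' := by rw [hs', lt_div_iff₀ hs0]; linarith
  set k := 1 / (s - 1) with hk
  have hk0 : 0 < k := by positivity
  have hsk : s' = k + 1 := by rw [hs', hk]; field_simp; ring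
  have hkk : k * (s - 1) = 1 := by rw [hk]; field_simp
  set A := ∫⁻ v, ‖g v‖ₑ ^ s with hA
  have hCpos : 0 < 4 * s' * 2 ^ (s' - 2) / (s' - 2) := by
    have : 0 < s' - 2 := by linarith
    have : 0 < s' := by linarith
    positivity
  by_cases hAtop : A = ∞
  · rw [hAtop, ENNReal.top_rpow_of_pos hk0, ENNReal.mul_top]
    · exact le_top
    · simpa using hCpos
  by_cases hA0 : A = 0
  · have : g =ᵐ[volume] 0 := by
      rw [hA, lintegral_eq_zero_iff (by fun_prop)] at hA0
      filter_upwards [hA0] with v hv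
      simpa [ENNReal.rpow_eq_zero_iff, (by linarith : 0 < s), (by linarith : ¬ s < 0)] using hv
    have hz : ∀ w, 𝓕 g w = 0 := by
      intro w
      rw [Real.fourier_eq]
      rw [integral_eq_zero_of_ae]
      filter_upwards [this] with v hv
      simp [hv]
    simp [hz, (by linarith : 0 < s')]
  set a := A.toReal with ha
  have ha0 : 0 < a := ENNReal.toReal_pos hA0 hAtop
  have haA : A = ENNReal.ofReal a := (ENNReal.ofReal_toReal hAtop).symm
  set h : ℝ → ℝ := fun t => (2 * a / t) ^ k with hh
  have hhm : Measurable h := by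
    rw [hh]; fun_prop
  -- level set bound
  have lev : ∀ t, 0 < t → volume {w | t < ‖𝓕 g w‖} ≤
      ENNReal.ofReal (4 * t ^ (-2 : ℝ)) * ∫⁻ v, {v | ‖g v‖ ≤ h t}.indicator (fun v => ‖g v‖ₑ ^ (2:ℝ)) v := by
    intro t ht
    have hht : 0 < h t := by rw [hh]; positivity
    have hB : MeasurableSet {v | ‖g v‖ ≤ h t} := measurableSet_le (by fun_prop) (by fun_prop)
    set B := {v | ‖g v‖ ≤ h t} with hBdef
    set g1 := Bᶜ.indicator g with hg1
    set g2 := B.indicator g with hg2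
    have i1 : Integrable g1 volume := h1.indicator hB.compl
    have i2 : Integrable g2 volume := h1.indicator hB
    have hsum : ∀ w, 𝓕 g w = 𝓕 g1 w + 𝓕 g2 w := by
      intro w
      have : g = g1 + g2 := by rw [hg1, hg2, add_comm]; exact (Set.indicator_self_add_compl B g).symm
      conv_lhs => rw [this]
      exact congrFun (VectorFourier.fourierIntegral_add (L := innerₗ V) Real.continuous_fourierChar continuous_inner i1 i2) w
    have b1 : ∀ w, ‖𝓕 g1 w‖ ≤ t / 2 := by
      intro w
      have e1 : ‖𝓕 g1 w‖ ≤ ∫ v, ‖g1 v‖ := by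
        exact VectorFourier.norm_fourierIntegral_le_integral_norm _ _ _ _ _
      refine e1.trans ?_
      rw [integral_norm_eq_lintegral_enorm i1.1]
      apply ENNReal.toReal_le_of_le_ofReal (by positivity)
      have : ∀ v, ‖g1 v‖ₑ ≤ ENNReal.ofReal ((h t) ^ (1 - s)) * ‖g v‖ₑ ^ s := by
        intro v
        by_cases hv : v ∈ B
        · simp [hg1, hv]
        · have hv' : h t < ‖g v‖ := by simpa [hBdef] using hv
          rw [hg1, Set.indicator_of_mem (by exact hv), enorm_rpow_eq _ (by linarith), ← ENNReal.ofReal_mul (by positivity), ← ofReal_norm]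
          apply ENNReal.ofReal_le_ofReal
          have hp : 0 < ‖g v‖ := hht.trans hv'
          have e3 : ‖g v‖ = ‖g v‖ ^ (1 - s) * ‖g v‖ ^ s := by
            rw [← Real.rpow_add hp]; simp
          have e4 : ‖g v‖ ^ (1 - s) ≤ h t ^ (1 - s) :=
            Real.rpow_le_rpow_of_nonpos hht hv'.le (by linarith)
          calc ‖g v‖ = ‖g v‖ ^ (1 - s) * ‖g v‖ ^ s := e3
            _ ≤ _ := by gcongr
      calc ∫⁻ v, ‖g1 v‖ₑ ≤ ∫⁻ v, ENNReal.ofReal ((h t) ^ (1 - s)) * ‖g v‖ₑ ^ s := lintegral_mono this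
        _ = ENNReal.ofReal ((h t) ^ (1 - s)) * A := by rw [lintegral_const_mul _ (by fun_prop)]
        _ = ENNReal.ofReal (t / 2) := by
          rw [haA, ← ENNReal.ofReal_mul (by positivity)]
          congr 1
          rw [hh]; simp only
          rw [← Real.rpow_mul (by positivity)]
          have : k * (1 - s) = -1 := by linarith
          rw [this, Real.rpow_neg_one]; field_simp
    have sub : {w | t < ‖𝓕 g w‖} ⊆ {w | ENNReal.ofReal ((t/2)^(2:ℝ)) ≤ ‖𝓕 g2 w‖ₑ ^ (2:ℝ)} := by
      intro w hw
      simp only [mem_ofPred_eq] at hw ⊢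
      rw [enorm_rpow_eq _ (by norm_num)]
      apply ENNReal.ofReal_le_ofReal
      apply Real.rpow_le_rpow (by positivity) _ (by norm_num)
      have := norm_add_le (𝓕 g1 w) (𝓕 g2 w)
      rw [← hsum] at this
      linarith [b1 w]
    have hmeas : Measurable (fun w => 𝓕 g2 w) := by
      have : Continuous (𝓕 g2) := VectorFourier.fourierIntegral_continuous Real.continuous_fourierChar
          (L := innerₗ V) continuous_inner i2
      exact this.measurable
    have ch := mul_meas_ge_le_lintegral (μ := (volume : Measure V)) (f := fun w => ‖𝓕 g2 w‖ₑ ^ (2:ℝ)) (by fun_prop) (ENNReal.ofReal ((t/2)^(2:ℝ)))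
    have ch2 := ch.trans (plan_l g2 i2)
    have e5 : ∀ v, ‖g2 v‖ₑ ^ (2:ℝ) = B.indicator (fun v => ‖g v‖ₑ ^ (2:ℝ)) v := by
      intro v
      by_cases hv : v ∈ B <;> simp [hg2, hv]
    simp only [e5] at ch2
    have e6 : ENNReal.ofReal (4 * t ^ (-2:ℝ)) * ENNReal.ofReal ((t/2)^(2:ℝ)) = 1 := by
      rw [← ENNReal.ofReal_mul (by positivity), Real.div_rpow ht.le (by norm_num), Real.rpow_neg ht.le]
      rw [← ENNReal.ofReal_one]; congr 1
      norm_num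
      field_simp
    calc volume {w | t < ‖𝓕 g w‖} ≤ volume {w | ENNReal.ofReal ((t/2)^(2:ℝ)) ≤ ‖𝓕 g2 w‖ₑ ^ (2:ℝ)} := measure_mono sub
      _ = ENNReal.ofReal (4 * t ^ (-2:ℝ)) * (ENNReal.ofReal ((t/2)^(2:ℝ)) * volume {w | ENNReal.ofReal ((t/2)^(2:ℝ)) ≤ ‖𝓕 g2 w‖ₑ ^ (2:ℝ)}) := by
          rw [← mul_assoc, e6, one_mul]
      _ ≤ _ := by gcongr
  have hFm : Measurable (𝓕 g) := by
    have : Continuous (𝓕 g) := VectorFourier.fourierIntegral_continuous Real.continuous_fourierChar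
          (L := innerₗ V) continuous_inner h1
    exact this.measurable
  -- inner integral
  have inner : ∀ v, ∫⁻ t in Ioi (0:ℝ), {t | ‖g v‖ ≤ h t}.indicator (fun t => ENNReal.ofReal (4 * t ^ (s' - 3)) * ‖g v‖ₑ ^ (2:ℝ)) t
      ≤ ENNReal.ofReal (4 * 2 ^ (s' - 2) / (s' - 2) * a ^ (s' - 2)) * ‖g v‖ₑ ^ s := by
    intro v
    by_cases hv : g v = 0
    · simp [hv]
    have hn : 0 < ‖g v‖ := norm_pos_iff.2 hv
    set T := 2 * a * ‖g v‖ ^ (-(s - 1)) with hT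
    have hT0 : 0 < T := by rw [hT]; positivity
    have hle : ∀ t ∈ Ioi (0:ℝ), {t | ‖g v‖ ≤ h t}.indicator (fun t => ENNReal.ofReal (4 * t ^ (s' - 3)) * ‖g v‖ₑ ^ (2:ℝ)) t
        ≤ (Ioc 0 T).indicator (fun t => ENNReal.ofReal (4 * t ^ (s' - 3)) * ‖g v‖ₑ ^ (2:ℝ)) t := by
      intro t ht
      by_cases hc : ‖g v‖ ≤ h t
      · have ht0 : 0 < t := ht
        have : t ∈ Ioc 0 T := by
          refine ⟨ht, ?_⟩
          have e1 : ‖g v‖ ^ (s - 1) ≤ h t ^ (s - 1) := Real.rpow_le_rpow hn.le hc hs0.le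
          have e2 : h t ^ (s - 1) = 2 * a / t := by
            rw [hh]; simp only; rw [← Real.rpow_mul (by positivity), hkk, Real.rpow_one]
          rw [e2, le_div_iff₀ ht0] at e1
          rw [hT, Real.rpow_neg hn.le, ← div_eq_mul_inv, le_div_iff₀ (by positivity)]
          linarith
        rw [Set.indicator_of_mem this]
        exact Set.indicator_le_self _ _ _
      · rw [Set.indicator_of_notMem (by exact hc)]; exact zero_le
    have e7 : ∫⁻ t in Ioc 0 T, ENNReal.ofReal (t ^ (s' - 3)) = ENNReal.ofReal (T ^ (s' - 2) / (s' - 2)) := by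
      rw [← ofReal_integral_eq_lintegral_ofReal, ← intervalIntegral.integral_of_le hT0.le, integral_rpow (Or.inl (by linarith))]
      · rw [Real.zero_rpow (by linarith)]; congr 2 <;> ring_nf
      · exact (intervalIntegral.intervalIntegrable_rpow' (by linarith)).1
      · filter_upwards [ae_restrict_mem measurableSet_Ioc] with t ht
        exact Real.rpow_nonneg ht.1.le _
    calc _ ≤ ∫⁻ t in Ioi (0:ℝ), (Ioc 0 T).indicator (fun t => ENNReal.ofReal (4 * t ^ (s' - 3)) * ‖g v‖ₑ ^ (2:ℝ)) t :=
          setLIntegral_mono' measurableSet_Ioi hle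
      _ = ∫⁻ t in Ioc 0 T, ENNReal.ofReal (4 * t ^ (s' - 3)) * ‖g v‖ₑ ^ (2:ℝ) := by
          rw [setLIntegral_indicator measurableSet_Ioc]
          congr 2; ext t; simp +contextual
      _ = ENNReal.ofReal 4 * ENNReal.ofReal (T ^ (s' - 2) / (s' - 2)) * ‖g v‖ₑ ^ (2:ℝ) := by
          rw [lintegral_mul_const _ (by fun_prop), ← e7, ← lintegral_const_mul _ (by fun_prop)]
          congr 1
          apply lintegral_congr; intro t
          rw [ENNReal.ofReal_mul (by norm_num)]
      _ ≤ _ := by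
          have hs2' : 0 < s' - 2 := by linarith
          rw [enorm_rpow_eq _ (by norm_num), enorm_rpow_eq _ (by linarith), ← ENNReal.ofReal_mul (by positivity), ← ENNReal.ofReal_mul (by positivity), ← ENNReal.ofReal_mul (by positivity)]
          apply ENNReal.ofReal_le_ofReal
          apply le_of_eq
          rw [hT, Real.mul_rpow (by positivity) (by positivity), Real.mul_rpow (by positivity) (by positivity), ← Real.rpow_mul hn.le]
          have e8 : ‖g v‖ ^ s = ‖g v‖ ^ (-(s - 1) * (s' - 2)) * ‖g v‖ ^ (2:ℝ) := by
            rw [← Real.rpow_add hn]; congr 1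
            rw [hsk]; linear_combination hkk
          rw [e8]; ring
  have hs'0 : 0 < s' := by linarith
  calc ∫⁻ w, ‖𝓕 g w‖ₑ ^ s' = ∫⁻ w, ENNReal.ofReal (‖𝓕 g w‖ ^ s') := by
        apply lintegral_congr; intro w; rw [enorm_rpow_eq _ hs'0.le]
    _ = ENNReal.ofReal s' * ∫⁻ t in Ioi 0, volume {w | t < ‖𝓕 g w‖} * ENNReal.ofReal (t ^ (s' - 1)) :=
        lintegral_rpow_eq_lintegral_meas_lt_mul _ (by filter_upwards with w using norm_nonneg _) (by fun_prop) hs'0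
    _ ≤ ENNReal.ofReal s' * ∫⁻ t in Ioi (0:ℝ), ∫⁻ v, {t | ‖g v‖ ≤ h t}.indicator (fun t => ENNReal.ofReal (4 * t ^ (s' - 3)) * ‖g v‖ₑ ^ (2:ℝ)) t := by
        gcongr ENNReal.ofReal s' * ?_
        apply setLIntegral_mono' measurableSet_Ioi
        intro t ht
        have ht0 : 0 < t := ht
        have hB : MeasurableSet {v | ‖g v‖ ≤ h t} := measurableSet_le (by fun_prop) (by fun_prop)
        calc volume {w | t < ‖𝓕 g w‖} * ENNReal.ofReal (t ^ (s' - 1)) ≤ (ENNReal.ofReal (4 * t ^ (-2 : ℝ)) * ∫⁻ v, {v | ‖g v‖ ≤ h t}.indicator (fun v => ‖g v‖ₑ ^ (2:ℝ)) v) * ENNReal.ofReal (t ^ (s' - 1)) :=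
              mul_le_mul' (lev t ht) le_rfl
          _ = ENNReal.ofReal (4 * t ^ (s' - 3)) * ∫⁻ v, {v | ‖g v‖ ≤ h t}.indicator (fun v => ‖g v‖ₑ ^ (2:ℝ)) v := by
              rw [mul_right_comm, ← ENNReal.ofReal_mul (by positivity)]
              congr 2
              rw [mul_assoc, ← Real.rpow_add ht0]; congr 2; ring
          _ = _ := by
              rw [← lintegral_const_mul _ ((by fun_prop : Measurable (fun v => ‖g v‖ₑ ^ (2:ℝ))).indicator hB)]
              apply lintegral_congr; intro v
              by_cases hc : ‖g v‖ ≤ h t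
              · rw [Set.indicator_of_mem (by exact hc), Set.indicator_of_mem (by exact hc)]
              · rw [Set.indicator_of_notMem (by exact hc), Set.indicator_of_notMem (by exact hc), mul_zero]
    _ = ENNReal.ofReal s' * ∫⁻ v, ∫⁻ t in Ioi (0:ℝ), {t | ‖g v‖ ≤ h t}.indicator (fun t => ENNReal.ofReal (4 * t ^ (s' - 3)) * ‖g v‖ₑ ^ (2:ℝ)) t := by
        congr 1
        apply lintegral_lintegral_swap
        apply Measurable.aemeasurable
        have : (Function.uncurry fun t v => {t | ‖g v‖ ≤ h t}.indicator (fun t => ENNReal.ofReal (4 * t ^ (s' - 3)) * ‖g v‖ₑ ^ (2:ℝ)) t)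
          = {p : ℝ × V | ‖g p.2‖ ≤ h p.1}.indicator (fun p => ENNReal.ofReal (4 * p.1 ^ (s' - 3)) * ‖g p.2‖ₑ ^ (2:ℝ)) := by
          ext ⟨t, v⟩
          by_cases hc : ‖g v‖ ≤ h t
          · simp [Function.uncurry, hc]
          · simp [Function.uncurry, hc]
        rw [this]
        apply Measurable.indicator
        · fun_prop
        · exact measurableSet_le (by fun_prop) (by fun_prop)
    _ ≤ ENNReal.ofReal s' * ∫⁻ v, ENNReal.ofReal (4 * 2 ^ (s' - 2) / (s' - 2) * a ^ (s' - 2)) * ‖g v‖ₑ ^ s := by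
        gcongr with v; exact inner v
    _ = _ := by
        have hs2' : 0 < s' - 2 := by linarith
        rw [lintegral_const_mul _ (by fun_prop), ← hA, haA, ENNReal.ofReal_rpow_of_pos ha0, ← ENNReal.ofReal_mul (by positivity), ← ENNReal.ofReal_mul (by positivity), ← ENNReal.ofReal_mul (by positivity)]
        congr 1
        have : a ^ k = a ^ (s' - 2) * a := by
          nth_rewrite 3 [← Real.rpow_one a]
          rw [← Real.rpow_add ha0]; congr 1; rw [hsk]; ring
        rw [this]; ring

open scoped FourierTransform in
theorem HY {V : Type*} [NormedAddCommGroup V] [InnerProductSpace ℝ V] [FiniteDimensional ℝ V]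
    [MeasurableSpace V] [BorelSpace V] {s : ℝ} (hs1 : 1 < s) (hs2 : s ≤ 2) :
    ∃ C : ℝ, 0 < C ∧ ∀ g : V → ℂ, Integrable g volume →
    ∫⁻ w, ‖𝓕 g w‖ₑ ^ (s / (s - 1)) ≤
      ENNReal.ofReal C * (∫⁻ v, ‖g v‖ₑ ^ s) ^ (1 / (s - 1)) := by
  rcases hs2.lt_or_eq with hs2 | rfl
  · have hs0 : 0 < s - 1 := by linarith
    have hs'2 : 2 < s / (s - 1) := by rw [lt_div_iff₀ hs0]; linarith
    refine ⟨4 * (s / (s - 1)) * 2 ^ (s / (s-1) - 2) / (s / (s-1) - 2), ?_, ?_⟩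
    · have : 0 < s / (s - 1) - 2 := by linarith
      positivity
    intro g hg
    have h := HY_meas hs1 hs2 (hg.1.mk g) hg.1.stronglyMeasurable_mk.measurable (hg.congr hg.1.ae_eq_mk)
    have e : 𝓕 (hg.1.mk g) = 𝓕 g := by
      ext w
      rw [Real.fourier_eq, Real.fourier_eq]
      apply integral_congr_ae
      filter_upwards [hg.1.ae_eq_mk] with v hv
      rw [hv]
    rw [e] at h
    convert h using 3
    apply lintegral_congr_ae
    filter_upwards [hg.1.ae_eq_mk] with v hv
    rw [hv]
  · refine ⟨1, one_pos, ?_⟩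
    intro g hg
    have := plan_l g hg
    norm_num at this ⊢
    exact this

theorem lintegral_comp_smul' {V : Type*} [NormedAddCommGroup V] [NormedSpace ℝ V] [FiniteDimensional ℝ V]
    [MeasurableSpace V] [BorelSpace V] (μ : Measure V) [μ.IsAddHaarMeasure] (f : V → ℝ≥0∞) {c : ℝ} (hc : c ≠ 0) :
    ∫⁻ x, f (c • x) ∂μ = ENNReal.ofReal |(c ^ Module.finrank ℝ V)⁻¹| * ∫⁻ x, f x ∂μ := by
  have h := Measure.map_addHaar_smul μ hc
  have h2 := lintegral_map_equiv (μ := μ) f (Homeomorph.smulOfNeZero c hc).toMeasurableEquiv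
  have e : (⇑(Homeomorph.smulOfNeZero c hc).toMeasurableEquiv : V → V) = fun x => c • x := rfl
  rw [e] at h2
  have e3 : Measure.map (fun x => c • x) μ = Measure.map (c • ·) μ := rfl
  rw [← h2, h, lintegral_smul_measure, smul_eq_mul]

theorem HYcv {V : Type*} [NormedAddCommGroup V] [InnerProductSpace ℝ V] [FiniteDimensional ℝ V]
    [MeasurableSpace V] [BorelSpace V] {s : ℝ} (hs1 : 1 < s) (hs2 : s ≤ 2) :
    ∃ C : ℝ, 0 < C ∧ ∀ (S : Set V) (Φ : V → V) (Φ' : V → V →L[ℝ] V) (F : V → ℂ), MeasurableSet S →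
      (∀ x ∈ S, HasFDerivWithinAt Φ (Φ' x) S x) → InjOn Φ S → (∀ x ∈ S, (Φ' x).det ≠ 0) →
      IntegrableOn F S volume →
    ∫⁻ ξ : V, ‖∫ x in S, F x * Complex.exp (Complex.I * Complex.ofReal (inner ℝ (Φ x) ξ))‖ₑ ^ (s / (s - 1)) ≤
      ENNReal.ofReal C * (∫⁻ x in S, ENNReal.ofReal (|(Φ' x).det| ^ (1 - s)) * ‖F x‖ₑ ^ s) ^ (1 / (s - 1)) := by
  obtain ⟨C, hC, H⟩ := HY (V := V) hs1 hs2
  have hc : (-(2 * π)⁻¹ : ℝ) ≠ 0 := by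
    have := Real.pi_pos
    simp [this.ne']
  set K := |((-(2 * π)⁻¹) ^ Module.finrank ℝ V)⁻¹| with hK
  have hK0 : 0 < K := by rw [hK]; positivity
  refine ⟨K * C, by positivity, ?_⟩
  intro S Φ Φ' F hS hΦ hinj hdet hF
  set Ψ := Function.invFunOn Φ S with hΨ
  have hΨS : ∀ x ∈ S, Ψ (Φ x) = x := fun x hx => hinj.leftInvOn_invFunOn hx
  have hIm : MeasurableSet (Φ '' S) := hS.image_of_continuousOn_injOn (fun x hx => (hΦ x hx).continuousWithinAt) hinj
  set g : V → ℂ := (Φ '' S).indicator (fun u => ((|(Φ' (Ψ u)).det|⁻¹ : ℝ) : ℂ) * F (Ψ u)) with hg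
  have gi : Integrable g volume := by
    rw [hg, integrable_indicator_iff hIm, integrableOn_image_iff_integrableOn_abs_det_fderiv_smul _ hS hΦ hinj]
    refine hF.congr_fun ?_ hS
    intro x hx
    have h1 : |(Φ' x).det| ≠ 0 := by simpa using hdet x hx
    simp only [hΨS x hx, Complex.real_smul]
    rw [← mul_assoc, ← Complex.ofReal_mul, mul_inv_cancel₀ h1]; simp
  have h1 := H g gi
  have e1 : ∫⁻ v, ‖g v‖ₑ ^ s = ∫⁻ x in S, ENNReal.ofReal (|(Φ' x).det| ^ (1 - s)) * ‖F x‖ₑ ^ s := by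
    have : ∀ v, ‖g v‖ₑ ^ s = (Φ '' S).indicator (fun u => (ENNReal.ofReal (|(Φ' (Ψ u)).det| ^ (-s)) * ‖F (Ψ u)‖ₑ ^ s)) v := by
      intro v
      by_cases hv : v ∈ Φ '' S
      · obtain ⟨x, hx, rfl⟩ := hv
        have h1 : 0 < |(Φ' x).det| := by simpa using hdet x hx
        rw [hg, indicator_of_mem (mem_image_of_mem _ hx), indicator_of_mem (mem_image_of_mem _ hx), hΨS x hx, enorm_mul, ENNReal.mul_rpow_of_nonneg _ _ (by linarith), enorm_rpow_eq _ (by linarith)]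
        congr 2
        rw [Complex.norm_real, norm_inv, norm_abs_eq_norm, Real.norm_eq_abs, Real.inv_rpow h1.le, Real.rpow_neg h1.le]
      · rw [hg, indicator_of_notMem hv, indicator_of_notMem hv]
        rw [enorm_zero, ENNReal.zero_rpow_of_pos (by linarith)]
    simp_rw [this]
    rw [lintegral_indicator hIm, lintegral_image_eq_lintegral_abs_det_fderiv_mul _ hS hΦ hinj]
    apply setLIntegral_congr_fun hS
    intro x hx
    have h1 : 0 < |(Φ' x).det| := by simpa using hdet x hx
    simp only [hΨS x hx]
    rw [← mul_assoc, ← ENNReal.ofReal_mul h1.le]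
    congr 2
    nth_rewrite 1 [← Real.rpow_one |(Φ' x).det|]
    rw [← Real.rpow_add h1]; rfl
  rw [e1] at h1
  set G : V → ℝ≥0∞ := fun w => ‖FourierTransform.fourier g w‖ₑ ^ (s / (s - 1)) with hG
  have e2 : ∀ ξ : V, ‖∫ x in S, F x * Complex.exp (Complex.I * Complex.ofReal (inner ℝ (Φ x) ξ))‖ₑ ^ (s / (s - 1))
     = G ((-(2 * π)⁻¹ : ℝ) • ξ) := by
    intro ξ
    rw [hG]; simp only
    congr 2
    rw [Real.fourier_eq' ]
    have : ∀ v, Complex.exp (((-2 * π * inner ℝ v ((-(2 * π)⁻¹ : ℝ) • ξ) : ℝ) : ℂ) * Complex.I) • g v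
      = (Φ '' S).indicator (fun u => Complex.exp (Complex.I * Complex.ofReal (inner ℝ u ξ)) * (((|(Φ' (Ψ u)).det|⁻¹ : ℝ) : ℂ) * F (Ψ u))) v := by
      intro v
      by_cases hv : v ∈ Φ '' S
      · rw [hg, indicator_of_mem hv, indicator_of_mem hv, smul_eq_mul]
        congr 2
        rw [mul_comm, inner_smul_right]
        congr 2
        have := Real.pi_pos
        field_simp
      · rw [hg, indicator_of_notMem hv, indicator_of_notMem hv, smul_zero]
    simp_rw [this]
    rw [integral_indicator hIm, integral_image_eq_integral_abs_det_fderiv_smul _ hS hΦ hinj]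
    apply setIntegral_congr_fun hS
    intro x hx
    have h1 : |(Φ' x).det| ≠ 0 := by simpa using hdet x hx
    simp only [hΨS x hx, Complex.real_smul]
    have h2 : ((|(Φ' x).det| : ℝ) : ℂ) ≠ 0 := by exact_mod_cast h1
    push_cast
    field_simp
  simp_rw [e2]
  rw [lintegral_comp_smul' _ G hc, ← hK, ENNReal.ofReal_mul hK0.le, mul_assoc]
  exact mul_le_mul' le_rfl h1

theorem HY1 {s : ℝ} (hs1 : 1 < s) (hs2 : s ≤ 2) :
    ∃ C : ℝ, 0 < C ∧ ∀ (S : Set ℝ) (Φ Φ' : ℝ → ℝ) (F : ℝ → ℂ) (c : ℝ), MeasurableSet S →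
      (∀ x ∈ S, HasDerivAt Φ (Φ' x) x) → InjOn Φ S → 0 < c → (∀ x ∈ S, c ≤ |Φ' x|) →
      IntegrableOn F S volume →
    ∫⁻ ξ : ℝ, ‖∫ x in S, F x * Complex.exp (Complex.I * Complex.ofReal (ξ * Φ x))‖ₑ ^ (s / (s - 1)) ≤
      ENNReal.ofReal (C * c⁻¹) * (∫⁻ x in S, ‖F x‖ₑ ^ s) ^ (1 / (s - 1)) := by
  obtain ⟨C, hC, H⟩ := HYcv (V := ℝ) hs1 hs2
  refine ⟨C, hC, ?_⟩
  intro S Φ Φ' F c hS hΦ hinj hc hb hF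
  have h := H S Φ (fun x => ContinuousLinearMap.toSpanSingleton ℝ (Φ' x)) F hS (fun x hx => (hΦ x hx).hasFDerivAt.hasFDerivWithinAt) hinj
    (by
      intro x hx
      have := hb x hx
      rw [ContinuousLinearMap.det_toSpanSingleton]
      intro h0; rw [h0] at this; simp at this; linarith) hF
  simp only [RCLike.inner_apply, conj_trivial, ContinuousLinearMap.det_toSpanSingleton] at h
  refine h.trans ?_
  rw [ENNReal.ofReal_mul hC.le, mul_assoc]
  gcongr
  have hs0 : 0 < s - 1 := by linarith
  calc (∫⁻ x in S, ENNReal.ofReal (|Φ' x| ^ (1 - s)) * ‖F x‖ₑ ^ s) ^ (1 / (s - 1))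
      ≤ (∫⁻ x in S, ENNReal.ofReal (c ^ (1 - s)) * ‖F x‖ₑ ^ s) ^ (1 / (s - 1)) := by
        apply ENNReal.rpow_le_rpow _ (by positivity)
        apply setLIntegral_mono' hS
        intro x hx
        gcongr ENNReal.ofReal ?_ * _
        exact Real.rpow_le_rpow_of_nonpos hc (hb x hx) (by linarith)
    _ = _ := by
        rw [lintegral_const_mul' _ _ (by simp), ENNReal.mul_rpow_of_nonneg _ _ (by positivity), ENNReal.ofReal_rpow_of_pos (by positivity), ← Real.rpow_mul hc.le]
        congr 3
        rw [← Real.rpow_neg_one]; congr 1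
        field_simp; ring

theorem lint_abs (f : ℝ → ℝ≥0∞) : ∫⁻ x, f |x| = 2 * ∫⁻ x in Ioi (0:ℝ), f x := by
  rw [← lintegral_add_compl _ (measurableSet_Ioi (a := (0:ℝ))), two_mul]
  congr 1
  · apply setLIntegral_congr_fun measurableSet_Ioi
    intro x hx; simp only; rw [abs_of_pos hx]
  · have h1 : (Ioi (0:ℝ))ᶜ = (fun x : ℝ => -x) ⁻¹' (Ici 0) := by ext x; simp
    rw [h1]
    have := (Measure.measurePreserving_neg (volume : Measure ℝ)).setLIntegral_comp_preimage_emb (MeasurableEquiv.neg ℝ).measurableEmbedding (fun x => f |x|) (Ici 0)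
    simp only [abs_neg] at this
    have e : (Neg.neg ⁻¹' Ici (0:ℝ)) = (fun x : ℝ => -x) ⁻¹' (Ici 0) := rfl
    rw [e] at this
    rw [this, restrict_Ioi_eq_restrict_Ici]
    apply setLIntegral_congr_fun measurableSet_Ici
    intro x hx; simp only; rw [abs_of_nonneg hx]

theorem pow_near {κ ρ : ℝ} (hκ : κ < 1) (hρ : 0 ≤ ρ) :
    ∫⁻ u, (Iic ρ).indicator (fun v => ENNReal.ofReal (v ^ (-κ))) |u| = ENNReal.ofReal (2 * ρ ^ (1 - κ) / (1 - κ)) := by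
  rw [lint_abs, setLIntegral_indicator measurableSet_Iic, inter_comm, Ioi_inter_Iic]
  rw [← ofReal_integral_eq_lintegral_ofReal, ← intervalIntegral.integral_of_le hρ, integral_rpow (Or.inl (by linarith))]
  · rw [Real.zero_rpow (by linarith), ← ENNReal.ofReal_ofNat 2, ← ENNReal.ofReal_mul (by norm_num)]; congr 1
    rw [sub_zero, mul_div_assoc]; ring_nf
  · exact (intervalIntegral.intervalIntegrable_rpow' (by linarith)).1
  · filter_upwards [ae_restrict_mem measurableSet_Ioc] with t ht
    exact Real.rpow_nonneg ht.1.le _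

theorem pow_far {κ ρ : ℝ} (hκ : 1 < κ) (hρ : 0 < ρ) :
    ∫⁻ u, (Ioi ρ).indicator (fun v => ENNReal.ofReal (v ^ (-κ))) |u| = ENNReal.ofReal (2 * ρ ^ (1 - κ) / (κ - 1)) := by
  rw [lint_abs, setLIntegral_indicator measurableSet_Ioi, Ioi_inter_Ioi, max_eq_left hρ.le]
  rw [← ofReal_integral_eq_lintegral_ofReal, integral_Ioi_rpow_of_lt (by linarith) hρ]
  · rw [← ENNReal.ofReal_ofNat 2, ← ENNReal.ofReal_mul (by norm_num)]; congr 1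
    have : κ - 1 ≠ 0 := by linarith
    have : -κ + 1 ≠ 0 := by linarith
    rw [show -κ + 1 = 1 - κ by ring] at *
    field_simp; ring
  · exact integrableOn_Ioi_rpow_of_lt (by linarith) hρ
  · filter_upwards [ae_restrict_mem measurableSet_Ioi] with t ht
    exact Real.rpow_nonneg (hρ.trans ht).le _

theorem HLS_inner {γ : ℝ} (h0 : 0 < γ) (h1 : γ < 1) (h : ℝ → ℝ≥0∞) (hm : Measurable h)
    {a : ℝ} (ha : 0 < a) (hA : ∫⁻ x, h x ^ (2 / (2 - γ)) = ENNReal.ofReal a) (φ : ℝ) (hf : h φ ≠ ∞) :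
    ∫⁻ ψ, {ψ | h ψ ≤ h φ}.indicator (fun ψ => h ψ * ENNReal.ofReal (|φ - ψ| ^ (-γ))) ψ ≤
      ENNReal.ofReal ((2 / (1 - γ) + 2 ^ (γ / 2)) * a ^ (1 - γ)) * h φ ^ (γ / (2 - γ)) := by
  by_cases hz : h φ = 0
  · have : ∀ ψ, {ψ | h ψ ≤ h φ}.indicator (fun ψ => h ψ * ENNReal.ofReal (|φ - ψ| ^ (-γ))) ψ = 0 := by
      intro ψ
      by_cases hc : h ψ ≤ h φ
      · rw [indicator_of_mem (by exact hc)]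
        have : h ψ = 0 := by rw [hz] at hc; simpa using hc
        simp [this]
      · rw [indicator_of_notMem (by exact hc)]
    simp [this]
  set b := (h φ).toReal with hb
  have hb0 : 0 < b := ENNReal.toReal_pos hz hf
  have hbe : h φ = ENNReal.ofReal b := (ENNReal.ofReal_toReal hf).symm
  set t := 2 / (2 - γ) with ht
  have h2 : 0 < 2 - γ := by linarith
  have hg1 : 0 < 1 - γ := by linarith
  have ht1 : t * (2 - γ) = 2 := by rw [ht]; field_simp
  have ht0 : 0 < t := by positivity
  set ρ := a * b ^ (-t) with hρ
  have hρ0 : 0 < ρ := by positivity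
  have sub : ∀ ψ, {ψ | h ψ ≤ h φ}.indicator (fun ψ => h ψ * ENNReal.ofReal (|φ - ψ| ^ (-γ))) ψ ≤
      h φ * (Iic ρ).indicator (fun v => ENNReal.ofReal (v ^ (-γ))) |φ - ψ| +
      h ψ * (Ioi ρ).indicator (fun v => ENNReal.ofReal (v ^ (-γ))) |φ - ψ| := by
    intro ψ
    by_cases hc : h ψ ≤ h φ
    · rw [indicator_of_mem (by exact hc)]
      by_cases hd : |φ - ψ| ≤ ρ
      · rw [indicator_of_mem (by exact hd)]
        refine le_trans ?_ le_self_add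
        exact mul_le_mul' hc le_rfl
      · rw [indicator_of_mem (s := Ioi ρ) (by simpa using hd)]
        exact le_add_self
    · rw [indicator_of_notMem (by exact hc)]; exact zero_le
  have wm : Measurable (fun ψ => (Iic ρ).indicator (fun v => ENNReal.ofReal (v ^ (-γ))) |φ - ψ|) := by
    have : Measurable ((Iic ρ).indicator (fun v => ENNReal.ofReal (v ^ (-γ)))) :=
      Measurable.indicator (by fun_prop) measurableSet_Iic
    exact this.comp (by fun_prop)
  have wm2 : Measurable (fun ψ => (Ioi ρ).indicator (fun v => ENNReal.ofReal (v ^ (-γ))) |φ - ψ|) := by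
    have : Measurable ((Ioi ρ).indicator (fun v => ENNReal.ofReal (v ^ (-γ)))) :=
      Measurable.indicator (by fun_prop) measurableSet_Ioi
    exact this.comp (by fun_prop)
  have near : ∫⁻ ψ, h φ * (Iic ρ).indicator (fun v => ENNReal.ofReal (v ^ (-γ))) |φ - ψ| =
      ENNReal.ofReal (2 / (1 - γ) * a ^ (1 - γ)) * h φ ^ (γ / (2 - γ)) := by
    rw [lintegral_const_mul _ wm, lintegral_sub_left_eq_self (μ := volume) (fun u => (Iic ρ).indicator (fun v => ENNReal.ofReal (v ^ (-γ))) |u|), pow_near h1 hρ0.le, hbe, ENNReal.ofReal_rpow_of_pos hb0, ← ENNReal.ofReal_mul hb0.le, ← ENNReal.ofReal_mul (by positivity)]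
    congr 1
    rw [hρ, Real.mul_rpow ha.le (by positivity), ← Real.rpow_mul hb0.le]
    have e : b ^ (γ / (2 - γ)) = b * b ^ (-t * (1 - γ)) := by
      nth_rewrite 2 [← Real.rpow_one b]
      rw [← Real.rpow_add hb0]; congr 1
      rw [ht]; field_simp; ring
    rw [e]; ring
  have far : ∫⁻ ψ, h ψ * (Ioi ρ).indicator (fun v => ENNReal.ofReal (v ^ (-γ))) |φ - ψ| ≤
      ENNReal.ofReal (2 ^ (γ / 2) * a ^ (1 - γ)) * h φ ^ (γ / (2 - γ)) := by
    have hold : t.HolderConjugate (2 / γ) := by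
      rw [Real.holderConjugate_iff]
      refine ⟨?_, ?_⟩
      · rw [ht, lt_div_iff₀ h2]; linarith
      · rw [ht]; field_simp; ring
    refine (ENNReal.lintegral_mul_le_Lp_mul_Lq volume hold hm.aemeasurable wm2.aemeasurable).trans ?_
    have e1 : ∀ ψ, (Ioi ρ).indicator (fun v => ENNReal.ofReal (v ^ (-γ))) |φ - ψ| ^ (2 / γ) =
        (Ioi ρ).indicator (fun v => ENNReal.ofReal (v ^ (-2:ℝ))) |φ - ψ| := by
      intro ψ
      by_cases hd : |φ - ψ| ∈ Ioi ρ
      · rw [indicator_of_mem hd, indicator_of_mem hd]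
        have : 0 < |φ - ψ| := hρ0.trans hd
        rw [ENNReal.ofReal_rpow_of_pos (by positivity), ← Real.rpow_mul this.le]
        congr 2; field_simp
      · rw [indicator_of_notMem hd, indicator_of_notMem hd, ENNReal.zero_rpow_of_pos (by positivity)]
    simp_rw [e1]
    rw [lintegral_sub_left_eq_self (μ := volume) (fun u => (Ioi ρ).indicator (fun v => ENNReal.ofReal (v ^ (-2:ℝ))) |u|), pow_far (by norm_num) hρ0, hA, hbe, ENNReal.ofReal_rpow_of_pos hb0, ENNReal.ofReal_rpow_of_pos ha, ENNReal.ofReal_rpow_of_pos (by norm_num; positivity), ← ENNReal.ofReal_mul (by positivity), ← ENNReal.ofReal_mul (by positivity)]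
    apply ENNReal.ofReal_le_ofReal
    apply le_of_eq
    have e2 : (2 * ρ ^ (1 - 2 : ℝ) / (2 - 1)) ^ (1 / (2 / γ)) = 2 ^ (γ / 2) * (a ^ (-(γ/2)) * b ^ (γ / (2 - γ))) := by
      rw [show (2 - 1 : ℝ) = 1 by norm_num, div_one, Real.mul_rpow (by norm_num) (by positivity), ← Real.rpow_mul hρ0.le, hρ, Real.mul_rpow ha.le (by positivity), ← Real.rpow_mul hb0.le]
      rw [show 1 / (2 / γ) = γ / 2 by field_simp]
      congr 2
      · congr 1; ring
      · congr 1; rw [ht]; field_simp; ring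
    rw [e2]
    have e3 : a ^ (1 - γ) = a ^ (1 / t) * a ^ (-(γ/2)) := by
      rw [← Real.rpow_add ha]; congr 1; rw [ht]; field_simp; ring
    rw [e3]; ring
  calc _ ≤ _ := lintegral_mono sub
    _ = _ := lintegral_add_left (wm.const_mul _) _
    _ ≤ _ := add_le_add near.le far
    _ = _ := by
      rw [← add_mul, ← ENNReal.ofReal_add (by positivity) (by positivity)]
      congr 2; ring

theorem HLS {γ : ℝ} (h0 : 0 < γ) (h1 : γ < 1) :
    ∃ C : ℝ, 0 < C ∧ ∀ h : ℝ → ℝ≥0∞, Measurable h →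
      ∫⁻ φ, ∫⁻ ψ, h φ * (h ψ * ENNReal.ofReal (|φ - ψ| ^ (-γ))) ≤
        ENNReal.ofReal C * (∫⁻ x, h x ^ (2 / (2 - γ))) ^ (2 - γ) := by
  have hg1 : 0 < 1 - γ := by linarith
  have h2 : 0 < 2 - γ := by linarith
  refine ⟨2 * (2 / (1 - γ) + 2 ^ (γ / 2)), by positivity, ?_⟩
  intro h hm
  by_cases hA0 : ∫⁻ x, h x ^ (2 / (2 - γ)) = 0
  · rw [lintegral_eq_zero_iff (by fun_prop)] at hA0
    have e : ∀ᵐ φ, ∫⁻ ψ, h φ * (h ψ * ENNReal.ofReal (|φ - ψ| ^ (-γ))) = 0 := by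
      filter_upwards [hA0] with φ hφ
      have : h φ = 0 := by
        simp only [Pi.zero_apply] at hφ
        rw [ENNReal.rpow_eq_zero_iff_of_pos (by positivity)] at hφ; exact hφ
      simp [this]
    rw [lintegral_congr_ae e]; simp
  by_cases hAt : ∫⁻ x, h x ^ (2 / (2 - γ)) = ∞
  · rw [hAt, ENNReal.top_rpow_of_pos h2, ENNReal.mul_top]
    · exact le_top
    · rw [Ne, ENNReal.ofReal_eq_zero, not_le]; positivity
  set a := (∫⁻ x, h x ^ (2 / (2 - γ))).toReal with ha
  have ha0 : 0 < a := ENNReal.toReal_pos hA0 hAt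
  have haA : ∫⁻ x, h x ^ (2 / (2 - γ)) = ENNReal.ofReal a := (ENNReal.ofReal_toReal hAt).symm
  have fin : ∀ᵐ φ, h φ ≠ ∞ := by
    filter_upwards [ae_lt_top (by fun_prop) hAt] with φ hφ h'
    rw [h', ENNReal.top_rpow_of_pos (by positivity)] at hφ; simp at hφ
  set J : ℝ → ℝ → ℝ≥0∞ := fun φ ψ => {p : ℝ × ℝ | h p.2 ≤ h p.1}.indicator (fun p => h p.1 * (h p.2 * ENNReal.ofReal (|p.1 - p.2| ^ (-γ)))) (φ, ψ) with hJ
  have Jm : Measurable (Function.uncurry J) := by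
    have : Function.uncurry J = {p : ℝ × ℝ | h p.2 ≤ h p.1}.indicator (fun p => h p.1 * (h p.2 * ENNReal.ofReal (|p.1 - p.2| ^ (-γ)))) := rfl
    rw [this]
    exact Measurable.indicator (by fun_prop) (measurableSet_le (by fun_prop) (by fun_prop))
  have Jb : ∫⁻ φ, ∫⁻ ψ, J φ ψ ≤ ENNReal.ofReal ((2 / (1 - γ) + 2 ^ (γ / 2)) * a ^ (1 - γ)) * ENNReal.ofReal a := by
    rw [← haA, ← lintegral_const_mul _ (by fun_prop)]
    apply lintegral_mono_ae
    filter_upwards [fin] with φ hφ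
    have hin := HLS_inner h0 h1 h hm ha0 haA φ hφ
    have e : ∀ ψ, J φ ψ = h φ * {ψ | h ψ ≤ h φ}.indicator (fun ψ => h ψ * ENNReal.ofReal (|φ - ψ| ^ (-γ))) ψ := by
      intro ψ
      by_cases hc : h ψ ≤ h φ
      · rw [hJ]; simp only; rw [indicator_of_mem (by exact hc), indicator_of_mem (by exact hc)]
      · rw [hJ]; simp only; rw [indicator_of_notMem (by exact hc), indicator_of_notMem (by exact hc), mul_zero]
    simp_rw [e]
    rw [lintegral_const_mul' _ _ hφ]
    refine (mul_le_mul' le_rfl hin).trans (le_of_eq ?_)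
    have : h φ ^ (2 / (2 - γ)) = h φ * h φ ^ (γ / (2 - γ)) := by
      nth_rewrite 2 [← ENNReal.rpow_one (h φ)]
      rw [← ENNReal.rpow_add_of_nonneg _ _ (by norm_num) (by positivity)]
      congr 1; field_simp; ring
    rw [this]; ring
  have sub : ∀ φ ψ, h φ * (h ψ * ENNReal.ofReal (|φ - ψ| ^ (-γ))) ≤ J φ ψ + J ψ φ := by
    intro φ ψ
    rcases le_total (h ψ) (h φ) with hc | hc
    · refine le_trans (le_of_eq ?_) le_self_add
      rw [hJ]; simp only; rw [indicator_of_mem (by exact hc)]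
    · refine le_trans (le_of_eq ?_) le_add_self
      rw [hJ]; simp only; rw [indicator_of_mem (by exact hc), abs_sub_comm]; ring
  calc _ ≤ ∫⁻ φ, ∫⁻ ψ, (J φ ψ + J ψ φ) := lintegral_mono fun φ => lintegral_mono fun ψ => sub φ ψ
    _ = (∫⁻ φ, ∫⁻ ψ, J φ ψ) + ∫⁻ φ, ∫⁻ ψ, J ψ φ := by
        rw [← lintegral_add_left (show Measurable (fun φ => ∫⁻ ψ, J φ ψ) from Measurable.lintegral_prod_right' Jm)]
        apply lintegral_congr; intro φ
        rw [lintegral_add_left (show Measurable (fun ψ => J φ ψ) from Jm.comp (by fun_prop : Measurable fun ψ => (φ, ψ)))]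
    _ = (∫⁻ φ, ∫⁻ ψ, J φ ψ) + ∫⁻ φ, ∫⁻ ψ, J φ ψ := by
        congr 1
        exact lintegral_lintegral_swap (f := fun φ ψ => J ψ φ) (Jm.comp measurable_swap).aemeasurable
    _ ≤ _ := add_le_add Jb Jb
    _ = _ := by
        rw [haA, ENNReal.ofReal_rpow_of_pos ha0, ← ENNReal.ofReal_mul (by positivity), ← ENNReal.ofReal_add (by positivity) (by positivity), ← ENNReal.ofReal_mul (by positivity)]
        congr 1
        have : a ^ (2 - γ) = a ^ (1 - γ) * a := by
          nth_rewrite 3 [← Real.rpow_one a]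
          rw [← Real.rpow_add ha0]; congr 1; ring
        rw [this]; ring

/-- unnormalised extension operator over the line of angles -/
def TT (F : ℝ → ℂ) (x y : ℝ) : ℂ :=
  ∫ φ, F φ * Complex.exp (Complex.I * Complex.ofReal (x * Real.cos φ + y * Real.sin φ))

theorem norm_e (t : ℝ) : ‖Complex.exp (Complex.I * Complex.ofReal t)‖ = 1 := by
  rw [mul_comm]; exact Complex.norm_exp_ofReal_mul_I t

theorem int_e {F : ℝ → ℂ} (hF : Integrable F volume) (x y : ℝ) :
    Integrable (fun φ => F φ * Complex.exp (Complex.I * Complex.ofReal (x * Real.cos φ + y * Real.sin φ))) volume := by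
  apply hF.mul_bdd (c := 1)
  · apply Continuous.aestronglyMeasurable; fun_prop
  · filter_upwards with φ; rw [norm_e]

theorem sq_split (f : ℝ → ℂ) (hf : Integrable f volume) :
    (∫ x, f x) ^ 2 = 2 * ∫ p in {p : ℝ × ℝ | p.1 < p.2}, f p.1 * f p.2 := by
  have hi : Integrable (fun p : ℝ × ℝ => f p.1 * f p.2) volume := hf.mul_prod hf
  have m1 : MeasurableSet {p : ℝ × ℝ | p.1 < p.2} := measurableSet_lt (by fun_prop) (by fun_prop)
  have m2 : MeasurableSet {p : ℝ × ℝ | p.2 < p.1} := measurableSet_lt (by fun_prop) (by fun_prop)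
  have h1 : (∫ x, f x) ^ 2 = ∫ p : ℝ × ℝ, f p.1 * f p.2 := by
    rw [sq]; exact (integral_prod_mul f f).symm
  rw [h1, ← integral_add_compl m1 hi, two_mul]
  congr 1
  have h2 : ∫ p in {p : ℝ × ℝ | p.1 < p.2}ᶜ, f p.1 * f p.2 = ∫ p in {p : ℝ × ℝ | p.2 < p.1}, f p.1 * f p.2 := by
    apply setIntegral_congr_set
    have hd : (volume : Measure (ℝ × ℝ)) {p : ℝ × ℝ | p.1 = p.2} = 0 := by
      have md : MeasurableSet {p : ℝ × ℝ | p.1 = p.2} := measurableSet_eq_fun (by fun_prop) (by fun_prop)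
      rw [Measure.volume_eq_prod, Measure.measure_prod_null md]
      filter_upwards with x
      have : (Prod.mk x ⁻¹' {p : ℝ × ℝ | p.1 = p.2}) = {x} := by ext y; simp [eq_comm]
      rw [this]; simp
    have : ∀ᵐ p : ℝ × ℝ, p.1 ≠ p.2 := by
      rw [ae_iff]; simpa using hd
    filter_upwards [this] with p hp
    apply propext
    change ¬ (p.1 < p.2) ↔ p.2 < p.1
    rw [not_lt]; exact ⟨fun h => lt_of_le_of_ne h hp.symm, le_of_lt⟩
  rw [h2]
  have h3 := (Measure.measurePreserving_swap (μ := (volume : Measure ℝ)) (ν := (volume : Measure ℝ))).setIntegral_preimage_emb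
    (MeasurableEquiv.prodComm.measurableEmbedding) (fun p : ℝ × ℝ => f p.1 * f p.2) {p : ℝ × ℝ | p.1 < p.2}
  rw [← Measure.volume_eq_prod] at h3
  rw [← h3]
  apply integral_congr_ae
  filter_upwards with p
  simp [mul_comm]

def PhiC (z : ℂ) : ℂ := ((Real.cos z.re + Real.cos z.im : ℝ) : ℂ) + ((Real.sin z.re + Real.sin z.im : ℝ) : ℂ) * Complex.I

theorem PhiC_re (z : ℂ) : (PhiC z).re = Real.cos z.re + Real.cos z.im := by
  simp only [PhiC, Complex.add_re, Complex.ofReal_re, Complex.mul_re, Complex.I_re, mul_zero, Complex.ofReal_im, Complex.I_im, zero_mul, sub_zero, add_zero]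

theorem PhiC_im (z : ℂ) : (PhiC z).im = Real.sin z.re + Real.sin z.im := by
  simp only [PhiC, Complex.ofReal_re, Complex.I_re, mul_zero, Complex.ofReal_im, Complex.I_im, add_zero, Complex.add_im, Complex.mul_im, mul_one, zero_add]

def PhiC' (z : ℂ) : ℂ →L[ℝ] ℂ :=
  ((-Real.sin z.re) • Complex.reCLM + (-Real.sin z.im) • Complex.imCLM).smulRight (1:ℂ)
  + ((Real.cos z.re) • Complex.reCLM + (Real.cos z.im) • Complex.imCLM).smulRight Complex.I

theorem PhiC_deriv (z : ℂ) : HasFDerivAt PhiC (PhiC' z) z := by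
  have r : HasFDerivAt (fun z : ℂ => z.re) Complex.reCLM z := Complex.reCLM.hasFDerivAt
  have i : HasFDerivAt (fun z : ℂ => z.im) Complex.imCLM z := Complex.imCLM.hasFDerivAt
  have c1 := r.cos.add i.cos
  have c2 := r.sin.add i.sin
  have := (c1.smul_const (1:ℂ)).add (c2.smul_const Complex.I)
  convert! this using 1
  ext z
  simp [PhiC, Complex.real_smul]

theorem PhiC_det (z : ℂ) : (PhiC' z).det = Real.sin (z.im - z.re) := by
  rw [ContinuousLinearMap.det, ← LinearMap.det_toMatrix Complex.basisOneI, Matrix.det_fin_two]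
  simp [LinearMap.toMatrix_apply, PhiC', Real.sin_sub, -Complex.ofReal_sin, -Complex.ofReal_cos]
  ring

def SC : Set ℂ := {z : ℂ | 0 < z.re ∧ z.re < z.im ∧ z.im ≤ 1}

theorem SC_meas : MeasurableSet SC := by
  have h1 : MeasurableSet {z : ℂ | 0 < z.re} := measurableSet_lt measurable_const Complex.measurable_re
  have h2 : MeasurableSet {z : ℂ | z.re < z.im} := measurableSet_lt Complex.measurable_re Complex.measurable_im
  have h3 : MeasurableSet {z : ℂ | z.im ≤ 1} := measurableSet_le Complex.measurable_im measurable_const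
  exact h1.inter (h2.inter h3)

theorem PhiC_inj : InjOn PhiC SC := by
  rintro ⟨a, b⟩ ⟨h1, h2, h3⟩ ⟨a', b'⟩ ⟨h1', h2', h3'⟩ h
  simp only at h1 h2 h3 h1' h2' h3'
  have hre := congrArg Complex.re h
  have him := congrArg Complex.im h
  simp only [PhiC_re, PhiC_im] at hre him
  rw [Real.cos_add_cos, Real.cos_add_cos] at hre
  have sadd : ∀ a b : ℝ, Real.sin a + Real.sin b = 2 * Real.sin ((a + b)/2) * Real.cos ((a - b)/2) := by
    intro a b
    rw [show Real.sin a = Real.sin ((a+b)/2 + (a-b)/2) by ring_nf, show Real.sin b = Real.sin ((a+b)/2 - (a-b)/2) by ring_nf, Real.sin_add, Real.sin_sub]; ring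
  rw [sadd, sadd] at him
  have hpi := Real.pi_gt_three
  have p1 : 0 < Real.cos ((a - b)/2) := Real.cos_pos_of_mem_Ioo ⟨by linarith, by linarith⟩
  have p2 : 0 < Real.cos ((a' - b')/2) := Real.cos_pos_of_mem_Ioo ⟨by linarith, by linarith⟩
  have e1 : Real.cos ((a - b)/2) = Real.cos ((a' - b')/2) := by
    have s1 := Real.sin_sq_add_cos_sq ((a+b)/2)
    have s2 := Real.sin_sq_add_cos_sq ((a'+b')/2)
    have : Real.cos ((a - b)/2) ^ 2 = Real.cos ((a' - b')/2) ^ 2 := by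
      have q1 := congrArg (· ^ 2) hre
      have q2 := congrArg (· ^ 2) him
      ring_nf at q1 q2
      have l : Real.cos ((a - b)/2) ^ 2 * (Real.sin ((a+b)/2)^2 + Real.cos ((a+b)/2)^2) =
        Real.cos ((a' - b')/2) ^ 2 * (Real.sin ((a'+b')/2)^2 + Real.cos ((a'+b')/2)^2) := by ring_nf; linarith
      rw [s1, s2] at l; linarith
    exact (sq_eq_sq₀ p1.le p2.le).1 this
  have e2 : Real.cos ((b - a)/2) = Real.cos ((b' - a')/2) := by
    rw [← Real.cos_neg, ← Real.cos_neg ((b' - a')/2)]; convert e1 using 2 <;> ring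
  have d := Real.injOn_cos ⟨by linarith, by linarith⟩ ⟨by linarith, by linarith⟩ e2
  rw [← e1] at hre
  have e3 : Real.cos ((a + b)/2) = Real.cos ((a' + b')/2) := by
    have := mul_right_cancel₀ p1.ne' hre; linarith
  have m := Real.injOn_cos ⟨by linarith, by linarith⟩ ⟨by linarith, by linarith⟩ e3
  apply Complex.ext <;> simp <;> linarith

theorem TT_sq {F : ℝ → ℂ} (hF : Integrable F volume) (hsupp : ∀ φ, φ ∉ Ioc (0:ℝ) 1 → F φ = 0) (ξ : ℂ) :
    (TT F ξ.re ξ.im) ^ 2 = 2 * ∫ z in SC, (F z.re * F z.im) * Complex.exp (Complex.I * Complex.ofReal (inner ℝ (PhiC z) ξ)) := by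
  rw [TT, sq_split _ (int_e hF _ _)]
  congr 1
  have h := Complex.volume_preserving_equiv_real_prod.setIntegral_preimage_emb Complex.measurableEquivRealProd.measurableEmbedding
    (fun p : ℝ × ℝ => (F p.1 * Complex.exp (Complex.I * Complex.ofReal (ξ.re * Real.cos p.1 + ξ.im * Real.sin p.1))) *
     (F p.2 * Complex.exp (Complex.I * Complex.ofReal (ξ.re * Real.cos p.2 + ξ.im * Real.sin p.2)))) {p : ℝ × ℝ | p.1 < p.2}
  rw [← h]
  simp only [Complex.measurableEquivRealProd_apply]
  have hsub : SC ⊆ (⇑Complex.measurableEquivRealProd ⁻¹' {p : ℝ × ℝ | p.1 < p.2}) := by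
    intro z hz; simp [Complex.measurableEquivRealProd_apply]; exact hz.2.1
  have m1 : MeasurableSet {p : ℝ × ℝ | p.1 < p.2} := measurableSet_lt (by fun_prop) (by fun_prop)
  rw [setIntegral_eq_of_subset_of_forall_sdiff_eq_zero (Complex.measurableEquivRealProd.measurable m1) hsub]
  · apply setIntegral_congr_fun SC_meas
    intro z hz
    simp only
    rw [mul_mul_mul_comm, ← Complex.exp_add, Complex.inner]
    congr 2
    rw [← mul_add, ← Complex.ofReal_add]
    congr 2
    simp only [Complex.mul_re, Complex.conj_re, Complex.conj_im, PhiC_re, PhiC_im]; ring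
  · intro z hz
    have h1 : z.re < z.im := by simpa [Complex.measurableEquivRealProd_apply] using hz.1
    have h2 : ¬ (0 < z.re ∧ z.re < z.im ∧ z.im ≤ 1) := hz.2
    by_cases h3 : 0 < z.re
    · have : F z.im = 0 := hsupp _ (fun h4 => h2 ⟨h3, h1, h4.2⟩)
      simp [this]
    · have : F z.re = 0 := hsupp _ (fun h4 => h3 h4.1)
      simp [this]

theorem Zyg {r : ℝ} (hr1 : 1 < r) (hr4 : r < 4) :
    ∃ C : ℝ, 0 < C ∧ ∀ F : ℝ → ℂ, Measurable F → Integrable F volume → (∀ φ, φ ∉ Ioc (0:ℝ) 1 → F φ = 0) →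
      ∫⁻ p : ℝ × ℝ, ‖TT F p.1 p.2‖ₑ ^ (3 * r / (r - 1)) ≤
        ENNReal.ofReal C * (∫⁻ φ, ‖F φ‖ₑ ^ r) ^ (3 / (r - 1)) := by
  have hr0 : 0 < r - 1 := by linarith
  have hr2 : 0 < r + 2 := by linarith
  set s := 3 * r / (r + 2) with hs
  have hsm : s - 1 = 2 * (r - 1) / (r + 2) := by rw [hs]; field_simp; ring
  have hs0 : 0 < s - 1 := by rw [hsm]; positivity
  have hs1 : 1 < s := by linarith
  have hs2 : s < 2 := by rw [hs, div_lt_iff₀ hr2]; linarith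
  have hss : s / (s - 1) = 3 * r / (r - 1) / 2 := by rw [hsm, hs]; field_simp
  have h2s : 2 - (s - 1) = 6 / (r + 2) := by rw [hsm]; field_simp; ring
  obtain ⟨C1, hC1, H1⟩ := HYcv (V := ℂ) hs1 hs2.le
  obtain ⟨C2, hC2, H2⟩ := HLS (γ := s - 1) hs0 (by linarith)
  set c := (2 / π) ^ (1 - s) with hc
  have hc0 : 0 < c := by have := Real.pi_pos; positivity
  refine ⟨2 ^ (s / (s - 1)) * C1 * (c * C2) ^ (1 / (s - 1)), by positivity, ?_⟩
  intro F hm hF hsupp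
  have hG : IntegrableOn (fun z : ℂ => F z.re * F z.im) SC volume := by
    have : Integrable (fun p : ℝ × ℝ => F p.1 * F p.2) volume := hF.mul_prod hF
    have := (Complex.volume_preserving_equiv_real_prod.integrable_comp_emb Complex.measurableEquivRealProd.measurableEmbedding).2 this
    exact this.integrableOn
  have h := H1 SC PhiC PhiC' (fun z => F z.re * F z.im) SC_meas (fun z _ => (PhiC_deriv z).hasFDerivWithinAt) PhiC_inj
    (by
      intro z hz
      rw [PhiC_det]
      have hpi := Real.pi_gt_three
      have := hz.1; have := hz.2.1; have := hz.2.2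
      exact (Real.sin_pos_of_pos_of_lt_pi (by linarith) (by linarith)).ne') hG
  have e1 : ∫⁻ p : ℝ × ℝ, ‖TT F p.1 p.2‖ₑ ^ (3 * r / (r - 1)) =
     ENNReal.ofReal (2 ^ (s / (s - 1))) * ∫⁻ ξ : ℂ, ‖∫ z in SC, (F z.re * F z.im) * Complex.exp (Complex.I * Complex.ofReal (inner ℝ (PhiC z) ξ))‖ₑ ^ (s / (s - 1)) := by
    rw [← Complex.volume_preserving_equiv_real_prod.lintegral_comp_emb Complex.measurableEquivRealProd.measurableEmbedding, ← lintegral_const_mul' _ _ (by simp)]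
    apply lintegral_congr
    intro ξ
    simp only [Complex.measurableEquivRealProd_apply]
    rw [← ENNReal.ofReal_rpow_of_pos (by norm_num), ← ENNReal.mul_rpow_of_nonneg _ _ (by positivity)]
    have e2 : ENNReal.ofReal 2 * ‖∫ z in SC, (F z.re * F z.im) * Complex.exp (Complex.I * Complex.ofReal (inner ℝ (PhiC z) ξ))‖ₑ
       = ‖TT F ξ.re ξ.im‖ₑ ^ (2:ℝ) := by
      have := congrArg (fun z => ‖z‖ₑ) (TT_sq hF hsupp ξ)
      simp only [enorm_pow, enorm_mul] at this
      rw [show (2:ℝ) = ((2:ℕ):ℝ) by norm_num, ENNReal.rpow_natCast, this]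
      congr 1
      rw [← ofReal_norm]; simp
    rw [e2, ← ENNReal.rpow_mul]; congr 1; rw [hss]; ring
  rw [e1]
  have e3 : ∫⁻ z in SC, ENNReal.ofReal (|(PhiC' z).det| ^ (1 - s)) * ‖F z.re * F z.im‖ₑ ^ s ≤
      ENNReal.ofReal c * ∫⁻ φ, ∫⁻ ψ, ‖F φ‖ₑ ^ s * (‖F ψ‖ₑ ^ s * ENNReal.ofReal (|φ - ψ| ^ (-(s - 1)))) := by
    calc _ ≤ ∫⁻ z in SC, ENNReal.ofReal c * (‖F z.re‖ₑ ^ s * (‖F z.im‖ₑ ^ s * ENNReal.ofReal (|z.re - z.im| ^ (-(s - 1))))) := by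
          apply setLIntegral_mono' SC_meas
          intro z hz
          have hz1 := hz.1; have hz2 := hz.2.1; have hz3 := hz.2.2
          have hpi := Real.pi_gt_three
          have b1 : 2 / π * (z.im - z.re) ≤ Real.sin (z.im - z.re) := Real.mul_le_sin (by linarith) (by linarith)
          have b0 : 0 < 2 / π * (z.im - z.re) := by
            have : 0 < z.im - z.re := by linarith
            positivity
          have b2 : |(PhiC' z).det| ^ (1 - s) ≤ c * |z.re - z.im| ^ (-(s - 1)) := by
            rw [PhiC_det, abs_of_pos (by linarith), abs_of_neg (by linarith), hc, show -(s - 1) = 1 - s by ring, ← Real.mul_rpow (by positivity) (by linarith)]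
            apply Real.rpow_le_rpow_of_nonpos _ _ (by linarith)
            · convert b0 using 2; ring
            · convert b1 using 2; ring
          rw [enorm_mul, ENNReal.mul_rpow_of_nonneg _ _ (by linarith)]
          calc _ ≤ ENNReal.ofReal (c * |z.re - z.im| ^ (-(s - 1))) * (‖F z.re‖ₑ ^ s * ‖F z.im‖ₑ ^ s) :=
                mul_le_mul' (ENNReal.ofReal_le_ofReal b2) le_rfl
            _ = _ := by rw [ENNReal.ofReal_mul hc0.le]; ring
      _ ≤ ∫⁻ z : ℂ, ENNReal.ofReal c * (‖F z.re‖ₑ ^ s * (‖F z.im‖ₑ ^ s * ENNReal.ofReal (|z.re - z.im| ^ (-(s - 1))))) :=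
          setLIntegral_le_lintegral _ _
      _ = ENNReal.ofReal c * ∫⁻ z : ℂ, (‖F z.re‖ₑ ^ s * (‖F z.im‖ₑ ^ s * ENNReal.ofReal (|z.re - z.im| ^ (-(s - 1))))) :=
          lintegral_const_mul' _ _ (by simp)
      _ = _ := by
          congr 1
          have := Complex.volume_preserving_equiv_real_prod.lintegral_comp_emb Complex.measurableEquivRealProd.measurableEmbedding
            (fun p : ℝ × ℝ => ‖F p.1‖ₑ ^ s * (‖F p.2‖ₑ ^ s * ENNReal.ofReal (|p.1 - p.2| ^ (-(s - 1)))))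
          simp only [Complex.measurableEquivRealProd_apply] at this
          rw [this, Measure.volume_eq_prod, lintegral_prod _ (by fun_prop)]
  have e4 := H2 (fun φ => ‖F φ‖ₑ ^ s) (by fun_prop)
  have e5 : ∀ φ, (‖F φ‖ₑ ^ s) ^ (2 / (2 - (s - 1))) = ‖F φ‖ₑ ^ r := by
    intro φ; rw [← ENNReal.rpow_mul]; congr 1; rw [h2s, hs]; field_simp; norm_num
  simp only [e5] at e4
  rw [mul_assoc (2 ^ (s / (s - 1)) : ℝ), ENNReal.ofReal_mul (by positivity), mul_assoc, ENNReal.ofReal_mul hC1.le, mul_assoc]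
  refine mul_le_mul' le_rfl (h.trans (mul_le_mul' le_rfl ?_))
  calc _ ≤ (ENNReal.ofReal c * (ENNReal.ofReal C2 * (∫⁻ φ, ‖F φ‖ₑ ^ r) ^ (2 - (s - 1)))) ^ (1 / (s - 1)) :=
        ENNReal.rpow_le_rpow (e3.trans (mul_le_mul' le_rfl e4)) (by positivity)
    _ = _ := by
        rw [← mul_assoc, ← ENNReal.ofReal_mul hc0.le, ENNReal.mul_rpow_of_nonneg _ _ (by positivity), ENNReal.ofReal_rpow_of_pos (by positivity), ← ENNReal.rpow_mul]
        congr 2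
        rw [h2s, hsm]; field_simp; norm_num

theorem young_le {a b θ : ℝ} (ha : 0 ≤ a) (hb : 0 ≤ b) (h0 : 0 ≤ θ) (h1 : θ ≤ 1) :
    a ^ (1 - θ) * b ^ θ ≤ a + b := by
  have h := Real.geom_mean_le_arith_mean2_weighted (sub_nonneg.2 h1) h0 ha hb (by ring)
  nlinarith

theorem near_fin {κ : ℝ} (hκ : κ < 1) : ∫⁻ u, (Iic (1:ℝ)).indicator (fun v => ENNReal.ofReal (v ^ (-κ))) |u| ≠ ∞ := by
  rw [pow_near hκ (by norm_num)]; simp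

theorem far_fin {κ : ℝ} (hκ : 1 < κ) : ∫⁻ u, (Ioi (1:ℝ)).indicator (fun v => ENNReal.ofReal (v ^ (-κ))) |u| ≠ ∞ := by
  rw [pow_far hκ (by norm_num)]; simp

theorem ind_meas (S : Set ℝ) (hS : MeasurableSet S) (κ : ℝ) : Measurable (fun u : ℝ => S.indicator (fun v => ENNReal.ofReal (v ^ (-κ))) |u|) := by
  have : Measurable (S.indicator (fun v => ENNReal.ofReal (v ^ (-κ)))) :=
      Measurable.indicator (by fun_prop) hS
  exact this.comp (by fun_prop)

theorem W1 {σ p α : ℝ} (hσ : 0 < σ) (hp : 0 < p) (hα : 0 ≤ α) (hα1 : α * p < 1) (hα2 : 1 / p - 1 / σ < α)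
    {K : ℝ≥0∞} (hK : K ≠ ∞) :
    ∃ C : ℝ≥0∞, C ≠ ∞ ∧ ∀ f : ℝ → ℝ, Measurable f → (∀ x, 0 ≤ f x) → (∀ x, f x ≤ 1) →
      ∫⁻ x, ENNReal.ofReal (f x ^ σ) ≤ K → ∫⁻ x, ENNReal.ofReal (|x| ^ (-(α * p)) * f x ^ p) ≤ C := by
  rcases le_or_gt σ p with hc | hc
  · refine ⟨(∫⁻ u, (Iic (1:ℝ)).indicator (fun v => ENNReal.ofReal (v ^ (-(α * p)))) |u|) + K, ENNReal.add_ne_top.2 ⟨near_fin hα1, hK⟩, ?_⟩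
    intro f hm h0 h1 hf
    refine le_trans ?_ (add_le_add le_rfl hf)
    rw [← lintegral_add_left (ind_meas _ measurableSet_Iic _)]
    apply lintegral_mono
    intro x
    simp only
    by_cases hx : |x| ≤ 1
    · rw [indicator_of_mem (by exact hx)]
      refine le_trans ?_ le_self_add
      apply ENNReal.ofReal_le_ofReal
      have : f x ^ p ≤ 1 := Real.rpow_le_one (h0 x) (h1 x) hp.le
      have : 0 ≤ |x| ^ (-(α * p)) := by positivity
      nlinarith
    · refine le_trans ?_ le_add_self
      apply ENNReal.ofReal_le_ofReal
      push Not at hx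
      have e1 : |x| ^ (-(α * p)) ≤ 1 := Real.rpow_le_one_of_one_le_of_nonpos hx.le (by have := mul_nonneg hα hp.le; linarith)
      have e2 : f x ^ p ≤ f x ^ σ := by
        rcases (h0 x).eq_or_lt with h | h
        · rw [← h, Real.zero_rpow hp.ne', Real.zero_rpow hσ.ne']
        · exact Real.rpow_le_rpow_of_exponent_ge h (h1 x) hc
      have : 0 ≤ f x ^ p := Real.rpow_nonneg (h0 x) _
      nlinarith
  · set m := α * p * σ / (σ - p) with hm
    have hsp : 0 < σ - p := by linarith
    have hm1 : 1 < m := by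
      rw [hm, lt_div_iff₀ hsp]
      have : (1 / p - 1 / σ) * (p * σ) < α * (p * σ) := by gcongr
      have e : (1 / p - 1 / σ) * (p * σ) = σ - p := by field_simp
      linarith
    refine ⟨(∫⁻ u, (Iic (1:ℝ)).indicator (fun v => ENNReal.ofReal (v ^ (-(α * p)))) |u|) +
      ((∫⁻ u, (Ioi (1:ℝ)).indicator (fun v => ENNReal.ofReal (v ^ (-m))) |u|) + K), ENNReal.add_ne_top.2 ⟨near_fin hα1, ENNReal.add_ne_top.2 ⟨far_fin hm1, hK⟩⟩, ?_⟩
    intro f hm h0 h1 hf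
    refine le_trans ?_ (add_le_add le_rfl (add_le_add le_rfl hf))
    rw [← lintegral_add_left (ind_meas _ measurableSet_Ioi _), ← lintegral_add_left (ind_meas _ measurableSet_Iic _)]
    apply lintegral_mono
    intro x
    simp only
    by_cases hx : |x| ≤ 1
    · rw [indicator_of_mem (by exact hx)]
      refine le_trans ?_ le_self_add
      apply ENNReal.ofReal_le_ofReal
      have : f x ^ p ≤ 1 := Real.rpow_le_one (h0 x) (h1 x) hp.le
      have : 0 ≤ |x| ^ (-(α * p)) := by positivity
      nlinarith
    · refine le_trans ?_ le_add_self
      push Not at hx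
      rw [indicator_of_mem (s := Ioi (1:ℝ)) (by exact hx), ← ENNReal.ofReal_add (by positivity) (Real.rpow_nonneg (h0 x) _)]
      apply ENNReal.ofReal_le_ofReal
      have hx0 : 0 < |x| := by linarith
      have := young_le (a := |x| ^ (-m)) (b := f x ^ σ) (θ := p / σ) (by positivity) (Real.rpow_nonneg (h0 x) _) (by positivity) (by rw [div_le_one hσ]; exact hc.le)
      rw [← Real.rpow_mul (h0 x), ← Real.rpow_mul hx0.le] at this
      convert this using 3
      · rw [‹m = _›]; field_simp
      · field_simp

theorem W2A {σ p α β : ℝ} (hp : 0 < p) (hσp : p < σ) (hα2 : 1 / p - 1 / σ < α)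
    (hs : 2 / p - 1 / σ < α + β) {K : ℝ≥0∞} (hK : K ≠ ∞) :
    ∃ C : ℝ≥0∞, C ≠ ∞ ∧ ∀ f : ℝ → ℝ → ℝ, Measurable (Function.uncurry f) → (∀ x y, 0 ≤ f x y) →
      (∀ y, ∫⁻ x, ENNReal.ofReal (f x y ^ σ) ≤ K) →
      ∫⁻ y, ∫⁻ x, ENNReal.ofReal (if 1 < |y| ∧ |y| / 2 < |x| then |x| ^ (-(α * p)) * |y| ^ (-(β * p)) * f x y ^ p else 0) ≤ C := by
  have hσ : 0 < σ := hp.trans hσp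
  have hsp : 0 < σ - p := by linarith
  -- choose μ
  obtain ⟨μ, hμ1, hμ2⟩ : ∃ μ, 1 < μ ∧ (μ * p / σ - β * p - α * p) * σ / (σ - p) + 1 < -1 := by
    set t := σ * (α + β - (2 / p - 1 / σ)) with ht
    have ht0 : 0 < t := by apply mul_pos hσ; linarith
    refine ⟨1 + t / 2, by linarith, ?_⟩
    have : (μ : ℝ) → (μ * p / σ - β * p - α * p) * σ / (σ - p) + 1 = (μ * p - (α + β) * p * σ) / (σ - p) + 1 := by
      intro μ; field_simp; ring
    rw [this]
    have e : (α + β) * p * σ = p * t + 2 * σ - p := by rw [ht]; field_simp; ring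
    rw [e, div_add_one hsp.ne', div_lt_iff₀ hsp]
    nlinarith
  set m := α * p * σ / (σ - p) with hm
  set n := (μ * p / σ - β * p) * σ / (σ - p) with hn
  have hm1 : 1 < m := by
    rw [hm, lt_div_iff₀ hsp]
    have : (1 / p - 1 / σ) * (p * σ) < α * (p * σ) := by gcongr
    have e : (1 / p - 1 / σ) * (p * σ) = σ - p := by field_simp
    linarith
  have hnm : n - m + 1 < -1 := by
    have : n - m = (μ * p / σ - β * p - α * p) * σ / (σ - p) := by rw [hn, hm]; field_simp
    rw [this]; exact hμ2
  have hm10 : 0 < m - 1 := by linarith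
  set c := 2 * (1/2) ^ (1 - m) / (m - 1) with hc
  have hc0 : 0 < c := by positivity
  refine ⟨(∫⁻ u, (Ioi (1:ℝ)).indicator (fun v => ENNReal.ofReal (v ^ (-μ))) |u|) * K + ENNReal.ofReal c * (∫⁻ u, (Ioi (1:ℝ)).indicator (fun v => ENNReal.ofReal (v ^ (-(-(n - m + 1))))) |u|), ?_, ?_⟩
  · refine ENNReal.add_ne_top.2 ⟨ENNReal.mul_ne_top (far_fin hμ1) hK, ENNReal.mul_ne_top (by simp) (far_fin (by linarith))⟩
  intro f hfm h0 hf
  have key : ∀ y x, (if 1 < |y| ∧ |y| / 2 < |x| then |x| ^ (-(α * p)) * |y| ^ (-(β * p)) * f x y ^ p else 0) ≤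
     (if 1 < |y| ∧ |y| / 2 < |x| then |y| ^ (-μ) * f x y ^ σ + |y| ^ n * |x| ^ (-m) else 0) := by
    intro y x
    split_ifs with h
    · have hy : 0 < |y| := by linarith [h.1]
      have hx : 0 < |x| := by linarith [h.2]
      have := young_le (b := |y| ^ (-μ) * f x y ^ σ) (a := |y| ^ n * |x| ^ (-m)) (θ := p / σ) (by positivity) (mul_nonneg (by positivity) (Real.rpow_nonneg (h0 _ _) _)) (by positivity) (by rw [div_le_one hσ]; exact hσp.le)
      rw [Real.mul_rpow (by positivity) (Real.rpow_nonneg (h0 _ _) _), Real.mul_rpow (by positivity) (by positivity), ← Real.rpow_mul (h0 x y), ← Real.rpow_mul hx.le, ← Real.rpow_mul hy.le, ← Real.rpow_mul hy.le] at this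
      rw [add_comm] at this
      refine le_trans (le_of_eq ?_) this
      have e1 : σ * (p / σ) = p := by field_simp
      have e2 : -m * (1 - p / σ) = -(α * p) := by rw [hm]; field_simp
      have e3 : |y| ^ (-(β * p)) = |y| ^ (n * (1 - p / σ)) * |y| ^ (-μ * (p / σ)) := by
        rw [← Real.rpow_add hy]; congr 1; rw [hn]; field_simp; ring
      rw [e1, e2, e3]; ring
    · exact le_rfl
  have bound : ∀ y, ∫⁻ x, ENNReal.ofReal (if 1 < |y| ∧ |y| / 2 < |x| then |x| ^ (-(α * p)) * |y| ^ (-(β * p)) * f x y ^ p else 0) ≤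
     (Ioi (1:ℝ)).indicator (fun v => ENNReal.ofReal (v ^ (-μ))) |y| * K + ENNReal.ofReal c * (Ioi (1:ℝ)).indicator (fun v => ENNReal.ofReal (v ^ (-(-(n - m + 1))))) |y| := by
    intro y
    by_cases hy : 1 < |y|
    · rw [indicator_of_mem (by exact hy), indicator_of_mem (by exact hy)]
      have hy0 : 0 < |y| := by linarith
      have fm : Measurable (fun x => f x y) := hfm.comp (by fun_prop : Measurable fun x => (x, y))
      calc _ ≤ ∫⁻ x, (ENNReal.ofReal (|y| ^ (-μ)) * ENNReal.ofReal (f x y ^ σ) + ENNReal.ofReal (|y| ^ n) * (Ioi (|y|/2)).indicator (fun v => ENNReal.ofReal (v ^ (-m))) |x|) := by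
            apply lintegral_mono
            intro x
            refine (ENNReal.ofReal_le_ofReal (key y x)).trans ?_
            by_cases hx : |y| / 2 < |x|
            · simp only
              rw [if_pos ⟨hy, hx⟩, indicator_of_mem (by exact hx), ENNReal.ofReal_add (mul_nonneg (by positivity) (Real.rpow_nonneg (h0 _ _) _)) (by positivity), ENNReal.ofReal_mul (by positivity), ENNReal.ofReal_mul (by positivity)]
            · rw [if_neg (fun h => hx h.2)]; simp
        _ = ENNReal.ofReal (|y| ^ (-μ)) * (∫⁻ x, ENNReal.ofReal (f x y ^ σ)) + ENNReal.ofReal (|y| ^ n) * ∫⁻ x, (Ioi (|y|/2)).indicator (fun v => ENNReal.ofReal (v ^ (-m))) |x| := by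
            rw [lintegral_add_left (by fun_prop), lintegral_const_mul' _ _ (by simp), lintegral_const_mul' _ _ (by simp)]
        _ ≤ _ := by
            rw [pow_far hm1 (by positivity)]
            apply add_le_add (mul_le_mul' le_rfl (hf y))
            rw [← ENNReal.ofReal_mul (by positivity), ← ENNReal.ofReal_mul (by positivity)]
            apply ENNReal.ofReal_le_ofReal
            apply le_of_eq
            rw [hc, show |y| / 2 = |y| * (1/2) by ring, Real.mul_rpow (by positivity) (by norm_num)]
            have : |y| ^ (-(-(n - m + 1))) = |y| ^ n * |y| ^ (1 - m) := by
              rw [← Real.rpow_add hy0]; congr 1; ring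
            rw [this]; ring
    · rw [indicator_of_notMem (by exact hy), indicator_of_notMem (by exact hy)]
      simp [hy]
  calc _ ≤ _ := lintegral_mono bound
    _ = _ := by
      rw [lintegral_add_left ((ind_meas _ measurableSet_Ioi _).mul_const _), lintegral_mul_const _ (ind_meas _ measurableSet_Ioi _), lintegral_const_mul' _ _ (by simp)]

theorem W2C {σ p ρ α β : ℝ} (hσ : 0 < σ) (hσp : σ ≤ p) (hρ : p < ρ) (hα : 0 ≤ α)
    (hs : (ρ - p) / (ρ - σ) < (α + β) * p) {K : ℝ≥0∞} (hK : K ≠ ∞) :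
    ∃ C : ℝ≥0∞, C ≠ ∞ ∧ ∀ f : ℝ → ℝ → ℝ, Measurable (Function.uncurry f) → (∀ x y, 0 ≤ f x y) →
      (∀ y, ∫⁻ x, ENNReal.ofReal (f x y ^ σ) ≤ K) → (∫⁻ y, ∫⁻ x, ENNReal.ofReal (f x y ^ ρ) ≤ K) →
      ∫⁻ y, ∫⁻ x, ENNReal.ofReal (if 1 < |y| ∧ |y| / 2 < |x| then |x| ^ (-(α * p)) * |y| ^ (-(β * p)) * f x y ^ p else 0) ≤ C := by
  have hp : 0 < p := by linarith
  have hρσ : 0 < ρ - σ := by linarith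
  set θ := (p - σ) / (ρ - σ) with hθ
  have hθ0 : 0 ≤ θ := div_nonneg (by linarith) hρσ.le
  have hθ1 : θ < 1 := by rw [hθ, div_lt_one hρσ]; linarith
  have h1θ : 1 - θ = (ρ - p) / (ρ - σ) := by rw [hθ]; field_simp; ring
  have h1θ' : 0 < 1 - θ := by linarith
  set μ := (α + β) * p / (1 - θ) with hμ
  have hμ1 : 1 < μ := by rw [hμ, lt_div_iff₀ h1θ', h1θ]; linarith
  set c := (2:ℝ) ^ (α * p) with hc
  have hc0 : 0 < c := by positivity
  refine ⟨ENNReal.ofReal c * ((∫⁻ u, (Ioi (1:ℝ)).indicator (fun v => ENNReal.ofReal (v ^ (-μ))) |u|) * K + K), ?_, ?_⟩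
  · exact ENNReal.mul_ne_top (by simp) (ENNReal.add_ne_top.2 ⟨ENNReal.mul_ne_top (far_fin hμ1) hK, hK⟩)
  intro f hfm h0 hf hf2
  have key : ∀ y x, ENNReal.ofReal (if 1 < |y| ∧ |y| / 2 < |x| then |x| ^ (-(α * p)) * |y| ^ (-(β * p)) * f x y ^ p else 0) ≤
     ENNReal.ofReal c * ((Ioi (1:ℝ)).indicator (fun v => ENNReal.ofReal (v ^ (-μ))) |y| * ENNReal.ofReal (f x y ^ σ) + ENNReal.ofReal (f x y ^ ρ)) := by
    intro y x
    split_ifs with h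
    · have hy : 0 < |y| := by linarith [h.1]
      have hx : 0 < |x| := by linarith [h.2]
      rw [indicator_of_mem (by exact h.1), ← ENNReal.ofReal_mul (by positivity), ← ENNReal.ofReal_add (mul_nonneg (by positivity) (Real.rpow_nonneg (h0 _ _) _)) (Real.rpow_nonneg (h0 _ _) _), ← ENNReal.ofReal_mul (by positivity)]
      apply ENNReal.ofReal_le_ofReal
      have e0 : |x| ^ (-(α * p)) ≤ c * |y| ^ (-(α * p)) := by
        have := Real.rpow_le_rpow_of_nonpos (z := -(α * p)) (by positivity) h.2.le (by have := mul_nonneg hα hp.le; linarith)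
        refine this.trans (le_of_eq ?_)
        rw [hc, Real.div_rpow hy.le (by norm_num), Real.rpow_neg (by norm_num : (0:ℝ) ≤ 2), div_inv_eq_mul, mul_comm]
      have := young_le (a := |y| ^ (-μ) * f x y ^ σ) (b := f x y ^ ρ) (θ := θ) (mul_nonneg (by positivity) (Real.rpow_nonneg (h0 _ _) _)) (Real.rpow_nonneg (h0 _ _) _) hθ0 hθ1.le
      refine le_trans ?_ (mul_le_mul_of_nonneg_left this hc0.le)
      rw [Real.mul_rpow (by positivity) (Real.rpow_nonneg (h0 _ _) _), ← Real.rpow_mul (h0 x y), ← Real.rpow_mul hy.le, ← Real.rpow_mul (h0 x y)]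
      have e1 : f x y ^ (σ * (1 - θ)) * f x y ^ (ρ * θ) = f x y ^ p := by
        rw [← Real.rpow_add_of_nonneg (h0 x y) (by positivity) (mul_nonneg (by linarith) hθ0)]
        congr 1
        rw [h1θ, hθ]; field_simp; ring
      have e2 : |y| ^ (-μ * (1 - θ)) = |y| ^ (-(α * p)) * |y| ^ (-(β * p)) := by
        rw [← Real.rpow_add hy]; congr 1; rw [hμ]; field_simp; ring
      rw [mul_assoc (|y| ^ (-μ * (1 - θ))), e1, e2, ← mul_assoc, ← mul_assoc]
      have : 0 ≤ f x y ^ p := Real.rpow_nonneg (h0 _ _) _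
      gcongr
    · simp
  have fm : ∀ y, Measurable (fun x => f x y) := fun y => hfm.comp (by fun_prop : Measurable fun x => (x, y))
  calc _ ≤ ∫⁻ y, ∫⁻ x, _ := lintegral_mono fun y => lintegral_mono fun x => key y x
    _ = ∫⁻ y, ENNReal.ofReal c * ((Ioi (1:ℝ)).indicator (fun v => ENNReal.ofReal (v ^ (-μ))) |y| * (∫⁻ x, ENNReal.ofReal (f x y ^ σ)) + ∫⁻ x, ENNReal.ofReal (f x y ^ ρ)) := by
        apply lintegral_congr; intro y
        have := fm y
        rw [lintegral_const_mul' _ _ (by simp), lintegral_add_left (by fun_prop), lintegral_const_mul _ (by fun_prop)]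
    _ ≤ ∫⁻ y, ENNReal.ofReal c * ((Ioi (1:ℝ)).indicator (fun v => ENNReal.ofReal (v ^ (-μ))) |y| * K + ∫⁻ x, ENNReal.ofReal (f x y ^ ρ)) := by
        apply lintegral_mono; intro y
        exact mul_le_mul' le_rfl (add_le_add (mul_le_mul' le_rfl (hf y)) le_rfl)
    _ = ENNReal.ofReal c * ((∫⁻ u, (Ioi (1:ℝ)).indicator (fun v => ENNReal.ofReal (v ^ (-μ))) |u|) * K + ∫⁻ y, ∫⁻ x, ENNReal.ofReal (f x y ^ ρ)) := by
        rw [lintegral_const_mul' _ _ (by simp), lintegral_add_left ((ind_meas _ measurableSet_Ioi _).mul_const _), lintegral_mul_const _ (ind_meas _ measurableSet_Ioi _)]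
    _ ≤ _ := mul_le_mul' le_rfl (add_le_add le_rfl hf2)

/-- admissibility of the corner region -/
def Good (σ ρ p α β : ℝ) : Prop :=
  (p < σ ∧ 2 / p - 1 / σ < α + β) ∨ (σ ≤ p ∧ p < ρ ∧ (ρ - p) / (ρ - σ) < (α + β) * p)

theorem W2corner {σ p ρ α β : ℝ} (hσ : 0 < σ) (hp : 0 < p) (hα : 0 ≤ α) (hα2 : 1 / p - 1 / σ < α)
    (hg : Good σ ρ p α β) {K : ℝ≥0∞} (hK : K ≠ ∞) :
    ∃ C : ℝ≥0∞, C ≠ ∞ ∧ ∀ f : ℝ → ℝ → ℝ, Measurable (Function.uncurry f) → (∀ x y, 0 ≤ f x y) →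
      (∀ y, ∫⁻ x, ENNReal.ofReal (f x y ^ σ) ≤ K) → (∫⁻ y, ∫⁻ x, ENNReal.ofReal (f x y ^ ρ) ≤ K) →
      ∫⁻ y, ∫⁻ x, ENNReal.ofReal (if 1 < |y| ∧ |y| / 2 < |x| then |x| ^ (-(α * p)) * |y| ^ (-(β * p)) * f x y ^ p else 0) ≤ C := by
  rcases hg with ⟨h1, h2⟩ | ⟨h1, h2, h3⟩
  · obtain ⟨C, hC, H⟩ := W2A hp h1 hα2 h2 hK
    exact ⟨C, hC, fun f a b c _ => H f a b c⟩
  · exact W2C hσ h1 h2 hα h3 hK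

theorem W2 {σ p ρ α β : ℝ} (hσ : 0 < σ) (hp : 0 < p) (hα : 0 ≤ α) (hβ : 0 ≤ β) (hα1 : α * p < 1) (hβ1 : β * p < 1)
    (hα2 : 1 / p - 1 / σ < α) (hβ2 : 1 / p - 1 / σ < β)
    (hg : Good σ ρ p α β) {K : ℝ≥0∞} (hK : K ≠ ∞) :
    ∃ C : ℝ≥0∞, C ≠ ∞ ∧ ∀ f : ℝ → ℝ → ℝ, Measurable (Function.uncurry f) → (∀ x y, 0 ≤ f x y) → (∀ x y, f x y ≤ 1) →
      (∀ y, ∫⁻ x, ENNReal.ofReal (f x y ^ σ) ≤ K) → (∀ x, ∫⁻ y, ENNReal.ofReal (f x y ^ σ) ≤ K) →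
      (∫⁻ y, ∫⁻ x, ENNReal.ofReal (f x y ^ ρ) ≤ K) →
      ∫⁻ y, ∫⁻ x, ENNReal.ofReal (|x| ^ (-(α * p)) * |y| ^ (-(β * p)) * f x y ^ p) ≤ C := by
  obtain ⟨C1, hC1, H1⟩ := W1 hσ hp hα hα1 hα2 hK
  obtain ⟨C2, hC2, H2⟩ := W1 hσ hp hβ hβ1 hβ2 hK
  obtain ⟨C3, hC3, H3⟩ := W2corner hσ hp hα hα2 hg hK
  obtain ⟨C4, hC4, H4⟩ := W2corner hσ hp hβ hβ2 (α := β) (β := α) (by rw [Good, add_comm β α]; exact hg) hK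
  refine ⟨((∫⁻ u, (Iic (1:ℝ)).indicator (fun v => ENNReal.ofReal (v ^ (-(β * p)))) |u|) * C1 +
    (∫⁻ u, (Iic (1:ℝ)).indicator (fun v => ENNReal.ofReal (v ^ (-(α * p)))) |u|) * C2) + (C3 + C4), ?_, ?_⟩
  · exact ENNReal.add_ne_top.2 ⟨ENNReal.add_ne_top.2 ⟨ENNReal.mul_ne_top (near_fin hβ1) hC1, ENNReal.mul_ne_top (near_fin hα1) hC2⟩, ENNReal.add_ne_top.2 ⟨hC3, hC4⟩⟩
  intro f hfm h0 h1 hx hy hρ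
  have fm : ∀ y, Measurable (fun x => f x y) := fun y => hfm.comp (by fun_prop : Measurable fun x => (x, y))
  have fm' : ∀ x, Measurable (fun y => f x y) := fun x => hfm.comp (by fun_prop : Measurable fun y => (x, y))
  have hfs : Measurable (fun q : ℝ × ℝ => f q.2 q.1) := hfm.comp measurable_swap
  set A1 : ℝ → ℝ → ℝ≥0∞ := fun y x => (Iic (1:ℝ)).indicator (fun v => ENNReal.ofReal (v ^ (-(β * p)))) |y| * ENNReal.ofReal (|x| ^ (-(α * p)) * f x y ^ p) with hA1
  set A2 : ℝ → ℝ → ℝ≥0∞ := fun y x => (Iic (1:ℝ)).indicator (fun v => ENNReal.ofReal (v ^ (-(α * p)))) |x| * ENNReal.ofReal (|y| ^ (-(β * p)) * f x y ^ p) with hA2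
  set A3 : ℝ → ℝ → ℝ≥0∞ := fun y x => ENNReal.ofReal (if 1 < |y| ∧ |y| / 2 < |x| then |x| ^ (-(α * p)) * |y| ^ (-(β * p)) * f x y ^ p else 0) with hA3
  set A4 : ℝ → ℝ → ℝ≥0∞ := fun y x => ENNReal.ofReal (if 1 < |x| ∧ |x| / 2 < |y| then |y| ^ (-(β * p)) * |x| ^ (-(α * p)) * f x y ^ p else 0) with hA4
  have m1 : Measurable (Function.uncurry A1) := by
    apply Measurable.mul
    · exact (ind_meas _ measurableSet_Iic _).comp measurable_fst
    · change Measurable (fun q : ℝ × ℝ => ENNReal.ofReal (|q.2| ^ (-(α * p)) * f q.2 q.1 ^ p))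
      fun_prop
  have m2 : Measurable (Function.uncurry A2) := by
    apply Measurable.mul
    · exact (ind_meas _ measurableSet_Iic _).comp measurable_snd
    · change Measurable (fun q : ℝ × ℝ => ENNReal.ofReal (|q.1| ^ (-(β * p)) * f q.2 q.1 ^ p))
      fun_prop
  have m3 : Measurable (Function.uncurry A3) := by
    apply ENNReal.measurable_ofReal.comp
    apply Measurable.ite
    · have s1 : MeasurableSet {q : ℝ × ℝ | 1 < |q.1|} := measurableSet_lt (by fun_prop) (by fun_prop)
      have s2 : MeasurableSet {q : ℝ × ℝ | |q.1| / 2 < |q.2|} := measurableSet_lt (by fun_prop) (by fun_prop)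
      exact s1.inter s2
    · fun_prop
    · fun_prop
  have m4 : Measurable (Function.uncurry A4) := by
    apply ENNReal.measurable_ofReal.comp
    apply Measurable.ite
    · have s1 : MeasurableSet {q : ℝ × ℝ | 1 < |q.2|} := measurableSet_lt (by fun_prop) (by fun_prop)
      have s2 : MeasurableSet {q : ℝ × ℝ | |q.2| / 2 < |q.1|} := measurableSet_lt (by fun_prop) (by fun_prop)
      exact s1.inter s2
    · fun_prop
    · fun_prop
  have key : ∀ y x, ENNReal.ofReal (|x| ^ (-(α * p)) * |y| ^ (-(β * p)) * f x y ^ p) ≤ (A1 y x + A2 y x) + (A3 y x + A4 y x) := by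
    intro y x
    have f0 : 0 ≤ f x y ^ p := Real.rpow_nonneg (h0 _ _) _
    by_cases c1 : |y| ≤ 1
    · refine le_trans (le_trans (le_of_eq ?_) le_self_add) le_self_add
      rw [hA1]; simp only
      rw [indicator_of_mem (by exact c1), ← ENNReal.ofReal_mul (by positivity)]
      congr 1; ring
    by_cases c2 : |x| ≤ 1
    · refine le_trans (le_trans (le_of_eq ?_) le_add_self) le_self_add
      rw [hA2]; simp only
      rw [indicator_of_mem (by exact c2), ← ENNReal.ofReal_mul (by positivity)]
      congr 1; ring
    push Not at c1 c2
    by_cases c3 : |y| / 2 < |x|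
    · refine le_trans (le_trans (le_of_eq ?_) le_self_add) le_add_self
      rw [hA3]; simp only
      rw [if_pos ⟨c1, c3⟩]
    · refine le_trans (le_trans (le_of_eq ?_) le_add_self) le_add_self
      rw [hA4]; simp only
      rw [if_pos ⟨c2, by linarith⟩]
      congr 1; ring
  have B : ∀ A : ℝ → ℝ → ℝ≥0∞, Measurable (Function.uncurry A) → (∀ y, Measurable (A y)) ∧ Measurable (fun y => ∫⁻ x, A y x) := by
    intro A hA
    exact ⟨fun y => hA.comp (by fun_prop : Measurable fun x => (y, x)), Measurable.lintegral_prod_right' hA⟩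
  calc _ ≤ ∫⁻ y, ∫⁻ x, ((A1 y x + A2 y x) + (A3 y x + A4 y x)) := lintegral_mono fun y => lintegral_mono fun x => key y x
    _ = ∫⁻ y, (((∫⁻ x, A1 y x) + (∫⁻ x, A2 y x)) + ((∫⁻ x, A3 y x) + (∫⁻ x, A4 y x))) := by
        apply lintegral_congr; intro y
        rw [lintegral_add_left (show Measurable (fun x => A1 y x + A2 y x) from ((B A1 m1).1 y).add ((B A2 m2).1 y)), lintegral_add_left ((B A1 m1).1 y), lintegral_add_left ((B A3 m3).1 y)]
    _ = ((∫⁻ y, ∫⁻ x, A1 y x) + (∫⁻ y, ∫⁻ x, A2 y x)) + ((∫⁻ y, ∫⁻ x, A3 y x) + (∫⁻ y, ∫⁻ x, A4 y x)) := by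
        rw [lintegral_add_left (show Measurable (fun y => (∫⁻ x, A1 y x) + ∫⁻ x, A2 y x) from ((B A1 m1).2).add ((B A2 m2).2)), lintegral_add_left ((B A1 m1).2), lintegral_add_left ((B A3 m3).2)]
    _ ≤ _ := by
        refine add_le_add (add_le_add ?_ ?_) (add_le_add ?_ ?_)
        · rw [← lintegral_mul_const _ (ind_meas _ measurableSet_Iic _)]
          apply lintegral_mono; intro y
          rw [hA1]; simp only
          have := fm y
          rw [lintegral_const_mul _ (by fun_prop)]
          exact mul_le_mul' le_rfl (H1 (fun x => f x y) (fm y) (fun x => h0 x y) (fun x => h1 x y) (hx y))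
        · rw [lintegral_lintegral_swap m2.aemeasurable, ← lintegral_mul_const _ (ind_meas _ measurableSet_Iic _)]
          apply lintegral_mono; intro x
          rw [hA2]; simp only
          have := fm' x
          rw [lintegral_const_mul _ (by fun_prop)]
          exact mul_le_mul' le_rfl (H2 (fun y => f x y) (fm' x) (fun y => h0 x y) (fun y => h1 x y) (hy x))
        · exact H3 f hfm h0 hx hρ
        · rw [lintegral_lintegral_swap m4.aemeasurable]
          refine H4 (fun a b => f b a) hfs (fun a b => h0 b a) hy ?_
          rw [lintegral_lintegral_swap]
          · exact hρ
          · apply Measurable.aemeasurable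
            apply ENNReal.measurable_ofReal.comp
            exact (hfm.pow_const _)

theorem conv_step {q lam a b : ℝ} (hq : 1 < q) (hl0 : 0 < lam) (hl1 : lam < 1) (ha : 0 ≤ a) (hb : 0 ≤ b) :
    (a + lam * b) ^ q ≤ (1 - lam) ^ (1 - q) * a ^ q + lam * b ^ q := by
  have h := (convexOn_rpow hq.le).2 (show a / (1 - lam) ∈ Ici (0:ℝ) from div_nonneg ha (by linarith)) (show b ∈ Ici (0:ℝ) from hb)
    (show 0 ≤ 1 - lam by linarith) hl0.le (by ring)
  simp only [smul_eq_mul] at h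
  have e1 : (1 - lam) * (a / (1 - lam)) = a := by
    have : 1 - lam ≠ 0 := by linarith
    field_simp
  rw [e1] at h
  refine h.trans (le_of_eq ?_)
  rw [Real.div_rpow ha (by linarith), Real.rpow_sub (by linarith), Real.rpow_one]
  ring

def Bseq (lam : ℝ) (a : ℕ → ℝ) (j : ℕ) : ℝ := ∑ i ∈ Finset.range (j+1), a i * lam ^ (j - i)

theorem Bseq_nonneg {lam : ℝ} {a : ℕ → ℝ} (hl : 0 < lam) (ha : ∀ i, 0 ≤ a i) (j : ℕ) : 0 ≤ Bseq lam a j :=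
  Finset.sum_nonneg fun i _ => mul_nonneg (ha i) (by positivity)

theorem Bseq_succ {lam : ℝ} {a : ℕ → ℝ} (j : ℕ) : Bseq lam a (j+1) = a (j+1) + lam * Bseq lam a j := by
  rw [Bseq, Finset.sum_range_succ, Bseq, Finset.mul_sum, add_comm]
  congr 1
  · simp
  · apply Finset.sum_congr rfl
    intro i hi
    have : i ≤ j := by simpa [Nat.lt_succ_iff] using hi
    rw [Nat.succ_sub this, pow_succ]; ring

theorem Bseq_sum {q lam : ℝ} {a : ℕ → ℝ} (hq : 1 < q) (hl0 : 0 < lam) (hl1 : lam < 1) (ha : ∀ i, 0 ≤ a i) (n : ℕ) :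
    ∑ j ∈ Finset.range n, Bseq lam a j ^ q ≤ (1 - lam) ^ (-q) * ∑ j ∈ Finset.range n, a j ^ q := by
  have hc : (1:ℝ) ≤ (1 - lam) ^ (1 - q) := Real.one_le_rpow_of_pos_of_le_one_of_nonpos (by linarith) (by linarith) (by linarith)
  have key : ∀ n, (1 - lam) * ∑ j ∈ Finset.range (n+1), Bseq lam a j ^ q + lam * Bseq lam a n ^ q ≤ (1 - lam) ^ (1 - q) * ∑ j ∈ Finset.range (n+1), a j ^ q := by
    intro n
    induction n with
    | zero =>
      have : Bseq lam a 0 = a 0 := by simp [Bseq]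
      simp only [zero_add, Finset.sum_range_one, this]
      have := Real.rpow_nonneg (ha 0) q
      nlinarith
    | succ n ih =>
      rw [Finset.sum_range_succ, Finset.sum_range_succ _ (n+1)]
      have h := conv_step hq hl0 hl1 (ha (n+1)) (Bseq_nonneg hl0 ha n)
      rw [← Bseq_succ] at h
      rw [mul_add, mul_add]
      linarith
  cases n with
  | zero => simp
  | succ n =>
    have h := key n
    have h2 : 0 ≤ lam * Bseq lam a n ^ q := mul_nonneg hl0.le (Real.rpow_nonneg (Bseq_nonneg hl0 ha n) _)
    have h3 : (1 - lam) ^ (-q) = (1 - lam) ^ (1 - q) / (1 - lam) := by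
      rw [show 1 - q = -q + 1 by ring, Real.rpow_add (by linarith), Real.rpow_one]
      exact (mul_div_cancel_right₀ _ (by linarith : (1 - lam) ≠ 0)).symm
    rw [h3, div_mul_eq_mul_div, le_div_iff₀ (by linarith)]
    linarith

theorem bern {q : ℝ} (hq : 1 < q) (A f : ℝ≥0∞) : (A + f) ^ q ≤ A ^ q + ENNReal.ofReal q * (f * (A + f) ^ (q - 1)) := by
  by_cases hA : A = ∞
  · simp [hA, show (0:ℝ) < q by linarith]
  by_cases hf : f = ∞
  · simp [hf, show (0:ℝ) < q - 1 by linarith, ENNReal.mul_top, show (0:ℝ) < q by linarith]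
  lift A to NNReal using hA
  lift f to NNReal using hf
  by_cases h0 : A + f = 0
  · have : (A:ℝ≥0∞) + f = 0 := by exact_mod_cast h0
    rw [this, ENNReal.zero_rpow_of_pos (by linarith)]; exact bot_le
  have hpos : (0:ℝ) < A + f := by
    have : (0:NNReal) < A + f := pos_iff_ne_zero.2 h0
    exact_mod_cast this
  have h := one_add_mul_self_le_rpow_one_add (s := -((f:ℝ) / (A + f))) (p := q) (by
    rw [neg_le_neg_iff, div_le_one hpos]; linarith [A.coe_nonneg]) hq.le
  have e : 1 + -((f:ℝ) / (A + f)) = A / (A + f) := by field_simp; ring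
  rw [e, Real.div_rpow A.coe_nonneg hpos.le] at h
  have h2 : ((A:ℝ) + f) ^ q ≤ (A:ℝ) ^ q + q * (f * ((A:ℝ) + f) ^ (q - 1)) := by
    have hq0 : 0 < ((A:ℝ) + f) ^ q := by positivity
    rw [le_div_iff₀ hq0] at h
    rw [Real.rpow_sub hpos, Real.rpow_one]
    have : (1 + q * -((f:ℝ) / (A + f))) * ((A:ℝ) + f) ^ q = ((A:ℝ) + f) ^ q - q * (f * (((A:ℝ) + f) ^ q / (A + f))) := by
      field_simp; ring
    linarith
  have h3 := ENNReal.ofReal_le_ofReal h2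
  rw [ENNReal.ofReal_add (by positivity) (by positivity), ENNReal.ofReal_mul (by linarith), ENNReal.ofReal_mul (by positivity),
    ← ENNReal.ofReal_rpow_of_pos hpos, ← ENNReal.ofReal_rpow_of_nonneg A.coe_nonneg (by linarith), ← ENNReal.ofReal_rpow_of_pos hpos,
    ENNReal.ofReal_add A.coe_nonneg f.coe_nonneg] at h3
  simpa using h3

theorem sum_pow_le {q : ℝ} (hq : 1 < q) (f : ℕ → ℝ≥0∞) (n : ℕ) :
    (∑ j ∈ Finset.range n, f j) ^ q ≤ ENNReal.ofReal q * ∑ j ∈ Finset.range n, f j * (∑ i ∈ Finset.range (j+1), f i) ^ (q - 1) := by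
  induction n with
  | zero => simp [show (0:ℝ) < q by linarith]
  | succ n ih =>
    rw [Finset.sum_range_succ _ n]
    refine (bern hq _ _).trans ?_
    rw [Finset.sum_range_succ _ n, mul_add]
    refine add_le_add ih ?_
    rw [Finset.sum_range_succ _ n]

theorem Lp_sum {X : Type*} [MeasurableSpace X] (μ : Measure X) {P : ℝ} (hP : 1 ≤ P) (f : ℕ → X → ℝ≥0∞) (hf : ∀ j, Measurable (f j)) (n : ℕ) :
    (∫⁻ x, (∑ j ∈ Finset.range n, f j x) ^ P ∂μ) ^ (1 / P) ≤ ∑ j ∈ Finset.range n, (∫⁻ x, (f j x) ^ P ∂μ) ^ (1 / P) := by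
  induction n with
  | zero =>
    have h1 : 0 < P := by linarith
    simp [h1]
  | succ n ih =>
    simp only [Finset.sum_range_succ _ n]
    refine (ENNReal.lintegral_Lp_add_le (f := fun x => ∑ j ∈ Finset.range n, f j x) (g := f n) ?_ (hf n).aemeasurable hP).trans ?_
    · exact (Finset.measurable_fun_sum _ fun i _ => hf i).aemeasurable
    · exact add_le_add ih le_rfl

theorem Summ {X : Type*} [MeasurableSpace X] (μ : Measure X) {q D p1 P K : ℝ} (hq : 1 < q) (hD : 1 < D) (hp1 : q < p1)
    (hP : P = (q - 1) * p1 / (p1 - 1)) (hP1 : 1 ≤ P) (hK : 0 < K) :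
    ∃ C > 0, ∀ (f : ℕ → X → ℝ≥0∞) (a : ℕ → ℝ), (∀ j, Measurable (f j)) → (∀ j, 0 ≤ a j) →
      (∀ j, ∫⁻ x, f j x ^ p1 ∂μ ≤ ENNReal.ofReal (K * a j ^ p1 * D ^ ((j:ℝ) * (1 - p1 / q)))) →
      (∀ j, ∫⁻ x, f j x ^ P ∂μ ≤ ENNReal.ofReal (K * a j ^ P * D ^ ((j:ℝ) * (1 - P / q)))) →
      ∀ n, ∫⁻ x, (∑ j ∈ Finset.range n, f j x) ^ q ∂μ ≤ ENNReal.ofReal (C * ∑ j ∈ Finset.range n, a j ^ q) := by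
  have hp0 : 0 < p1 := by linarith
  have hP0 : 0 < P := by linarith
  set η : ℝ := 1 / P - 1 / q with hη
  have hηq : η * (q - 1) = 1 / q - 1 / p1 := by
    have h1 : q - 1 ≠ 0 := by linarith
    have h2 : p1 - 1 ≠ 0 := by linarith
    rw [hη, hP]
    field_simp; ring
  have hη0 : 0 < η := by
    have : 0 < η * (q - 1) := by
      rw [hηq, sub_pos]; exact one_div_lt_one_div_of_lt (by linarith) hp1
    exact pos_of_mul_pos_left this (by linarith)
  set lam : ℝ := D ^ (-η) with hlam
  have hl0 : 0 < lam := by positivity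
  have hl1 : lam < 1 := Real.rpow_lt_one_of_one_lt_of_neg hD (by linarith)
  have h1l : 0 < 1 - lam := by linarith
  refine ⟨q * (K ^ (1 / p1) * (K ^ (1 / P)) ^ (q - 1)) * (1 - lam) ^ (-q), by positivity, ?_⟩
  intro f a hf ha H1 H2 n
  have hpow : ∀ (p : ℝ), 0 < p → ∀ j, (∫⁻ x, f j x ^ p ∂μ ≤ ENNReal.ofReal (K * a j ^ p * D ^ ((j:ℝ) * (1 - p / q)))) →
      (∫⁻ x, f j x ^ p ∂μ) ^ (1 / p) ≤ ENNReal.ofReal (K ^ (1 / p) * (a j * D ^ ((j:ℝ) * (1 / p - 1 / q)))) := by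
    intro p hp j h
    have haj := ha j
    refine (ENNReal.rpow_le_rpow h (by positivity)).trans (le_of_eq ?_)
    rw [ENNReal.ofReal_rpow_of_nonneg (by positivity) (by positivity), Real.mul_rpow (by positivity) (by positivity),
      Real.mul_rpow (by positivity) (by positivity), ← Real.rpow_mul haj, ← Real.rpow_mul (by positivity),
      mul_one_div_cancel hp.ne', Real.rpow_one, mul_assoc]
    congr 4
    field_simp
  have G : ∀ j, ∫⁻ x, f j x * (∑ i ∈ Finset.range (j+1), f i x) ^ (q - 1) ∂μ ≤ ENNReal.ofReal ((K ^ (1 / p1) * (K ^ (1 / P)) ^ (q - 1)) * Bseq lam a j ^ q) := by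
    intro j
    have haj := ha j
    have hB := Bseq_nonneg hl0 ha j
    have hpq : p1.HolderConjugate (p1 / (p1 - 1)) := Real.HolderConjugate.conjExponent (by linarith)
    refine (ENNReal.lintegral_mul_le_Lp_mul_Lq μ hpq (hf j).aemeasurable ((Finset.measurable_fun_sum _ fun i _ => hf i).pow_const _).aemeasurable).trans ?_
    have e1 : ∀ x, ((∑ i ∈ Finset.range (j+1), f i x) ^ (q - 1)) ^ (p1 / (p1 - 1)) = (∑ i ∈ Finset.range (j+1), f i x) ^ P := by
      intro x
      rw [← ENNReal.rpow_mul, hP, mul_div_assoc]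
    simp only [e1]
    have e2 : 1 / (p1 / (p1 - 1)) = (1 / P) * (q - 1) := by
      have h1 : q - 1 ≠ 0 := by linarith
      have h2 : p1 - 1 ≠ 0 := by linarith
      rw [hP]; field_simp
    rw [e2, ENNReal.rpow_mul]
    have h3 : (∫⁻ x, (∑ i ∈ Finset.range (j+1), f i x) ^ P ∂μ) ^ (1 / P) ≤ ENNReal.ofReal (K ^ (1 / P) * (D ^ ((j:ℝ) * η) * Bseq lam a j)) := by
      refine (Lp_sum μ hP1 f hf (j+1)).trans ((Finset.sum_le_sum fun i _ => hpow P hP0 i (H2 i)).trans (le_of_eq ?_))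
      rw [← ENNReal.ofReal_sum_of_nonneg (fun i _ => by have := ha i; positivity), Bseq, Finset.mul_sum, Finset.mul_sum]
      congr 1
      apply Finset.sum_congr rfl
      intro i hi
      have hij : i ≤ j := by simpa [Nat.lt_succ_iff] using hi
      congr 1
      rw [mul_left_comm]; congr 1
      rw [hlam, ← Real.rpow_natCast, ← Real.rpow_mul (by linarith), ← Real.rpow_add (by linarith), Nat.cast_sub hij]
      congr 1; ring
    refine (mul_le_mul' (hpow p1 hp0 j (H1 j)) (ENNReal.rpow_le_rpow h3 (by linarith))).trans ?_
    rw [ENNReal.ofReal_rpow_of_nonneg (by positivity) (by linarith), ← ENNReal.ofReal_mul (by positivity)]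
    apply ENNReal.ofReal_le_ofReal
    have hDj : 0 < D ^ ((j:ℝ) * η) := by positivity
    rw [Real.mul_rpow (by positivity) (by positivity), Real.mul_rpow (by positivity) hB, ← Real.rpow_mul (by linarith : (0:ℝ) ≤ D)]
    have e3 : D ^ ((j:ℝ) * (1 / p1 - 1 / q)) * D ^ ((j:ℝ) * η * (q - 1)) = 1 := by
      rw [← Real.rpow_add (by linarith), mul_assoc, hηq, ← mul_add]; simp
    have e4 : a j ≤ Bseq lam a j := by
      rw [Bseq, Finset.sum_range_succ]; simp only [Nat.sub_self, pow_zero, mul_one]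
      have : 0 ≤ ∑ i ∈ Finset.range j, a i * lam ^ (j - i) := Finset.sum_nonneg fun i _ => mul_nonneg (ha i) (by positivity)
      linarith
    have e5 : a j * Bseq lam a j ^ (q - 1) ≤ Bseq lam a j ^ q := by
      rcases hB.eq_or_lt with h | h
      · have : a j = 0 := by linarith
        rw [this, zero_mul]; positivity
      · rw [Real.rpow_sub h, Real.rpow_one, mul_div_assoc', div_le_iff₀ h, mul_comm]
        exact mul_le_mul_of_nonneg_left e4 (by positivity)
    calc _ = (K ^ (1 / p1) * (K ^ (1 / P)) ^ (q - 1)) * (a j * Bseq lam a j ^ (q - 1)) * (D ^ ((j:ℝ) * (1 / p1 - 1 / q)) * D ^ ((j:ℝ) * η * (q - 1))) := by ring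
      _ ≤ _ := by
        rw [e3, mul_one]
        exact mul_le_mul_of_nonneg_left e5 (by positivity)
  have hB := fun j => Bseq_nonneg hl0 ha j
  calc _ ≤ ∫⁻ x, ENNReal.ofReal q * ∑ j ∈ Finset.range n, f j x * (∑ i ∈ Finset.range (j+1), f i x) ^ (q - 1) ∂μ := lintegral_mono fun x => sum_pow_le hq _ n
    _ = ENNReal.ofReal q * ∑ j ∈ Finset.range n, ∫⁻ x, f j x * (∑ i ∈ Finset.range (j+1), f i x) ^ (q - 1) ∂μ := by
      rw [lintegral_const_mul' _ _ (by simp), lintegral_finsetSum]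
      intro j _
      exact (hf j).mul ((Finset.measurable_fun_sum _ fun i _ => hf i).pow_const _)
    _ ≤ ENNReal.ofReal q * ∑ j ∈ Finset.range n, ENNReal.ofReal ((K ^ (1 / p1) * (K ^ (1 / P)) ^ (q - 1)) * Bseq lam a j ^ q) :=
      mul_le_mul' le_rfl (Finset.sum_le_sum fun j _ => G j)
    _ ≤ _ := by
      rw [← ENNReal.ofReal_sum_of_nonneg (fun i _ => by have := hB i; positivity), ← ENNReal.ofReal_mul (by linarith), ← Finset.mul_sum]
      apply ENNReal.ofReal_le_ofReal
      have := Bseq_sum hq hl0 hl1 ha n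
      rw [mul_assoc, mul_assoc]
      have := mul_le_mul_of_nonneg_left this (show 0 ≤ q * (K ^ (1 / p1) * (K ^ (1 / P)) ^ (q - 1)) by positivity)
      linarith

theorem sc {R : ℝ} (hR : 0 < R) (h : ℝ → ℝ≥0∞) : ∫⁻ x, h (R * x) = ENNReal.ofReal R⁻¹ * ∫⁻ x, h x := by
  have := lintegral_comp_smul' (volume : Measure ℝ) h hR.ne'
  simpa [abs_of_pos hR] using this

theorem sc2 {R : ℝ} (hR : 0 < R) (h : ℝ → ℝ≥0∞) : ∫⁻ x, h x = ENNReal.ofReal R * ∫⁻ x, h (R * x) := by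
  rw [sc hR, ← mul_assoc, ← ENNReal.ofReal_mul hR.le, mul_inv_cancel₀ hR.ne', ENNReal.ofReal_one, one_mul]

theorem W1s {σ p α : ℝ} (hσ : 0 < σ) (hp : 0 < p) (hα : 0 ≤ α) (hα1 : α * p < 1) (hα2 : 1 / p - 1 / σ < α)
    {K : ℝ≥0∞} (hK : K ≠ ∞) :
    ∃ C : ℝ≥0∞, C ≠ ∞ ∧ ∀ (f : ℝ → ℝ) (M R : ℝ), Measurable f → 0 ≤ M → 0 < R → (∀ x, 0 ≤ f x) → (∀ x, f x ≤ M) →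
      ∫⁻ x, ENNReal.ofReal (f x ^ σ) ≤ K * ENNReal.ofReal (M ^ σ * R) →
      ∫⁻ x, ENNReal.ofReal (|x| ^ (-(α * p)) * f x ^ p) ≤ C * ENNReal.ofReal (M ^ p * R ^ (1 - α * p)) := by
  obtain ⟨C, hC, H⟩ := W1 hσ hp hα hα1 hα2 hK
  refine ⟨C, hC, ?_⟩
  intro f M R hf hM hR h0 h1 hI
  rcases hM.eq_or_lt with hM0 | hM0
  · have : ∀ x, f x = 0 := fun x => le_antisymm (by rw [hM0]; exact h1 x) (h0 x)
    simp [this, hp.ne']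
  have hg := H (fun x => f (R * x) / M) (by fun_prop) (fun x => div_nonneg (h0 _) hM) (fun x => (div_le_one hM0).2 (h1 _)) (by
    have e : ∀ x, ENNReal.ofReal ((f (R * x) / M) ^ σ) = ENNReal.ofReal (M ^ σ)⁻¹ * ENNReal.ofReal (f (R * x) ^ σ) := by
      intro x
      rw [Real.div_rpow (h0 _) hM, ← ENNReal.ofReal_mul (by positivity)]; congr 1; ring
    simp only [e]
    rw [lintegral_const_mul' _ _ (by simp), sc hR (fun x => ENNReal.ofReal (f x ^ σ))]
    calc _ ≤ ENNReal.ofReal (M ^ σ)⁻¹ * (ENNReal.ofReal R⁻¹ * (K * ENNReal.ofReal (M ^ σ * R))) := by gcongr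
      _ = K * ENNReal.ofReal ((M ^ σ)⁻¹ * R⁻¹ * (M ^ σ * R)) := by
        rw [ENNReal.ofReal_mul (p := (M ^ σ)⁻¹ * R⁻¹) (by positivity), ENNReal.ofReal_mul (p := (M ^ σ)⁻¹) (by positivity)]; ring
      _ = K := by
        rw [show (M ^ σ)⁻¹ * R⁻¹ * (M ^ σ * R) = 1 by
          have := (Real.rpow_pos_of_pos hM0 σ).ne'
          field_simp]
        simp)
  rw [sc2 hR]
  have e : ∀ x, ENNReal.ofReal (|R * x| ^ (-(α * p)) * f (R * x) ^ p) = ENNReal.ofReal (R ^ (-(α * p)) * M ^ p) * ENNReal.ofReal (|x| ^ (-(α * p)) * (f (R * x) / M) ^ p) := by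
    intro x
    rw [← ENNReal.ofReal_mul (by positivity), abs_mul, abs_of_pos hR, Real.mul_rpow hR.le (abs_nonneg _), Real.div_rpow (h0 _) hM]
    congr 1
    have := (Real.rpow_pos_of_pos hM0 p).ne'
    field_simp
  simp only [e]
  rw [lintegral_const_mul' _ _ (by simp), ← mul_assoc, ← ENNReal.ofReal_mul hR.le, mul_comm]
  refine mul_le_mul' hg (le_of_eq ?_)
  congr 1
  rw [sub_eq_add_neg, Real.rpow_add hR, Real.rpow_one]; ring

theorem W2s {σ p ρ α β : ℝ} (hσ : 0 < σ) (hp : 0 < p) (hα : 0 ≤ α) (hβ : 0 ≤ β) (hα1 : α * p < 1) (hβ1 : β * p < 1)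
    (hα2 : 1 / p - 1 / σ < α) (hβ2 : 1 / p - 1 / σ < β)
    (hg : Good σ ρ p α β) {K : ℝ≥0∞} (hK : K ≠ ∞) :
    ∃ C : ℝ≥0∞, C ≠ ∞ ∧ ∀ (f : ℝ → ℝ → ℝ) (M R1 R2 : ℝ), Measurable (Function.uncurry f) → 0 ≤ M → 0 < R1 → 0 < R2 →
      (∀ x y, 0 ≤ f x y) → (∀ x y, f x y ≤ M) →
      (∀ y, ∫⁻ x, ENNReal.ofReal (f x y ^ σ) ≤ K * ENNReal.ofReal (M ^ σ * R1)) →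
      (∀ x, ∫⁻ y, ENNReal.ofReal (f x y ^ σ) ≤ K * ENNReal.ofReal (M ^ σ * R2)) →
      (∫⁻ y, ∫⁻ x, ENNReal.ofReal (f x y ^ ρ) ≤ K * ENNReal.ofReal (M ^ ρ * (R1 * R2))) →
      ∫⁻ y, ∫⁻ x, ENNReal.ofReal (|x| ^ (-(α * p)) * |y| ^ (-(β * p)) * f x y ^ p) ≤
        C * ENNReal.ofReal (M ^ p * R1 ^ (1 - α * p) * R2 ^ (1 - β * p)) := by
  obtain ⟨C, hC, H⟩ := W2 hσ hp hα hβ hα1 hβ1 hα2 hβ2 hg hK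
  refine ⟨C, hC, ?_⟩
  intro f M R1 R2 hf hM hR1 hR2 h0 h1 hx hy hρ
  rcases hM.eq_or_lt with hM0 | hM0
  · have : ∀ x y, f x y = 0 := fun x y => le_antisymm (by rw [hM0]; exact h1 x y) (h0 x y)
    simp [this, hp.ne']
  have ee : ∀ (τ : ℝ) x y, ENNReal.ofReal ((f x y / M) ^ τ) = ENNReal.ofReal (M ^ τ)⁻¹ * ENNReal.ofReal (f x y ^ τ) := by
    intro τ x y
    rw [Real.div_rpow (h0 _ _) hM, ← ENNReal.ofReal_mul (by positivity)]; congr 1; ring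
  have fin : ∀ (τ R : ℝ), 0 < R → ENNReal.ofReal (M ^ τ)⁻¹ * (ENNReal.ofReal R⁻¹ * (K * ENNReal.ofReal (M ^ τ * R))) = K := by
    intro τ R hR
    calc _ = K * ENNReal.ofReal ((M ^ τ)⁻¹ * R⁻¹ * (M ^ τ * R)) := by
          rw [ENNReal.ofReal_mul (p := (M ^ τ)⁻¹ * R⁻¹) (by positivity), ENNReal.ofReal_mul (p := (M ^ τ)⁻¹) (by positivity)]; ring
      _ = K := by
        rw [show (M ^ τ)⁻¹ * R⁻¹ * (M ^ τ * R) = 1 by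
          have := (Real.rpow_pos_of_pos hM0 τ).ne'
          field_simp]
        simp
  have hgg := H (fun x y => f (R1 * x) (R2 * y) / M) (by
      have : Measurable (fun q : ℝ × ℝ => f (R1 * q.1) (R2 * q.2)) := hf.comp (by fun_prop : Measurable fun q : ℝ × ℝ => (R1 * q.1, R2 * q.2))
      exact this.div_const M) (fun x y => div_nonneg (h0 _ _) hM) (fun x y => (div_le_one hM0).2 (h1 _ _))
    (by
      intro y
      simp only [ee]
      rw [lintegral_const_mul' _ _ (by simp), sc hR1 (fun x => ENNReal.ofReal (f x (R2 * y) ^ σ)), ← fin σ R1 hR1]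
      exact mul_le_mul' le_rfl (mul_le_mul' le_rfl (hx _)))
    (by
      intro x
      simp only [ee]
      rw [lintegral_const_mul' _ _ (by simp), sc hR2 (fun y => ENNReal.ofReal (f (R1 * x) y ^ σ)), ← fin σ R2 hR2]
      exact mul_le_mul' le_rfl (mul_le_mul' le_rfl (hy _)))
    (by
      simp only [ee]
      have e1 : ∀ y, ∫⁻ x, ENNReal.ofReal (M ^ ρ)⁻¹ * ENNReal.ofReal (f (R1 * x) (R2 * y) ^ ρ) = ENNReal.ofReal (M ^ ρ)⁻¹ * (ENNReal.ofReal R1⁻¹ * ∫⁻ x, ENNReal.ofReal (f x (R2 * y) ^ ρ)) := by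
        intro y
        rw [lintegral_const_mul' _ _ (by simp), sc hR1 (fun x => ENNReal.ofReal (f x (R2 * y) ^ ρ))]
      simp only [e1]
      rw [lintegral_const_mul' _ _ (by simp), lintegral_const_mul' _ _ (by simp), sc hR2 (fun y => ∫⁻ x, ENNReal.ofReal (f x y ^ ρ)),
        ← mul_assoc (ENNReal.ofReal R1⁻¹), ← ENNReal.ofReal_mul (by positivity), ← mul_inv]
      calc _ ≤ ENNReal.ofReal (M ^ ρ)⁻¹ * (ENNReal.ofReal (R1 * R2)⁻¹ * (K * ENNReal.ofReal (M ^ ρ * (R1 * R2)))) := by gcongr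
        _ = K := fin ρ (R1 * R2) (by positivity))
  rw [sc2 hR2]
  have e : ∀ y, ∫⁻ x, ENNReal.ofReal (|x| ^ (-(α * p)) * |R2 * y| ^ (-(β * p)) * f x (R2 * y) ^ p) =
      ENNReal.ofReal (R1 * (R1 ^ (-(α * p)) * R2 ^ (-(β * p)) * M ^ p)) * ∫⁻ x, ENNReal.ofReal (|x| ^ (-(α * p)) * |y| ^ (-(β * p)) * (f (R1 * x) (R2 * y) / M) ^ p) := by
    intro y
    rw [sc2 hR1, ENNReal.ofReal_mul hR1.le, mul_assoc]
    congr 1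
    rw [← lintegral_const_mul' _ _ (by simp)]
    apply lintegral_congr; intro x
    rw [← ENNReal.ofReal_mul (by positivity), abs_mul, abs_of_pos hR1, Real.mul_rpow hR1.le (abs_nonneg _), abs_mul, abs_of_pos hR2, Real.mul_rpow hR2.le (abs_nonneg _), Real.div_rpow (h0 _ _) hM]
    congr 1
    have := (Real.rpow_pos_of_pos hM0 p).ne'
    field_simp
  simp only [e]
  rw [lintegral_const_mul' _ _ (by simp), ← mul_assoc, ← ENNReal.ofReal_mul hR2.le, mul_comm]
  refine mul_le_mul' hgg (le_of_eq ?_)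
  congr 1
  rw [sub_eq_add_neg, Real.rpow_add hR1, Real.rpow_one, sub_eq_add_neg, Real.rpow_add hR2, Real.rpow_one]; ring

theorem TT_meas {F : ℝ → ℂ} (hF : Measurable F) : Measurable (fun q : ℝ × ℝ => TT F q.1 q.2) := by
  unfold TT
  have : StronglyMeasurable (Function.uncurry fun (q : ℝ × ℝ) (φ : ℝ) => F φ * Complex.exp (Complex.I * Complex.ofReal (q.1 * Real.cos φ + q.2 * Real.sin φ))) := by
    apply Measurable.stronglyMeasurable
    apply Measurable.mul
    · exact hF.comp measurable_snd
    · apply Continuous.measurable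
      fun_prop
  exact (this.integral_prod_right (ν := volume)).measurable

structure Piece (r δ a : ℝ) (G : ℝ → ℂ) : Prop where
  d0 : 0 < δ
  d1 : δ ≤ 1
  a0 : 0 ≤ a
  m : Measurable G
  i : Integrable G volume
  s : ∀ φ, φ ∉ Ioc (δ / 2) δ → G φ = 0
  n : ∫⁻ φ, ‖G φ‖ₑ ^ r ≤ ENNReal.ofReal (a ^ r)

theorem Piece.hold {r δ a s : ℝ} {G : ℝ → ℂ} (h : Piece r δ a G) (hs : 1 ≤ s) (hsr : s ≤ r) :
    ∫⁻ φ, ‖G φ‖ₑ ^ s ≤ ENNReal.ofReal (a ^ s * δ ^ (1 - s / r)) := by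
  have hd := h.d0
  have ha := h.a0
  have hs0 : 0 < s := by linarith
  have hr0 : 0 < r := by linarith
  have key := eLpNorm'_le_eLpNorm'_mul_rpow_measure_univ (μ := volume.restrict (Ioc (δ / 2) δ)) (f := G) hs0 hsr h.m.aestronglyMeasurable
  rw [eLpNorm'_eq_lintegral_enorm, eLpNorm'_eq_lintegral_enorm] at key
  have e : ∀ p : ℝ, 0 < p → ∫⁻ φ in Ioc (δ / 2) δ, ‖G φ‖ₑ ^ p = ∫⁻ φ, ‖G φ‖ₑ ^ p := by
    intro p hp
    rw [← lintegral_indicator measurableSet_Ioc]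
    apply lintegral_congr; intro φ
    by_cases hφ : φ ∈ Ioc (δ / 2) δ
    · rw [indicator_of_mem hφ]
    · rw [indicator_of_notMem hφ, h.s φ hφ]; simp [hp]
  rw [e s hs0, e r hr0] at key
  have k2 := ENNReal.rpow_le_rpow key hs0.le
  rw [← ENNReal.rpow_mul, one_div_mul_cancel hs0.ne', ENNReal.rpow_one] at k2
  refine k2.trans ?_
  have v : (volume.restrict (Ioc (δ / 2) δ)) univ ≤ ENNReal.ofReal δ := by
    rw [Measure.restrict_apply_univ, Real.volume_Ioc]
    exact ENNReal.ofReal_le_ofReal (by linarith)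
  have hexp : 0 ≤ 1 / s - 1 / r := by rw [sub_nonneg]; exact one_div_le_one_div_of_le hs0 hsr
  have k3 : (∫⁻ φ, ‖G φ‖ₑ ^ r) ^ (1 / r) ≤ ENNReal.ofReal a := by
    refine (ENNReal.rpow_le_rpow h.n (by positivity)).trans (le_of_eq ?_)
    rw [ENNReal.ofReal_rpow_of_nonneg (by positivity) (by positivity), ← Real.rpow_mul ha, mul_one_div_cancel hr0.ne', Real.rpow_one]
  refine (ENNReal.rpow_le_rpow (mul_le_mul' k3 (ENNReal.rpow_le_rpow v hexp)) hs0.le).trans (le_of_eq ?_)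
  rw [ENNReal.ofReal_rpow_of_nonneg hd.le hexp, ← ENNReal.ofReal_mul ha, ENNReal.ofReal_rpow_of_nonneg (by positivity) hs0.le,
    Real.mul_rpow ha (by positivity), ← Real.rpow_mul hd.le]
  congr 3
  field_simp

theorem Piece.bd {r δ a : ℝ} {G : ℝ → ℂ} (h : Piece r δ a G) (hr : 1 < r) (x y : ℝ) :
    ‖TT G x y‖ ≤ a * δ ^ (1 - 1 / r) := by
  have hd := h.d0
  have ha := h.a0
  have := h.hold le_rfl hr.le
  simp only [ENNReal.rpow_one, Real.rpow_one] at this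
  rw [TT]
  refine (norm_integral_le_integral_norm _).trans ?_
  simp only [norm_mul, norm_e, mul_one]
  rw [integral_norm_eq_lintegral_enorm h.m.aestronglyMeasurable]
  exact ENNReal.toReal_le_of_le_ofReal (by positivity) this

theorem Piece.hy {s : ℝ} (hs1 : 1 < s) (hs2 : s ≤ 2) :
    ∃ C : ℝ, 0 < C ∧ ∀ (r δ a c : ℝ) (G : ℝ → ℂ) (Φ Φ' ψ : ℝ → ℝ), Piece r δ a G → s ≤ r → Continuous ψ →
      (∀ x ∈ Ioc (δ / 2) δ, HasDerivAt Φ (Φ' x) x) → InjOn Φ (Ioc (δ / 2) δ) → 0 < c → (∀ x ∈ Ioc (δ / 2) δ, c ≤ |Φ' x|) →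
      ∫⁻ ξ : ℝ, ENNReal.ofReal (‖∫ φ, G φ * Complex.exp (Complex.I * Complex.ofReal (ξ * Φ φ + ψ φ))‖ ^ (s / (s - 1))) ≤
        ENNReal.ofReal C * ENNReal.ofReal ((a * δ ^ (1 - 1 / r)) ^ (s / (s - 1)) * (c⁻¹ * δ⁻¹)) := by
  obtain ⟨C, hC, H⟩ := HY1 hs1 hs2
  refine ⟨C, hC, ?_⟩
  intro r δ a c G Φ Φ' ψ h hsr hψ hΦ hinj hc hcb
  have hd := h.d0
  have ha := h.a0
  have hs0 : 0 < s - 1 := by linarith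
  have hr0 : 0 < r := by linarith
  have hI : Integrable (fun φ => G φ * Complex.exp (Complex.I * Complex.ofReal (ψ φ))) volume := by
    apply h.i.mul_bdd (c := 1)
    · apply Continuous.aestronglyMeasurable; fun_prop
    · filter_upwards with φ; rw [norm_e]
  have key := H (Ioc (δ / 2) δ) Φ Φ' (fun φ => G φ * Complex.exp (Complex.I * Complex.ofReal (ψ φ))) c measurableSet_Ioc hΦ hinj hc hcb hI.integrableOn
  have e : ∀ ξ : ℝ, ∫ φ in Ioc (δ / 2) δ, (G φ * Complex.exp (Complex.I * Complex.ofReal (ψ φ))) * Complex.exp (Complex.I * Complex.ofReal (ξ * Φ φ)) =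
      ∫ φ, G φ * Complex.exp (Complex.I * Complex.ofReal (ξ * Φ φ + ψ φ)) := by
    intro ξ
    rw [← integral_indicator measurableSet_Ioc]
    congr 1; ext φ
    by_cases hφ : φ ∈ Ioc (δ / 2) δ
    · rw [indicator_of_mem hφ, mul_assoc, ← Complex.exp_add]
      congr 2; push_cast; ring
    · rw [indicator_of_notMem hφ, h.s φ hφ]; simp
  simp only [e] at key
  have hexp : 0 ≤ s / (s - 1) := by positivity
  simp only [enorm_rpow_eq _ hexp] at key
  refine key.trans ?_
  have k2 : ∫⁻ x in Ioc (δ / 2) δ, ‖G x * Complex.exp (Complex.I * Complex.ofReal (ψ x))‖ₑ ^ s ≤ ENNReal.ofReal (a ^ s * δ ^ (1 - s / r)) := by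
    refine le_trans ?_ (h.hold hs1.le hsr)
    refine (setLIntegral_le_lintegral _ _).trans (le_of_eq ?_)
    apply lintegral_congr; intro φ
    rw [enorm_mul, ← ofReal_norm (Complex.exp _), norm_e]; simp
  refine (mul_le_mul' le_rfl (ENNReal.rpow_le_rpow k2 (by positivity))).trans (le_of_eq ?_)
  rw [ENNReal.ofReal_rpow_of_nonneg (by positivity) (by positivity), ← ENNReal.ofReal_mul (by positivity), ← ENNReal.ofReal_mul (by positivity)]
  congr 1
  rw [Real.mul_rpow (by positivity) (by positivity), ← Real.rpow_mul ha, ← Real.rpow_mul hd.le, Real.mul_rpow ha (by positivity), ← Real.rpow_mul hd.le,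
    ← Real.rpow_neg_one δ]
  have e2 : δ ^ ((1 - s / r) * (1 / (s - 1))) = δ ^ ((1 - 1 / r) * (s / (s - 1))) * δ ^ (-1 : ℝ) := by
    rw [← Real.rpow_add hd]; congr 1; field_simp; ring
  rw [e2, mul_one_div]; ring

theorem Piece.px {r s : ℝ} (hs1 : 1 < s) (hs2 : s ≤ 2) (hsr : s ≤ r) :
    ∃ K : ℝ≥0∞, K ≠ ∞ ∧ ∀ (δ a : ℝ) (G : ℝ → ℂ), Piece r δ a G → ∀ y,
      ∫⁻ x, ENNReal.ofReal (‖TT G x y‖ ^ (s / (s - 1))) ≤ K * ENNReal.ofReal ((a * δ ^ (1 - 1 / r)) ^ (s / (s - 1)) * δ ^ (-2 : ℝ)) := by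
  obtain ⟨C, hC, H⟩ := Piece.hy hs1 hs2
  refine ⟨ENNReal.ofReal C * ENNReal.ofReal 4, by finiteness, ?_⟩
  intro δ a G h y
  have hd := h.d0
  have ha := h.a0
  have hd1 := h.d1
  have := H r δ a (δ / 4) G Real.cos (fun x => - Real.sin x) (fun φ => y * Real.sin φ) h hsr (by fun_prop) (fun x _ => Real.hasDerivAt_cos x) (by
      apply Real.injOn_cos.mono
      intro φ hφ
      exact ⟨by linarith [hφ.1], by linarith [hφ.2, Real.pi_gt_three]⟩) (by positivity) (by
      intro φ hφ
      have h1 : 0 < φ := by linarith [hφ.1]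
      have h2 : φ ≤ 1 := by linarith [hφ.2]
      have := Real.sin_gt_sub_cube h1
      rw [abs_neg]
      refine le_trans ?_ (le_abs_self _)
      have h3 : φ ^ 3 ≤ φ := by nlinarith [mul_nonneg h1.le (sub_nonneg.2 h2)]
      linarith [hφ.1])
  refine this.trans (le_of_eq ?_)
  rw [mul_assoc, ← ENNReal.ofReal_mul (p := 4) (by norm_num)]
  congr 2
  rw [show (-2:ℝ) = -1 + -1 by norm_num, Real.rpow_add hd, Real.rpow_neg_one]
  field_simp

theorem Piece.py {r s : ℝ} (hs1 : 1 < s) (hs2 : s ≤ 2) (hsr : s ≤ r) :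
    ∃ K : ℝ≥0∞, K ≠ ∞ ∧ ∀ (δ a : ℝ) (G : ℝ → ℂ), Piece r δ a G → ∀ x,
      ∫⁻ y, ENNReal.ofReal (‖TT G x y‖ ^ (s / (s - 1))) ≤ K * ENNReal.ofReal ((a * δ ^ (1 - 1 / r)) ^ (s / (s - 1)) * δ ^ (-1 : ℝ)) := by
  obtain ⟨C, hC, H⟩ := Piece.hy hs1 hs2
  refine ⟨ENNReal.ofReal C * ENNReal.ofReal 2, by finiteness, ?_⟩
  intro δ a G h x
  have hd := h.d0
  have ha := h.a0
  have hd1 := h.d1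
  have := H r δ a (1 / 2) G Real.sin Real.cos (fun φ => x * Real.cos φ) h hsr (by fun_prop) (fun x _ => Real.hasDerivAt_sin x) (by
      apply Real.injOn_sin.mono
      intro φ hφ
      exact ⟨by linarith [hφ.1, Real.pi_gt_three], by linarith [hφ.2, Real.pi_gt_three]⟩) (by positivity) (by
      intro φ hφ
      have h1 : 0 < φ := by linarith [hφ.1]
      have h2 : φ ≤ 1 := by linarith [hφ.2]
      have := Real.one_sub_sq_div_two_le_cos (x := φ)
      refine le_trans ?_ (le_abs_self _)
      nlinarith)
  simp only [TT, add_comm (x * _)]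
  refine this.trans (le_of_eq ?_)
  rw [mul_assoc, ← ENNReal.ofReal_mul (p := 2) (by norm_num)]
  congr 2
  rw [Real.rpow_neg_one]
  ring

theorem Piece.pz {r : ℝ} (hr1 : 1 < r) (hr4 : r < 4) :
    ∃ K : ℝ≥0∞, K ≠ ∞ ∧ ∀ (δ a : ℝ) (G : ℝ → ℂ), Piece r δ a G →
      ∫⁻ y, ∫⁻ x, ENNReal.ofReal (‖TT G x y‖ ^ (3 * r / (r - 1))) ≤ K * ENNReal.ofReal ((a * δ ^ (1 - 1 / r)) ^ (3 * r / (r - 1)) * (δ ^ (-2 : ℝ) * δ ^ (-1 : ℝ))) := by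
  obtain ⟨C, hC, H⟩ := Zyg hr1 hr4
  refine ⟨ENNReal.ofReal C, by finiteness, ?_⟩
  intro δ a G h
  have hd := h.d0
  have ha := h.a0
  have hd1 := h.d1
  have hr0 : 0 < r - 1 := by linarith
  have key := H G h.m h.i (fun φ hφ => h.s φ fun hc => hφ ⟨by linarith [hc.1], by linarith [hc.2]⟩)
  have hexp : 0 ≤ 3 * r / (r - 1) := by positivity
  simp only [enorm_rpow_eq _ hexp] at key
  have hm := TT_meas h.m
  rw [Measure.volume_eq_prod, lintegral_prod_symm _ (by fun_prop)] at key
  refine key.trans ?_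
  refine (mul_le_mul' le_rfl (ENNReal.rpow_le_rpow h.n (by positivity))).trans (le_of_eq ?_)
  congr 1
  rw [ENNReal.ofReal_rpow_of_nonneg (by positivity) (by positivity), ← Real.rpow_mul ha, Real.mul_rpow ha (by positivity), ← Real.rpow_mul hd.le,
    mul_assoc, ← Real.rpow_add hd, ← Real.rpow_add hd]
  congr 1
  rw [show (1 - 1 / r) * (3 * r / (r - 1)) + (-2 + -1) = 0 by field_simp; ring, Real.rpow_zero, mul_one]
  congr 1; ring

def wt (a b : ℝ) (z : ℝ × ℝ) : ℝ := (1 + |z.1|) ^ (-a) * (1 + |z.2|) ^ (-b)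

theorem wt_pos (a b : ℝ) (z : ℝ × ℝ) : 0 < wt a b z := by unfold wt; positivity

theorem wt_meas (a b : ℝ) : Measurable (wt a b) := by unfold wt; fun_prop

def WF (a b : ℝ) (G : ℝ → ℂ) (z : ℝ × ℝ) : ℝ≥0∞ := ‖TT G z.1 z.2‖ₑ * ENNReal.ofReal (wt a b z)

theorem WF_meas {a b : ℝ} {G : ℝ → ℂ} (hG : Measurable G) : Measurable (WF a b G) := by
  have := TT_meas hG
  have := wt_meas a b
  unfold WF
  fun_prop

def Est (a b r q N p : ℝ) : Prop := ∃ K : ℝ, 0 < K ∧ ∀ (δ A : ℝ) (G : ℝ → ℂ), Piece r δ A G →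
  ∫⁻ z, WF a b G z ^ p ≤ ENNReal.ofReal (K * A ^ p * δ ^ (N * (p / q - 1)))

def dy (j : ℕ) : Set ℝ := Ioc ((1/2:ℝ) ^ j / 2) ((1/2:ℝ) ^ j)

theorem dy_sum {E : Type*} [AddCommMonoid E] (H : ℝ → E) (n : ℕ) (φ : ℝ) :
    ∑ j ∈ Finset.range n, (dy j).indicator H φ = (Ioc ((1/2:ℝ) ^ n) 1).indicator H φ := by
  induction n with
  | zero => simp
  | succ n ih =>
    rw [Finset.sum_range_succ, ih]
    have hu : Ioc ((1/2:ℝ) ^ (n+1)) 1 = Ioc ((1/2:ℝ) ^ n) 1 ∪ dy n := by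
      rw [dy, union_comm, Ioc_union_Ioc_eq_Ioc]
      · rw [pow_succ]; congr 1; ring
      · have : (0:ℝ) < (1/2:ℝ) ^ n := by positivity
        linarith
      · exact pow_le_one₀ (by norm_num) (by norm_num)
    have hd : Disjoint (Ioc ((1/2:ℝ) ^ n) 1) (dy n) := by
      rw [Set.disjoint_left]; intro x hx hx2
      exact absurd hx2.2 (not_le.2 hx.1)
    rw [hu, indicator_union_of_disjoint hd]

theorem sum_rp {κ : ℝ} (hκ : 1 ≤ κ) (t : ℕ → ℝ≥0∞) (n : ℕ) :
    ∑ j ∈ Finset.range n, t j ^ κ ≤ (∑ j ∈ Finset.range n, t j) ^ κ := by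
  induction n with
  | zero => simp
  | succ n ih =>
    rw [Finset.sum_range_succ, Finset.sum_range_succ]
    exact (add_le_add ih le_rfl).trans (ENNReal.add_rpow_le_rpow_add _ _ hκ)

theorem TT_sum {n : ℕ} {G : ℕ → ℝ → ℂ} (hG : ∀ j, Integrable (G j) volume) (x y : ℝ) :
    TT (fun φ => ∑ j ∈ Finset.range n, G j φ) x y = ∑ j ∈ Finset.range n, TT (G j) x y := by
  unfold TT
  rw [← integral_finsetSum _ fun j _ => int_e (hG j) x y]
  simp only [Finset.sum_mul]

theorem core_of_est {a b r q N : ℝ} (hr : 1 < r) (hrq : r ≤ q) (hN : 0 < N) (hE : ∀ᶠ p in nhds q, Est a b r q N p) :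
    ∃ C : ℝ, 0 < C ∧ ∀ F : ℝ → ℂ, Measurable F → Integrable F volume → (∀ φ, φ ∉ Ioc (0:ℝ) 1 → F φ = 0) →
      ∫⁻ z, WF a b F z ^ q ≤ ENNReal.ofReal C * (∫⁻ φ, ‖F φ‖ₑ ^ r) ^ (q / r) := by
  have hq : 1 < q := by linarith
  have hr0 : 0 < r := by linarith
  have hT : Tendsto (fun p1 : ℝ => (q - 1) * p1 / (p1 - 1)) (nhds q) (nhds q) := by
    have h : ContinuousAt (fun p1 : ℝ => (q - 1) * p1 / (p1 - 1)) q :=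
      ContinuousAt.div (by fun_prop) (by fun_prop) (by linarith)
    have h2 : (q - 1) * q / (q - 1) = q := by
      have : q - 1 ≠ 0 := by linarith
      field_simp
    unfold ContinuousAt at h
    simp only [h2] at h
    exact h
  have ev := (hE.and ((hT.eventually hE).and (hT.eventually (lt_mem_nhds hq)))).filter_mono (nhdsWithin_le_nhds (s := Ioi q))
  obtain ⟨p1, ⟨⟨K1, hK1, E1⟩, ⟨K2, hK2, E2⟩, hP1⟩, hp1⟩ := (ev.and self_mem_nhdsWithin).exists
  set P := (q - 1) * p1 / (p1 - 1) with hP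
  obtain ⟨C, hC, H⟩ := Summ (volume : Measure (ℝ × ℝ)) (D := (2:ℝ) ^ N) (K := max K1 K2) hq (Real.one_lt_rpow (by norm_num) hN) hp1 hP hP1.le (by positivity)
  refine ⟨C, hC, ?_⟩
  intro F hFm hFi hFs
  by_cases hfin : ∫⁻ φ, ‖F φ‖ₑ ^ r = ∞
  · rw [hfin, ENNReal.top_rpow_of_pos (by positivity), ENNReal.mul_top (by simpa using hC)]; exact le_top
  set Fj : ℕ → ℝ → ℂ := fun j => (dy j).indicator F with hFj
  have dym : ∀ j, MeasurableSet (dy j) := fun j => measurableSet_Ioc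
  have Fjm : ∀ j, Measurable (Fj j) := fun j => hFm.indicator (dym j)
  have Fji : ∀ j, Integrable (Fj j) volume := fun j => hFi.indicator (dym j)
  have Fjn : ∀ j φ, ‖Fj j φ‖ₑ ^ r = (dy j).indicator (fun φ => ‖F φ‖ₑ ^ r) φ := by
    intro j φ
    by_cases h : φ ∈ dy j
    · simp [hFj, h]
    · simp [hFj, h, hr0]
  have Fjle : ∀ j, ∫⁻ φ, ‖Fj j φ‖ₑ ^ r ≤ ∫⁻ φ, ‖F φ‖ₑ ^ r := by
    intro j
    apply lintegral_mono; intro φ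
    simp only [Fjn]
    exact indicator_le_self' (fun _ _ => bot_le) φ
  set A : ℕ → ℝ := fun j => (∫⁻ φ, ‖Fj j φ‖ₑ ^ r).toReal ^ (1 / r) with hA
  have hA0 : ∀ j, 0 ≤ A j := fun j => by positivity
  have hAr : ∀ j, ENNReal.ofReal (A j ^ r) = ∫⁻ φ, ‖Fj j φ‖ₑ ^ r := by
    intro j
    rw [hA]; simp only
    rw [← Real.rpow_mul (by positivity), one_div_mul_cancel hr0.ne', Real.rpow_one, ENNReal.ofReal_toReal (ne_top_of_le_ne_top hfin (Fjle j))]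
  have hpc : ∀ j, Piece r ((1/2:ℝ) ^ j) (A j) (Fj j) := by
    intro j
    refine ⟨by positivity, pow_le_one₀ (by norm_num) (by norm_num), hA0 j, Fjm j, Fji j, ?_, (hAr j).ge⟩
    intro φ hφ
    exact indicator_of_notMem hφ _
  have hD : ∀ (p : ℝ) (j : ℕ), ((1/2:ℝ) ^ j) ^ (N * (p / q - 1)) = ((2:ℝ) ^ N) ^ ((j:ℝ) * (1 - p / q)) := by
    intro p j
    rw [← Real.rpow_natCast, ← Real.rpow_mul (by norm_num), ← Real.rpow_mul (by norm_num), one_div, Real.inv_rpow (by norm_num), ← Real.rpow_neg (by norm_num)]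
    congr 1; ring
  have HH := H (fun j => WF a b (Fj j)) A (fun j => WF_meas (Fjm j)) hA0
    (fun j => (E1 _ _ _ (hpc j)).trans (ENNReal.ofReal_le_ofReal (by
      have := hA0 j
      rw [hD]; gcongr; exact le_max_left _ _)))
    (fun j => (E2 _ _ _ (hpc j)).trans (ENNReal.ofReal_le_ofReal (by
      have := hA0 j
      rw [hD]; gcongr; exact le_max_right _ _)))
  set Sn : ℕ → ℝ → ℂ := fun n => (Ioc ((1/2:ℝ) ^ n) 1).indicator F with hSn
  have bound : ∀ n, ∫⁻ z, WF a b (Sn n) z ^ q ≤ ENNReal.ofReal C * (∫⁻ φ, ‖F φ‖ₑ ^ r) ^ (q / r) := by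
    intro n
    have e1 : Sn n = fun φ => ∑ j ∈ Finset.range n, Fj j φ := by
      ext φ; rw [hSn, hFj]; exact (dy_sum F n φ).symm
    refine (lintegral_mono fun z => ?_).trans ((HH n).trans ?_)
    · apply ENNReal.rpow_le_rpow _ (by linarith)
      simp only [WF]
      rw [e1, TT_sum Fji, ← Finset.sum_mul]
      exact mul_le_mul' (enorm_sum_le _ _) le_rfl
    · rw [ENNReal.ofReal_mul hC.le]
      refine mul_le_mul' le_rfl ?_
      rw [ENNReal.ofReal_sum_of_nonneg (fun j _ => by have := hA0 j; positivity)]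
      have e2 : ∀ j, ENNReal.ofReal (A j ^ q) = (∫⁻ φ, ‖Fj j φ‖ₑ ^ r) ^ (q / r) := by
        intro j
        rw [← hAr, ENNReal.ofReal_rpow_of_nonneg (by have := hA0 j; positivity) (by positivity), ← Real.rpow_mul (hA0 j)]
        congr 2; field_simp
      simp only [e2]
      refine (sum_rp ((one_le_div hr0).2 hrq) _ n).trans (ENNReal.rpow_le_rpow ?_ (by positivity))
      rw [← lintegral_finsetSum]
      · apply lintegral_mono; intro φ
        simp only [Fjn]
        rw [dy_sum]
        exact indicator_le_self' (fun _ _ => bot_le) φ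
      · intro j _
        exact (Fjm j).enorm.pow_const _
  have lim : ∀ z : ℝ × ℝ, Tendsto (fun n => WF a b (Sn n) z ^ q) atTop (nhds (WF a b F z ^ q)) := by
    intro z
    have h1 : Tendsto (fun n => TT (Sn n) z.1 z.2) atTop (nhds (TT F z.1 z.2)) := by
      unfold TT
      apply tendsto_integral_of_dominated_convergence (fun φ => ‖F φ‖)
      · intro n
        exact (int_e (hFi.indicator measurableSet_Ioc) _ _).aestronglyMeasurable
      · exact hFi.norm
      · intro n
        filter_upwards with φ
        rw [norm_mul, norm_e, mul_one]
        exact norm_indicator_le_norm_self _ _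
      · filter_upwards with φ
        apply tendsto_const_nhds.congr'
        by_cases hφ : φ ∈ Ioc (0:ℝ) 1
        · have : ∀ᶠ n : ℕ in atTop, (1/2:ℝ) ^ n < φ := (tendsto_pow_atTop_nhds_zero_of_lt_one (by norm_num) (by norm_num)).eventually (gt_mem_nhds hφ.1)
          filter_upwards [this] with n hn
          rw [hSn]; simp only
          rw [indicator_of_mem (show φ ∈ Ioc ((1/2:ℝ) ^ n) 1 from ⟨hn, hφ.2⟩)]
        · filter_upwards with n
          rw [hSn]; simp only
          rw [hFs φ hφ, indicator_of_notMem]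
          intro hc
          exact hφ ⟨lt_trans (by positivity) hc.1, hc.2⟩
    have h2 : Tendsto (fun n => WF a b (Sn n) z) atTop (nhds (WF a b F z)) := by
      unfold WF
      exact ENNReal.Tendsto.mul_const ((continuous_enorm.tendsto _).comp h1) (Or.inr (by simp))
    exact (ENNReal.continuous_rpow_const.tendsto _).comp h2
  calc ∫⁻ z, WF a b F z ^ q = ∫⁻ z, liminf (fun n => WF a b (Sn n) z ^ q) atTop := by
        apply lintegral_congr; intro z; exact (lim z).liminf_eq.symm
    _ ≤ liminf (fun n => ∫⁻ z, WF a b (Sn n) z ^ q) atTop := lintegral_liminf_le fun n => (WF_meas (hFm.indicator measurableSet_Ioc)).pow_const _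
    _ ≤ _ := by
      refine (liminf_le_liminf (Eventually.of_forall bound)).trans (le_of_eq ?_)
      exact liminf_const _

theorem WF_pow {a b p : ℝ} (hp : 0 ≤ p) (G : ℝ → ℂ) (z : ℝ × ℝ) :
    WF a b G z ^ p = ENNReal.ofReal ((1 + |z.1|) ^ (-(a * p)) * (1 + |z.2|) ^ (-(b * p)) * ‖TT G z.1 z.2‖ ^ p) := by
  have h := wt_pos a b z
  rw [WF, ENNReal.mul_rpow_of_nonneg _ _ hp, enorm_rpow_eq _ hp, ENNReal.ofReal_rpow_of_pos h, ← ENNReal.ofReal_mul (by positivity)]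
  congr 1
  rw [wt, Real.mul_rpow (by positivity) (by positivity), ← Real.rpow_mul (by positivity), ← Real.rpow_mul (by positivity), neg_mul, neg_mul]
  ring

theorem wle {κ x : ℝ} (hκ : 0 ≤ κ) (hx : x ≠ 0) : (1 + |x|) ^ (-κ) ≤ |x| ^ (-κ) :=
  Real.rpow_le_rpow_of_nonpos (abs_pos.2 hx) (by linarith) (by linarith)

theorem ae_ne0 : ∀ᵐ x : ℝ, x ≠ 0 := by
  rw [ae_iff]; simp

theorem one_fin {κ : ℝ} (hκ : 1 < κ) : ∫⁻ y : ℝ, ENNReal.ofReal ((1 + |y|) ^ (-κ)) ≠ ∞ := by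
  have := finite_integral_one_add_norm (E := ℝ) (μ := volume) (r := κ) (by simpa using hκ)
  exact this.ne

theorem fin_real {C : ℝ≥0∞} (hC : C ≠ ∞) {t : ℝ} : C * ENNReal.ofReal t ≤ ENNReal.ofReal ((C.toReal + 1) * t) := by
  rw [ENNReal.ofReal_mul (by positivity)]
  refine mul_le_mul' ?_ le_rfl
  calc C = ENNReal.ofReal C.toReal := (ENNReal.ofReal_toReal hC).symm
    _ ≤ _ := ENNReal.ofReal_le_ofReal (by linarith)

theorem est_of {a b r q N p e : ℝ} (he : N * (p / q - 1) ≤ e) {C : ℝ≥0∞} (hC : C ≠ ∞)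
    (H : ∀ (δ A : ℝ) (G : ℝ → ℂ), Piece r δ A G → ∫⁻ z, WF a b G z ^ p ≤ C * ENNReal.ofReal (A ^ p * δ ^ e)) : Est a b r q N p := by
  refine ⟨C.toReal + 1, by positivity, ?_⟩
  intro δ A G h
  have hd := h.d0
  have ha := h.a0
  refine (H δ A G h).trans ((fin_real hC).trans (ENNReal.ofReal_le_ofReal ?_))
  rw [mul_assoc]
  have := Real.rpow_le_rpow_of_exponent_ge hd h.d1 he
  gcongr

theorem estX {a b r q N p s : ℝ} (hs1 : 1 < s) (hs2 : s ≤ 2) (hsr : s ≤ r) (hp : 0 < p) (ha : 0 ≤ a) (hap : a * p < 1)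
    (ha2 : 1 / p - 1 / (s / (s - 1)) < a) (hb : 1 < b * p) (he : N * (p / q - 1) ≤ (1 - 1 / r) * p - 2 * (1 - a * p)) :
    Est a b r q N p := by
  have hs0 : 0 < s - 1 := by linarith
  obtain ⟨K, hK, HK⟩ := Piece.px hs1 hs2 hsr
  obtain ⟨C, hC, H⟩ := W1s (σ := s / (s - 1)) (by positivity) hp ha hap ha2 hK
  refine est_of he (C := (∫⁻ y : ℝ, ENNReal.ofReal ((1 + |y|) ^ (-(b * p)))) * C) (ENNReal.mul_ne_top (one_fin hb) hC) ?_
  intro δ A G h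
  have hd := h.d0
  have hA := h.a0
  have hm := TT_meas h.m
  simp only [WF_pow hp.le]
  rw [Measure.volume_eq_prod, lintegral_prod_symm _ (by fun_prop), mul_assoc, ← lintegral_mul_const _ (by fun_prop)]
  apply lintegral_mono; intro y
  have hmy : Measurable (fun x => TT G x y) := hm.comp (by fun_prop : Measurable fun x => (x, y))
  have key := H (fun x => ‖TT G x y‖) (A * δ ^ (1 - 1 / r)) (δ ^ (-2:ℝ)) hmy.norm (by positivity) (by positivity)
    (fun x => norm_nonneg _) (fun x => h.bd (by linarith) x y) (HK δ A G h y)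
  have e : (A * δ ^ (1 - 1 / r)) ^ p * (δ ^ (-2:ℝ)) ^ (1 - a * p) = A ^ p * δ ^ ((1 - 1 / r) * p - 2 * (1 - a * p)) := by
    rw [Real.mul_rpow hA (by positivity), ← Real.rpow_mul hd.le, ← Real.rpow_mul hd.le, mul_assoc, ← Real.rpow_add hd]
    congr 2; ring
  rw [e] at key
  refine le_trans ?_ (mul_le_mul' le_rfl key)
  rw [← lintegral_const_mul' _ _ (by simp)]
  apply lintegral_mono_ae
  filter_upwards [ae_ne0] with x hx
  rw [← ENNReal.ofReal_mul (by positivity)]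
  apply ENNReal.ofReal_le_ofReal
  have := wle (show 0 ≤ a * p by positivity) hx
  calc _ ≤ |x| ^ (-(a * p)) * (1 + |y|) ^ (-(b * p)) * ‖TT G x y‖ ^ p := by gcongr
    _ = _ := by ring

theorem estY {a b r q N p s : ℝ} (hs1 : 1 < s) (hs2 : s ≤ 2) (hsr : s ≤ r) (hp : 0 < p) (hb : 0 ≤ b) (hbp : b * p < 1)
    (hb2 : 1 / p - 1 / (s / (s - 1)) < b) (ha : 1 < a * p) (he : N * (p / q - 1) ≤ (1 - 1 / r) * p - (1 - b * p)) :
    Est a b r q N p := by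
  have hs0 : 0 < s - 1 := by linarith
  obtain ⟨K, hK, HK⟩ := Piece.py hs1 hs2 hsr
  obtain ⟨C, hC, H⟩ := W1s (σ := s / (s - 1)) (by positivity) hp hb hbp hb2 hK
  refine est_of he (C := (∫⁻ y : ℝ, ENNReal.ofReal ((1 + |y|) ^ (-(a * p)))) * C) (ENNReal.mul_ne_top (one_fin ha) hC) ?_
  intro δ A G h
  have hd := h.d0
  have hA := h.a0
  have hm := TT_meas h.m
  simp only [WF_pow hp.le]
  rw [Measure.volume_eq_prod, lintegral_prod _ (by fun_prop), mul_assoc, ← lintegral_mul_const _ (by fun_prop)]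
  apply lintegral_mono; intro x
  have hmx : Measurable (fun y => TT G x y) := hm.comp (by fun_prop : Measurable fun y => (x, y))
  have key := H (fun y => ‖TT G x y‖) (A * δ ^ (1 - 1 / r)) (δ ^ (-1:ℝ)) hmx.norm (by positivity) (by positivity)
    (fun y => norm_nonneg _) (fun y => h.bd (by linarith) x y) (HK δ A G h x)
  have e : (A * δ ^ (1 - 1 / r)) ^ p * (δ ^ (-1:ℝ)) ^ (1 - b * p) = A ^ p * δ ^ ((1 - 1 / r) * p - (1 - b * p)) := by
    rw [Real.mul_rpow hA (by positivity), ← Real.rpow_mul hd.le, ← Real.rpow_mul hd.le, mul_assoc, ← Real.rpow_add hd]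
    congr 2; ring
  rw [e] at key
  refine le_trans ?_ (mul_le_mul' le_rfl key)
  rw [← lintegral_const_mul' _ _ (by simp)]
  apply lintegral_mono_ae
  filter_upwards [ae_ne0] with y hy
  rw [← ENNReal.ofReal_mul (by positivity)]
  apply ENNReal.ofReal_le_ofReal
  have := wle (show 0 ≤ b * p by positivity) hy
  calc _ ≤ (1 + |x|) ^ (-(a * p)) * |y| ^ (-(b * p)) * ‖TT G x y‖ ^ p := by gcongr
    _ = _ := by ring

theorem estXY {a b r q N p s : ℝ} (hr4 : r < 4) (hs1 : 1 < s) (hs2 : s ≤ 2) (hsr : s ≤ r) (hp : 0 < p) (ha : 0 ≤ a) (hb : 0 ≤ b)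
    (hap : a * p < 1) (hbp : b * p < 1)
    (ha2 : 1 / p - 1 / (s / (s - 1)) < a) (hb2 : 1 / p - 1 / (s / (s - 1)) < b) (hg : Good (s / (s - 1)) (3 * r / (r - 1)) p a b)
    (he : N * (p / q - 1) ≤ (1 - 1 / r) * p - 2 * (1 - a * p) - (1 - b * p)) :
    Est a b r q N p := by
  have hs0 : 0 < s - 1 := by linarith
  obtain ⟨K1, hK1, HK1⟩ := Piece.px hs1 hs2 hsr
  obtain ⟨K2, hK2, HK2⟩ := Piece.py hs1 hs2 hsr
  obtain ⟨K3, hK3, HK3⟩ := Piece.pz (r := r) (by linarith) hr4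
  obtain ⟨C, hC, H⟩ := W2s (σ := s / (s - 1)) (by positivity) hp ha hb hap hbp ha2 hb2 hg (K := K1 + K2 + K3) (by finiteness)
  refine est_of he hC ?_
  intro δ A G h
  have hd := h.d0
  have hA := h.a0
  have hm := TT_meas h.m
  simp only [WF_pow hp.le]
  rw [Measure.volume_eq_prod, lintegral_prod_symm _ (by fun_prop)]
  have key := H (fun x y => ‖TT G x y‖) (A * δ ^ (1 - 1 / r)) (δ ^ (-2:ℝ)) (δ ^ (-1:ℝ)) hm.norm (by positivity) (by positivity) (by positivity)
    (fun x y => norm_nonneg _) (fun x y => h.bd (by linarith) x y)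
    (fun y => (HK1 δ A G h y).trans (mul_le_mul' (by rw [add_assoc]; exact le_self_add) le_rfl))
    (fun x => (HK2 δ A G h x).trans (mul_le_mul' (le_trans le_add_self le_self_add) le_rfl))
    ((HK3 δ A G h).trans (mul_le_mul' le_add_self le_rfl))
  have e : (A * δ ^ (1 - 1 / r)) ^ p * (δ ^ (-2:ℝ)) ^ (1 - a * p) * (δ ^ (-1:ℝ)) ^ (1 - b * p) = A ^ p * δ ^ ((1 - 1 / r) * p - 2 * (1 - a * p) - (1 - b * p)) := by
    rw [Real.mul_rpow hA (by positivity), ← Real.rpow_mul hd.le, ← Real.rpow_mul hd.le, ← Real.rpow_mul hd.le, mul_assoc, mul_assoc, ← Real.rpow_add hd, ← Real.rpow_add hd]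
    congr 2; ring
  rw [e] at key
  refine le_trans ?_ key
  apply lintegral_mono_ae
  filter_upwards [ae_ne0] with y hy
  apply lintegral_mono_ae
  filter_upwards [ae_ne0] with x hx
  apply ENNReal.ofReal_le_ofReal
  have := wle (show 0 ≤ a * p by positivity) hx
  have := wle (show 0 ≤ b * p by positivity) hy
  gcongr

def Core (a b r q : ℝ) : Prop := ∃ C : ℝ, 0 < C ∧ ∀ F : ℝ → ℂ, Measurable F → Integrable F volume → (∀ φ, φ ∉ Ioc (0:ℝ) 1 → F φ = 0) →
      ∫⁻ z, WF a b F z ^ q ≤ ENNReal.ofReal C * (∫⁻ φ, ‖F φ‖ₑ ^ r) ^ (q / r)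

theorem sig {r : ℝ} (hr : 1 < r) : 1 < min r 2 ∧ min r 2 ≤ 2 ∧ min r 2 ≤ r ∧
    (1 - 1 / r) / 2 < 1 / (min r 2 / (min r 2 - 1)) ∧ (r ≤ 2 → 1 / (min r 2 / (min r 2 - 1)) = 1 - 1 / r) := by
  refine ⟨lt_min hr (by norm_num), min_le_right _ _, min_le_left _ _, ?_, ?_⟩
  · have h1 : 1 / r < 1 := by rw [div_lt_one (by linarith)]; exact hr
    have h2 : 0 < 1 / r := by positivity
    rcases le_total r 2 with h | h
    · have e : (r - 1) / r = 1 - 1 / r := by rw [sub_div, div_self (by linarith)]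
      rw [min_eq_left h, one_div_div, e]; linarith
    · rw [min_eq_right h]; norm_num; rw [one_div] at h2; linarith
  · intro h
    rw [min_eq_left h, one_div_div, sub_div, div_self (by linarith)]

theorem caseIII {a b r q : ℝ} (ha : 0 ≤ a) (hb : 0 ≤ b) (hr : 1 < r) (hrq : r ≤ q)
    (h1 : max a b > 1 / q) (h2 : 2 * min a b = 2 / q - (1 - 1 / r)) : Core a b r q := by
  have hq : 0 < q := by linarith
  obtain ⟨s1, s2, s3, s4, -⟩ := sig hr
  set σ := min r 2 / (min r 2 - 1) with hσ
  have hw : 0 < 1 - 1 / r := by rw [sub_pos, div_lt_one (by linarith)]; exact hr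
  have e2 : 2 / q = 2 * (1 / q) := by ring
  have cp : Tendsto (fun p : ℝ => p) (nhds q) (nhds q) := tendsto_id
  have ci : Tendsto (fun p : ℝ => 1 / p - 1 / σ) (nhds q) (nhds (1 / q - 1 / σ)) := by
    have : ContinuousAt (fun p : ℝ => 1 / p - 1 / σ) q := (ContinuousAt.div (by fun_prop) (by fun_prop) hq.ne').sub (by fun_prop)
    exact this
  have ev0 := cp.eventually (lt_mem_nhds hq)
  have hlt : ∀ {c : ℝ}, c < 1 / q → c * q < 1 := fun h => by rwa [lt_div_iff₀ hq] at h
  have hgt : ∀ {c : ℝ}, 1 / q < c → 1 < c * q := fun h => by rwa [div_lt_iff₀ hq] at h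
  have cm : ∀ c : ℝ, Tendsto (fun p : ℝ => c * p) (nhds q) (nhds (c * q)) := fun c => cp.const_mul c
  rcases le_total a b with hab | hab
  · rw [min_eq_left hab] at h2
    rw [max_eq_right hab] at h1
    refine core_of_est (N := 2) hr hrq (by norm_num) ?_
    filter_upwards [ev0, (cm a).eventually (gt_mem_nhds (hlt (by linarith))), (cm b).eventually (lt_mem_nhds (hgt h1)),
      ci.eventually (gt_mem_nhds (show 1 / q - 1 / σ < a by linarith))] with p p0 p1 p2 p3
    refine estX s1 s2 s3 p0 ha p1 p3 p2 (le_of_eq ?_)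
    have : a = 1 / q - (1 - 1 / r) / 2 := by linarith
    rw [this]; ring
  · rw [min_eq_right hab] at h2
    rw [max_eq_left hab] at h1
    refine core_of_est (N := 1) hr hrq (by norm_num) ?_
    filter_upwards [ev0, (cm b).eventually (gt_mem_nhds (hlt (by linarith))), (cm a).eventually (lt_mem_nhds (hgt h1)),
      ci.eventually (gt_mem_nhds (show 1 / q - 1 / σ < b by linarith))] with p p0 p1 p2 p3
    refine estY s1 s2 s3 p0 hb p1 p3 p2 ?_
    have : b = 1 / q - (1 - 1 / r) / 2 := by linarith
    rw [this]
    have : 0 ≤ (1 - 1 / r) / 2 * p := by positivity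
    have e : (1 - 1 / r) * p - (1 - (1 / q - (1 - 1 / r) / 2) * p) = 1 * (p / q - 1) + (1 - 1 / r) / 2 * p := by ring
    rw [e]; linarith

theorem caseIV {a b r q : ℝ} (ha : 0 ≤ a) (hb : 0 ≤ b) (hr : 1 < r) (hrq : r ≤ q) (hsum : a + b > 2 / q - 1 / 2)
    (h1 : max a b < 1 / q) (h2 : a + b + min a b = 3 / q - (1 - 1 / r)) : Core a b r q := by
  have hq : 0 < q := by linarith
  have hr0 : 0 < r := by linarith
  have hm0 : 0 ≤ min a b := le_min ha hb
  have hiq : 1 / q ≤ 1 / r := one_div_le_one_div_of_le hr0 hrq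
  have hr4 : r < 4 := by
    by_contra hc
    push Not at hc
    have k1 : 1 / r ≤ 1 / 4 := one_div_le_one_div_of_le (by norm_num) hc
    have e3 : 3 / q = 3 * (1 / q) := by ring
    have e2 : 2 / q = 2 * (1 / q) := by ring
    have : 1 / q = 1 / 4 := by linarith
    linarith
  have hw : 0 < 1 - 1 / r := by rw [sub_pos, div_lt_one (by linarith)]; exact hr
  by_cases hz : a + b = 0
  · have ha0 : a = 0 := by linarith
    have hb0 : b = 0 := by linarith
    obtain ⟨C, hC, H⟩ := Zyg hr hr4
    refine ⟨C, hC, ?_⟩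
    intro F hF hFi hFs
    have hq3 : q = 3 * r / (r - 1) := by
      rw [ha0, hb0] at h2
      have h3 : 3 / q = 1 - 1 / r := by rw [min_self] at h2; linarith
      have : r - 1 ≠ 0 := by linarith
      field_simp at h3 ⊢
      linarith
    have := H F hF hFi hFs
    rw [← hq3] at this
    have e1 : q / r = 3 / (r - 1) := by
      rw [hq3]; have : r - 1 ≠ 0 := by linarith
      field_simp
    rw [e1]
    refine le_trans (le_of_eq ?_) this
    apply lintegral_congr; intro z
    rw [WF, wt, ha0, hb0]; simp
  have hab : 0 < a + b := lt_of_le_of_ne (by positivity) (Ne.symm hz)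
  obtain ⟨s1, s2, s3, s4, s5⟩ := sig hr
  set σ := min r 2 / (min r 2 - 1) with hσ
  have hσ0 : 0 < σ := div_pos (by linarith) (by linarith)
  have e3 : 3 / q = 3 * (1 / q) := by ring
  have e2 : 2 / q = 2 * (1 / q) := by ring
  have hmM : min a b + max a b = a + b := min_add_max a b
  have hmle : min a b ≤ max a b := min_le_max
  have ham := min_le_left a b
  have hbm := min_le_right a b
  have haM := le_max_left a b
  have hbM := le_max_right a b
  have cp : Tendsto (fun p : ℝ => p) (nhds q) (nhds q) := tendsto_id
  have ci : ∀ k : ℝ, Tendsto (fun p : ℝ => k / p - 1 / σ) (nhds q) (nhds (k / q - 1 / σ)) := by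
    intro k
    have : ContinuousAt (fun p : ℝ => k / p - 1 / σ) q := (ContinuousAt.div (by fun_prop) (by fun_prop) hq.ne').sub (by fun_prop)
    exact this
  have ev0 := cp.eventually (lt_mem_nhds hq)
  have hlt : ∀ {c : ℝ}, c < 1 / q → c * q < 1 := fun h => by rwa [lt_div_iff₀ hq] at h
  have cm : ∀ c : ℝ, Tendsto (fun p : ℝ => c * p) (nhds q) (nhds (c * q)) := fun c => cp.const_mul c
  set ρ := 3 * r / (r - 1) with hρ
  have hr1 : 0 < r - 1 := by linarith
  have hρ0 : 0 < ρ := by positivity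
  have hσρ : 2 * σ < ρ := by
    rcases le_total r 2 with h | h
    · rw [hσ, min_eq_left h, hρ, ← mul_div_assoc]; gcongr; linarith
    · rw [hσ, min_eq_right h, hρ, lt_div_iff₀ hr1]; norm_num; linarith
  have hρw : 3 / ρ = 1 - 1 / r := by rw [hρ]; field_simp
  have hqρ : q < ρ := by
    have : 3 / ρ < 3 / q := by rw [hρw]; linarith
    exact (div_lt_div_iff_of_pos_left (by norm_num) hρ0 hq).1 this
  have A : q ≤ σ → ∀ᶠ p in nhds q, 2 / p - 1 / σ < a + b := by
    intro hqs
    have hr2 : r ≤ 2 := by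
      by_contra hc
      push Not at hc
      rw [hσ, min_eq_right hc.le] at hqs
      norm_num at hqs; linarith
    refine (ci 2).eventually (gt_mem_nhds ?_)
    rw [s5 hr2]
    linarith
  have B : σ ≤ q → ∀ᶠ p in nhds q, p < ρ ∧ (ρ - p) / (ρ - σ) < (a + b) * p := by
    intro hqs
    refine (cp.eventually (gt_mem_nhds hqρ)).and ?_
    have c1 : Tendsto (fun p : ℝ => (ρ - p) / (ρ - σ)) (nhds q) (nhds ((ρ - q) / (ρ - σ))) := (tendsto_const_nhds.sub cp).div_const _
    refine c1.eventually_lt (cm (a + b)) ?_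
    have g1 : 2 * (1 / q) - 2 * (1 / ρ) ≤ a + b := by
      have : 3 / ρ = 3 * (1 / ρ) := by ring
      linarith
    have g2 : (2 * (1 / q) - 2 * (1 / ρ)) * q ≤ (a + b) * q := mul_le_mul_of_nonneg_right g1 hq.le
    refine lt_of_lt_of_le ?_ g2
    have e : (2 * (1 / q) - 2 * (1 / ρ)) * q = 2 * (ρ - q) / ρ := by field_simp
    rw [e, div_lt_div_iff₀ (by linarith) hρ0]
    have := mul_pos (sub_pos.2 hqρ) (sub_pos.2 hσρ)
    linarith
  have Gd : ∀ᶠ p in nhds q, Good σ ρ p a b := by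
    rcases lt_trichotomy q σ with h | h | h
    · filter_upwards [A h.le, cp.eventually (gt_mem_nhds h)] with p p1 p2
      exact Or.inl ⟨p2, p1⟩
    · filter_upwards [A h.le, B h.ge] with p p1 p2
      rcases lt_or_ge p σ with h3 | h3
      · exact Or.inl ⟨h3, p1⟩
      · exact Or.inr ⟨h3, p2⟩
    · filter_upwards [B h.le, cp.eventually (lt_mem_nhds h)] with p p1 p2
      exact Or.inr ⟨p2.le, p1⟩
  refine core_of_est (N := 3) hr hrq (by norm_num) ?_
  filter_upwards [ev0, Gd, (cm a).eventually (gt_mem_nhds (hlt (by linarith))), (cm b).eventually (gt_mem_nhds (hlt (by linarith))),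
    (ci 1).eventually (gt_mem_nhds (show 1 / q - 1 / σ < a by linarith)), (ci 1).eventually (gt_mem_nhds (show 1 / q - 1 / σ < b by linarith))]
    with p p0 pg p1 p2 p3 p4
  refine estXY hr4 s1 s2 s3 p0 ha hb p1 p2 p3 p4 pg ?_
  have g : 3 * (1 / q) ≤ (1 - 1 / r) + 2 * a + b := by linarith
  have g2 := mul_le_mul_of_nonneg_right g p0.le
  have e : 3 * (p / q - 1) = 3 * (1 / q) * p - 3 := by ring
  rw [e]; linarith

def Adm (a b r q : ℝ) (S : Set ℝ) : Prop := ∃ C : ℝ, 0 < C ∧ ∀ F : ℝ → ℂ, Measurable F → Integrable F volume → (∀ φ, φ ∉ S → F φ = 0) →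
      ∫⁻ z, WF a b F z ^ q ≤ ENNReal.ofReal C * (∫⁻ φ, ‖F φ‖ₑ ^ r) ^ (q / r)

theorem Adm.mono {a b r q : ℝ} {S T : Set ℝ} (h : Adm a b r q T) (hST : S ⊆ T) : Adm a b r q S := by
  obtain ⟨C, hC, H⟩ := h
  exact ⟨C, hC, fun F m i s => H F m i fun φ hφ => s φ fun hc => hφ (hST hc)⟩

theorem Adm.union {a b r q : ℝ} (hr : 1 < r) (hrq : r ≤ q) {S T : Set ℝ} (hSm : MeasurableSet S) (hS : Adm a b r q S) (hT : Adm a b r q T) : Adm a b r q (S ∪ T) := by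
  obtain ⟨C1, hC1, H1⟩ := hS
  obtain ⟨C2, hC2, H2⟩ := hT
  have hr0 : 0 < r := by linarith
  have hq0 : 0 < q := by linarith
  refine ⟨2 ^ (q - 1) * (C1 + C2), by positivity, ?_⟩
  intro F m i s
  have m1 : Measurable (S.indicator F) := m.indicator hSm
  have m2 : Measurable (Sᶜ.indicator F) := m.indicator hSm.compl
  have i1 : Integrable (S.indicator F) volume := i.indicator hSm
  have i2 : Integrable (Sᶜ.indicator F) volume := i.indicator hSm.compl
  have k1 := H1 (S.indicator F) m1 i1 (fun φ hφ => indicator_of_notMem hφ _)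
  have k2 := H2 (Sᶜ.indicator F) m2 i2 (fun φ hφ => by
    by_cases h : φ ∈ S
    · simp [h]
    · simp [h, s φ (by simp [h, hφ])])
  have le : ∀ U : Set ℝ, ∫⁻ φ, ‖U.indicator F φ‖ₑ ^ r ≤ ∫⁻ φ, ‖F φ‖ₑ ^ r := by
    intro U
    apply lintegral_mono; intro φ
    apply ENNReal.rpow_le_rpow _ hr0.le
    exact enorm_indicator_le_enorm_self _ _
  have tri : ∀ z, WF a b F z ≤ WF a b (S.indicator F) z + WF a b (Sᶜ.indicator F) z := by
    intro z
    have e : TT F z.1 z.2 = TT (S.indicator F) z.1 z.2 + TT (Sᶜ.indicator F) z.1 z.2 := by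
      unfold TT
      rw [← integral_add (int_e i1 _ _) (int_e i2 _ _)]
      congr 1; ext φ
      rw [← add_mul]; congr 1
      by_cases h : φ ∈ S <;> simp [h]
    unfold WF
    rw [e, ← add_mul]
    exact mul_le_mul' (enorm_add_le _ _) le_rfl
  set I := (∫⁻ φ, ‖F φ‖ₑ ^ r) ^ (q / r) with hI
  have le2 : ∀ U : Set ℝ, (∫⁻ φ, ‖U.indicator F φ‖ₑ ^ r) ^ (q / r) ≤ I := fun U => ENNReal.rpow_le_rpow (le U) (by positivity)
  calc _ ≤ ∫⁻ z, (2:ℝ≥0∞) ^ (q - 1) * (WF a b (S.indicator F) z ^ q + WF a b (Sᶜ.indicator F) z ^ q) := by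
        apply lintegral_mono; intro z
        exact (ENNReal.rpow_le_rpow (tri z) hq0.le).trans (ENNReal.rpow_add_le_mul_rpow_add_rpow _ _ (by linarith))
    _ = (2:ℝ≥0∞) ^ (q - 1) * ((∫⁻ z, WF a b (S.indicator F) z ^ q) + ∫⁻ z, WF a b (Sᶜ.indicator F) z ^ q) := by
        rw [lintegral_const_mul' _ _ (by finiteness), lintegral_add_left ((WF_meas m1).pow_const _)]
    _ ≤ (2:ℝ≥0∞) ^ (q - 1) * (ENNReal.ofReal C1 * I + ENNReal.ofReal C2 * I) := by
        refine mul_le_mul' le_rfl (add_le_add (k1.trans ?_) (k2.trans ?_))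
        · exact mul_le_mul' le_rfl (le2 _)
        · exact mul_le_mul' le_rfl (le2 _)
    _ = _ := by
        rw [ENNReal.ofReal_mul (by positivity), ENNReal.ofReal_add hC1.le hC2.le, ← add_mul, mul_assoc,
          ← ENNReal.ofReal_rpow_of_pos (by norm_num)]
        simp

theorem Adm.sing {a b r q : ℝ} (hq : 0 < q) (t : ℝ) : Adm a b r q {t} := by
  refine ⟨1, one_pos, ?_⟩
  intro F m i s
  have : ∀ x y, TT F x y = 0 := by
    intro x y
    unfold TT
    apply integral_eq_zero_of_ae
    have : ∀ᵐ φ : ℝ, φ ≠ t := by rw [ae_iff]; simp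
    filter_upwards [this] with φ hφ
    rw [s φ hφ]; simp
  simp [WF, this, hq]

theorem Adm.neg {a b r q : ℝ} {S : Set ℝ} (h : Adm a b r q S) : Adm a b r q {φ | -φ ∈ S} := by
  obtain ⟨C, hC, H⟩ := h
  refine ⟨C, hC, ?_⟩
  intro F m i s
  have k := H (fun ψ => F (-ψ)) (by fun_prop) i.comp_neg (fun φ hφ => s _ (by simpa using hφ))
  have e1 : ∫⁻ φ, ‖F (-φ)‖ₑ ^ r = ∫⁻ φ, ‖F φ‖ₑ ^ r := (Measure.measurePreserving_neg (volume : Measure ℝ)).lintegral_comp (m.enorm.pow_const r)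
  rw [e1] at k
  refine le_trans (le_of_eq ?_) k
  have e2 : ∀ x y, TT F x y = TT (fun ψ => F (-ψ)) x (-y) := by
    intro x y
    unfold TT
    rw [← integral_neg_eq_self]
    congr 1; ext φ
    simp
  have mp : MeasurePreserving (fun z : ℝ × ℝ => (z.1, -z.2)) volume volume :=
    (MeasurePreserving.id (volume : Measure ℝ)).prod (Measure.measurePreserving_neg (volume : Measure ℝ))
  have hm : Measurable (WF a b (fun ψ => F (-ψ))) := WF_meas (by fun_prop)
  rw [← mp.lintegral_comp (hm.pow_const q)]
  apply lintegral_congr; intro z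
  simp only [WF, wt, e2, abs_neg]

theorem Adm.shift {a b r q : ℝ} {S : Set ℝ} (h : Adm b a r q S) : Adm a b r q {φ | φ - π / 2 ∈ S} := by
  obtain ⟨C, hC, H⟩ := h
  refine ⟨C, hC, ?_⟩
  intro F m i s
  have k := H (fun ψ => F (ψ + π / 2)) (by fun_prop) (i.comp_add_right (π / 2)) (fun φ hφ => s _ (by simpa using hφ))
  have e1 : ∫⁻ φ, ‖F (φ + π / 2)‖ₑ ^ r = ∫⁻ φ, ‖F φ‖ₑ ^ r := lintegral_add_right_eq_self (fun φ => ‖F φ‖ₑ ^ r) _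
  rw [e1] at k
  refine le_trans (le_of_eq ?_) k
  have e2 : ∀ x y, TT F x y = TT (fun ψ => F (ψ + π / 2)) y (-x) := by
    intro x y
    unfold TT
    rw [← integral_add_right_eq_self _ (π / 2)]
    congr 1; ext φ
    rw [Real.cos_add_pi_div_two, Real.sin_add_pi_div_two]
    congr 4; ring
  have mp : MeasurePreserving (fun z : ℝ × ℝ => (z.2, -z.1)) volume volume :=
    ((MeasurePreserving.id (volume : Measure ℝ)).prod (Measure.measurePreserving_neg (volume : Measure ℝ))).comp Measure.measurePreserving_swap
  have hm : Measurable (WF b a (fun ψ => F (ψ + π / 2))) := WF_meas (by fun_prop)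
  rw [← mp.lintegral_comp (hm.pow_const q)]
  apply lintegral_congr; intro z
  simp only [WF, wt, e2, abs_neg]
  rw [mul_comm ((1 + |z.1|) ^ (-a))]

theorem adm_all {a b r q : ℝ} (hr : 1 < r) (hrq : r ≤ q) (h1 : Core a b r q) (h2 : Core b a r q) : Adm a b r q (Ioc 0 (2 * π)) := by
  have hq0 : 0 < q := by linarith
  have base : ∀ a b, Core a b r q → Adm a b r q (Icc (-1) 1) := by
    intro a b h
    have h' : Adm a b r q (Ioc 0 1) := h
    have hn : Adm a b r q (Ico (-1) 0) := h'.neg.mono (fun φ hφ => ⟨by linarith [hφ.2], by linarith [hφ.1]⟩)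
    have u := Adm.union hr hrq measurableSet_Ico hn (Adm.union hr hrq (measurableSet_singleton 0) (Adm.sing hq0 0) h')
    refine u.mono ?_
    intro φ hφ
    rcases lt_trichotomy φ 0 with h | h | h
    · exact Or.inl ⟨hφ.1, h⟩
    · exact Or.inr (Or.inl h)
    · exact Or.inr (Or.inr ⟨h, hφ.2⟩)
  have hk : ∀ k : ℕ, Adm a b r q (Icc (k * (π / 2) - 1) (k * (π / 2) + 1)) ∧ Adm b a r q (Icc (k * (π / 2) - 1) (k * (π / 2) + 1)) := by
    intro k
    induction k with
    | zero => simpa using ⟨base a b h1, base b a h2⟩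
    | succ k ih =>
      refine ⟨ih.2.shift.mono ?_, ih.1.shift.mono ?_⟩ <;>
      · intro φ hφ
        have h1 := hφ.1
        have h2 := hφ.2
        push_cast at h1 h2
        exact ⟨by linarith, by linarith⟩
  have hind : ∀ k : ℕ, Adm a b r q (Icc 0 (k * (π / 2) + 1)) := by
    intro k
    induction k with
    | zero => exact (hk 0).1.mono (Icc_subset_Icc (by norm_num) le_rfl)
    | succ k ih =>
      refine (Adm.union hr hrq measurableSet_Icc ih (hk (k+1)).1).mono ?_
      intro φ hφ
      rcases le_total φ (k * (π / 2) + 1) with h | h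
      · exact Or.inl ⟨hφ.1, h⟩
      · refine Or.inr ⟨?_, hφ.2⟩
        push_cast
        linarith [Real.pi_lt_four]
  refine (hind 4).mono ?_
  intro φ hφ
  exact ⟨hφ.1.le, by push_cast; linarith [hφ.2]⟩

/-- Theorem 3 (sufficiency, endpoint cases): weighted restriction estimates for
`R*_{α,β}` with `1 < r ≤ q < ∞` (real exponents). -/
theorem statement1 (α β : ℝ) (hα : 0 ≤ α) (hβ : 0 ≤ β)
    (r q : ℝ) (hr : 1 < r) (hrq : r ≤ q)
    (hsum : α + β > 2 / q - 1 / 2)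
    (hcase :
      (max α β > 1 / q ∧ 2 * min α β = 2 / q - (1 - 1 / r)) ∨
      (max α β < 1 / q ∧ α + β + min α β = 3 / q - (1 - 1 / r))) :
    ∃ C : ℝ, 0 < C ∧ ∀ F : ℝ → ℂ, Measurable F →
      planeLp (ENNReal.ofReal q) (fun p => Rab α β F p.1 p.2) ≤
        ENNReal.ofReal C * circleLp (ENNReal.ofReal r) F := by
  obtain ⟨C, hC, H⟩ : Adm α β r q (Ioc 0 (2 * π)) := by
    rcases hcase with ⟨h1, h2⟩ | ⟨h1, h2⟩
    · exact adm_all hr hrq (caseIII hα hβ hr hrq h1 h2)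
        (caseIII hβ hα hr hrq (by rwa [max_comm]) (by rwa [min_comm]))
    · exact adm_all hr hrq (caseIV hα hβ hr hrq hsum h1 h2)
        (caseIV hβ hα hr hrq (by rwa [add_comm]) (by rwa [max_comm])
          (by rwa [min_comm, add_comm β α]))
  have hr0 : 0 < r := by linarith
  have hq0 : 0 < q := by linarith
  refine ⟨C ^ (1 / q), by positivity, ?_⟩
  intro F m
  have hc : circleLp (ENNReal.ofReal r) F
      = (∫⁻ φ in Ioc (0:ℝ) (2 * π), ‖F φ‖ₑ ^ r) ^ (1 / r) := by
    unfold circleLp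
    rw [eLpNorm_eq_lintegral_rpow_enorm_toReal (by simpa using hr0) ENNReal.ofReal_ne_top,
      ENNReal.toReal_ofReal hr0.le]
  by_cases htop : circleLp (ENNReal.ofReal r) F = ∞
  · rw [htop, ENNReal.mul_top]
    · exact le_top
    · have : 0 < C ^ (1 / q) := by positivity
      simpa using this
  have hmem : MemLp F (ENNReal.ofReal r) (volume.restrict (Ioc (0:ℝ) (2 * π))) :=
    ⟨m.aestronglyMeasurable, lt_top_iff_ne_top.2 htop⟩
  have hint : IntegrableOn F (Ioc (0:ℝ) (2 * π)) volume :=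
    hmem.integrable (by rw [← ENNReal.ofReal_one]; exact ENNReal.ofReal_le_ofReal hr.le)
  set F0 := (Ioc (0:ℝ) (2 * π)).indicator F with hF0
  have k := H F0 (m.indicator measurableSet_Ioc)
    ((integrable_indicator_iff measurableSet_Ioc).2 hint)
    (fun φ hφ => indicator_of_notMem hφ _)
  have eI : ∫⁻ φ, ‖F0 φ‖ₑ ^ r = ∫⁻ φ in Ioc (0:ℝ) (2 * π), ‖F φ‖ₑ ^ r := by
    rw [← lintegral_indicator measurableSet_Ioc]
    apply lintegral_congr; intro φ
    by_cases h : φ ∈ Ioc (0:ℝ) (2 * π)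
    · simp only [hF0, indicator_of_mem h]
    · simp only [hF0, indicator_of_notMem h]
      simp [hr0]
  rw [eI] at k
  have eT : ∀ x y, Rext F x y = Complex.ofReal (1 / (2 * π)) * TT F0 x y := by
    intro x y
    unfold Rext TT
    rw [intervalIntegral.integral_of_le (by positivity), ← integral_indicator measurableSet_Ioc]
    congr 2; ext φ
    by_cases h : φ ∈ Ioc (0:ℝ) (2 * π)
    · simp only [hF0, indicator_of_mem h]
    · simp only [hF0, indicator_of_notMem h, zero_mul]
  have hle : ∀ z : ℝ × ℝ, ‖Rab α β F z.1 z.2‖ₑ ≤ WF α β F0 z := by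
    intro z
    unfold Rab WF
    rw [eT, enorm_mul, enorm_mul]
    have c1 : ‖Complex.ofReal (1 / (2 * π))‖ₑ ≤ 1 := by
      rw [← ofReal_norm_eq_enorm, ← ENNReal.ofReal_one]
      apply ENNReal.ofReal_le_ofReal
      rw [Complex.norm_real, Real.norm_of_nonneg (by positivity), div_le_one (by positivity)]
      linarith [Real.pi_gt_three]
    have c2 : ‖Complex.ofReal ((1 + |z.1|) ^ (-α) * (1 + |z.2|) ^ (-β))‖ₑ
        = ENNReal.ofReal (wt α β z) := by
      rw [← ofReal_norm_eq_enorm, Complex.norm_real, Real.norm_of_nonneg (by positivity)]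
      rfl
    rw [c2]
    refine mul_le_mul' ?_ le_rfl
    calc _ ≤ 1 * ‖TT F0 z.1 z.2‖ₑ := mul_le_mul' c1 le_rfl
      _ = _ := one_mul _
  rw [hc]
  unfold planeLp
  rw [eLpNorm_eq_lintegral_rpow_enorm_toReal (by simpa using hq0) ENNReal.ofReal_ne_top,
      ENNReal.toReal_ofReal hq0.le]
  calc (∫⁻ z : ℝ × ℝ, ‖Rab α β F z.1 z.2‖ₑ ^ q) ^ (1 / q)
      ≤ (ENNReal.ofReal C * (∫⁻ φ in Ioc (0:ℝ) (2 * π), ‖F φ‖ₑ ^ r) ^ (q / r)) ^ (1 / q) := by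
        apply ENNReal.rpow_le_rpow _ (by positivity)
        refine le_trans (lintegral_mono fun z => ?_) k
        exact ENNReal.rpow_le_rpow (hle z) hq0.le
    _ = _ := by
        rw [ENNReal.mul_rpow_of_nonneg _ _ (by positivity), ← ENNReal.rpow_mul,
          ENNReal.ofReal_rpow_of_pos hC]
        congr 2
        field_simp
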